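/- For every k ≥ 2, every 1 ≤ d ≤ k−1 and every μ > 0, there is C > 0 with the following property. Suppose p ≥ C·n^{−k+1}·log n, let n be divisible by k−1, and let G be an n-vertex k-graph with δ_d(G) ≥ (th_d(ham_{k,1}) + μ)·binom(n−d, k−d). Then the random sparsification G_p contains a loose Hamilton cycle with high probability. -/

import Mathlib

/-- `G` is a `k`-uniform hypergraph on vertex set `Fin n`. -/
def IsHG (k n : ℕ) (G : Finset (Finset (Fin n))) : Prop := ∀ e ∈ G, e.card = k

/-- Minimum `d`-degree of `G` is at least `m` (as a real number). -/
def MinDegGE {n : ℕ} (G : Finset (Finset (Fin n))) (d : ℕ) (m : ℝ) : Prop :=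
  ∀ S : Finset (Fin n), S.card = d → m ≤ ((G.filter (fun e => S ⊆ e)).card : ℝ)

open Classical in
/-- Probability that the random sparsification of `G` (each edge kept
independently with probability `p`) satisfies `Q`. -/
noncomputable def sparsProb {α : Type*} [DecidableEq α] (G : Finset α) (p : ℝ)
    (Q : Finset α → Prop) : ℝ :=
  ∑ E ∈ G.powerset, if Q E then p ^ E.card * (1 - p) ^ (G.card - E.card) else 0

/-- The edge set `E` on `Fin n` contains a Hamilton `ℓ`-cycle: a cyclic
ordering of all vertices with edges consisting of `k` consecutive vertices,
placed at offsets that are multiples of `k - ℓ` (so consecutive edges meet in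
exactly `ℓ` vertices and all vertices are covered). -/
def HasHamLCycle (k ℓ n : ℕ) (E : Finset (Finset (Fin n))) : Prop :=
  ∃ f : ℕ → Fin n, (∀ i, f (i + n) = f i) ∧ Set.InjOn f (Set.Iio n) ∧
    (∀ v : Fin n, ∃ i < n, f i = v) ∧
    ∀ t : ℕ, (Finset.image (fun j : Fin k => f (t * (k - ℓ) + (j : ℕ))) Finset.univ) ∈ E

/-- The minimum `d`-degree threshold `th_d(ham_{k,1})` for loose Hamilton
cycles in `k`-graphs. -/
noncomputable def looseHamThreshold (k d : ℕ) : ℝ :=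
  sInf {δ : ℝ | 0 ≤ δ ∧ δ ≤ 1 ∧ ∀ μ : ℝ, 0 < μ → ∃ n₀ : ℕ, ∀ n, n₀ ≤ n →
    (k - 1) ∣ n →
    ∀ G : Finset (Finset (Fin n)), IsHG k n G →
      MinDegGE G d ((δ + μ) * (((n - d).choose (k - d) : ℕ) : ℝ)) →
      HasHamLCycle k 1 n G}

namespace LooseHam

section SpreadLemma

set_option linter.unusedSectionVars false

variable {α : Type*} [DecidableEq α]

/-- Expectation of `Φ` over the binomial random subset of `X` with density `p`. -/
noncomputable def binomExp (p : ℝ) (X : Finset α) (Φ : Finset α → ℝ) : ℝ :=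
  ∑ W ∈ X.powerset, p ^ W.card * (1 - p) ^ (X.card - W.card) * Φ W

theorem binomExp_empty (p : ℝ) (Φ : Finset α → ℝ) : binomExp p ∅ Φ = Φ ∅ := by
  simp [binomExp]

theorem binomExp_insert (p : ℝ) {X : Finset α} {a : α} (ha : a ∉ X) (Φ : Finset α → ℝ) :
    binomExp p (insert a X) Φ =
      p * binomExp p X (fun W => Φ (insert a W)) + (1 - p) * binomExp p X Φ := by
  unfold binomExp
  rw [Finset.sum_powerset_insert ha, Finset.mul_sum, Finset.mul_sum, add_comm]
  congr 1
  · refine Finset.sum_congr rfl fun W hW => ?_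
    have hWX := Finset.mem_powerset.1 hW
    have haW : a ∉ W := fun h => ha (hWX h)
    rw [Finset.card_insert_of_notMem ha, Finset.card_insert_of_notMem haW,
      Nat.add_sub_add_right]
    ring
  · refine Finset.sum_congr rfl fun W hW => ?_
    have hWX := Finset.card_le_card (Finset.mem_powerset.1 hW)
    rw [Finset.card_insert_of_notMem ha, Nat.sub_add_comm hWX]
    ring

theorem binomExp_const (p : ℝ) (X : Finset α) (c : ℝ) : binomExp p X (fun _ => c) = c := by
  induction X using Finset.induction_on with
  | empty => simp [binomExp_empty]
  | insert a X ha ih => rw [binomExp_insert p ha, ih]; ring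

theorem binomExp_add (p : ℝ) (X : Finset α) (Φ Ψ : Finset α → ℝ) :
    binomExp p X (fun W => Φ W + Ψ W) = binomExp p X Φ + binomExp p X Ψ := by
  simp only [binomExp, mul_add, Finset.sum_add_distrib]

theorem binomExp_const_mul (p : ℝ) (X : Finset α) (c : ℝ) (Φ : Finset α → ℝ) :
    binomExp p X (fun W => c * Φ W) = c * binomExp p X Φ := by
  simp only [binomExp, Finset.mul_sum]
  exact Finset.sum_congr rfl fun _ _ => by ring

theorem binomExp_mono {p : ℝ} (h0 : 0 ≤ p) (h1 : p ≤ 1) {X : Finset α} {Φ Ψ : Finset α → ℝ}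
    (h : ∀ W ⊆ X, Φ W ≤ Ψ W) : binomExp p X Φ ≤ binomExp p X Ψ :=
  Finset.sum_le_sum fun W hW => mul_le_mul_of_nonneg_left (h W (Finset.mem_powerset.1 hW))
    (mul_nonneg (pow_nonneg h0 _) (pow_nonneg (sub_nonneg.2 h1) _))

/-- The union of two independent binomial random subsets is a binomial random subset. -/
theorem binomExp_union (p₁ p₂ : ℝ) (X : Finset α) (Φ : Finset α → ℝ) :
    binomExp p₁ X (fun W₁ => binomExp p₂ X (fun W₂ => Φ (W₁ ∪ W₂))) =
      binomExp (p₁ + p₂ - p₁ * p₂) X Φ := by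
  induction X using Finset.induction_on generalizing Φ with
  | empty => simp [binomExp_empty]
  | insert a X ha ih =>
    simp only [binomExp_insert _ ha, binomExp_add, binomExp_const_mul, Finset.insert_union,
      Finset.union_insert, Finset.insert_idem]
    rw [ih (fun W => Φ (insert a W)), ih Φ]
    ring

variable {ι : Type*} [Fintype ι]

/-- The family `S` restricted to `J`, with weights `w`, is `q`-spread. -/
def IsSpread (w : ι → ℝ) (q : ℝ) (J : Finset ι) (S : ι → Finset α) : Prop :=
  ∀ T : Finset α, ∑ i ∈ J with T ⊆ S i, w i ≤ q ^ T.card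

/-- Minimal fragments: a set `χ i ⊆ S i` outside of `W`, such that `χ i ∪ W` contains a member of
the family and `χ i` is contained in every such member. -/
theorem exists_fragment (J : Finset ι) (S : ι → Finset α) (W : Finset α) :
    ∃ χ : ι → Finset α, ∀ i ∈ J, χ i ⊆ S i ∧ Disjoint (χ i) W ∧ (∃ j ∈ J, S j ⊆ χ i ∪ W) ∧
      ∀ j ∈ J, S j ⊆ χ i ∪ W → χ i ⊆ S j := by
  have key : ∀ i : ι, ∃ χ : Finset α, i ∈ J → χ ⊆ S i ∧ Disjoint χ W ∧
      (∃ j ∈ J, S j ⊆ χ ∪ W) ∧ ∀ j ∈ J, S j ⊆ χ ∪ W → χ ⊆ S j := by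
    intro i
    by_cases hi : i ∈ J
    · obtain ⟨j, hj, hmin⟩ := Finset.exists_min_image (J.filter fun j => S j ⊆ S i ∪ W)
        (fun j => (S j \ W).card) ⟨i, by simp [hi]⟩
      rw [Finset.mem_filter] at hj
      refine ⟨S j \ W, fun _ => ⟨?_, Finset.sdiff_disjoint, ⟨j, hj.1, by simp⟩, ?_⟩⟩
      · intro x hx
        rw [Finset.mem_sdiff] at hx
        exact (Finset.mem_union.1 (hj.2 hx.1)).resolve_right hx.2
      · intro j' hj' hsub
        have hsub' : S j' \ W ⊆ S j \ W := by
          intro x hx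
          rw [Finset.mem_sdiff] at hx
          exact (Finset.mem_union.1 (hsub hx.1)).resolve_right hx.2
        have hle := hmin j' (Finset.mem_filter.2 ⟨hj', fun x hx => by
          have h1 := hsub hx
          have h2 := hj.2
          simp only [Finset.mem_union, Finset.mem_sdiff] at h1 ⊢
          rcases h1 with h1 | h1
          · have := h2 h1.1
            simpa using this
          · exact Or.inr h1⟩)
        have := Finset.eq_of_subset_of_card_le hsub' hle
        rw [← this]
        exact Finset.sdiff_subset
    · exact ⟨∅, fun h => absurd h hi⟩
  choose χ hχ using key
  exact ⟨χ, fun i hi => hχ i hi⟩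

/-- The expected weight of large minimal fragments is small. -/
theorem binomExp_large_fragment_le {w : ι → ℝ} (hw : ∀ i, 0 ≤ w i) {p q : ℝ} (hq : 0 ≤ q)
    (hqp : q ≤ p) (hp : 0 < p) (hp1 : p ≤ 1) {J : Finset ι} {S : ι → Finset α} {X : Finset α}
    (hS : IsSpread w q J S) (hX : ∀ i ∈ J, S i ⊆ X) {l : ℕ} (hl : ∀ i ∈ J, (S i).card ≤ l)
    (l' : ℕ) (χ : Finset α → ι → Finset α)
    (hχ : ∀ W, ∀ i ∈ J, χ W i ⊆ S i ∧ Disjoint (χ W i) W ∧ (∃ j ∈ J, S j ⊆ χ W i ∪ W) ∧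
      ∀ j ∈ J, S j ⊆ χ W i ∪ W → χ W i ⊆ S j) :
    binomExp p X (fun W => ∑ i ∈ J with l' < (χ W i).card, w i) ≤
      2 ^ l * (q / p) ^ (l' + 1) := by
  classical
  have hsel : ∀ Z : Finset α, ∃ M : Finset α, M.card ≤ l ∧ ∀ W, ∀ i ∈ J, χ W i ∪ W = Z →
      χ W i ⊆ M := by
    intro Z
    by_cases h : ∃ j ∈ J, S j ⊆ Z
    · obtain ⟨j, hj, hjZ⟩ := h
      exact ⟨S j, hl j hj, fun W i hi hZ => (hχ W i hi).2.2.2 j hj (hZ ▸ hjZ)⟩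
    · refine ⟨∅, by simp, fun W i hi hZ => ?_⟩
      obtain ⟨j, hj, hsub⟩ := (hχ W i hi).2.2.1
      exact absurd ⟨j, hj, hZ ▸ hsub⟩ h
  choose M hMl hM using hsel
  set B : Finset α → Finset (Finset α) := fun Z => (M Z).powerset.filter fun T =>
    l' < T.card ∧ T ⊆ Z
  set wt : Finset α → ℝ := fun W => p ^ W.card * (1 - p) ^ (X.card - W.card) with hwt
  have hwt0 : ∀ W, 0 ≤ wt W := fun W =>
    mul_nonneg (pow_nonneg hp.le _) (pow_nonneg (sub_nonneg.2 hp1) _)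
  have hstep : binomExp p X (fun W => ∑ i ∈ J with l' < (χ W i).card, w i) ≤
      ∑ i ∈ J, ∑ Z ∈ X.powerset, ∑ T ∈ B Z, if T ⊆ S i then w i * wt (Z \ T) else 0 := by
    have : binomExp p X (fun W => ∑ i ∈ J with l' < (χ W i).card, w i) =
        ∑ i ∈ J, ∑ W ∈ X.powerset with l' < (χ W i).card, wt W * w i := by
      simp only [binomExp, Finset.mul_sum, Finset.sum_filter]
      rw [Finset.sum_comm]
      refine Finset.sum_congr rfl fun i _ => Finset.sum_congr rfl fun W _ => ?_
      split_ifs <;> simp [hwt]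
    rw [this]
    refine Finset.sum_le_sum fun i hi => ?_
    rw [Finset.sum_sigma']
    rw [← Finset.sum_filter]
    set φ : Finset α → (_ : Finset α) × Finset α := fun W => ⟨χ W i ∪ W, χ W i⟩ with hφ
    have hdiff : ∀ W, (χ W i ∪ W) \ χ W i = W := fun W => by
      rw [Finset.union_sdiff_left]
      exact Finset.sdiff_eq_self_of_disjoint (hχ W i hi).2.1.symm
    have hinj : Set.InjOn φ (X.powerset.filter fun W => l' < (χ W i).card) := by
      intro W _ W' _ h
      simp only [hφ, Sigma.mk.injEq, heq_eq_eq] at h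
      rw [← hdiff W, ← hdiff W', h.1, h.2]
    have hval : ∑ W ∈ X.powerset with l' < (χ W i).card, wt W * w i =
        ∑ x ∈ (X.powerset.filter fun W => l' < (χ W i).card).image φ,
          w i * wt (x.1 \ x.2) := by
      rw [Finset.sum_image hinj]
      exact Finset.sum_congr rfl fun W _ => by simp only [hφ, hdiff]; ring
    rw [hval]
    refine Finset.sum_le_sum_of_subset_of_nonneg ?_ fun x _ _ => mul_nonneg (hw i) (hwt0 _)
    intro x hx
    obtain ⟨W, hW, rfl⟩ := Finset.mem_image.1 hx
    rw [Finset.mem_filter, Finset.mem_powerset] at hW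
    simp only [hφ, B, Finset.mem_filter, Finset.mem_sigma, Finset.mem_powerset]
    exact ⟨⟨Finset.union_subset ((hχ W i hi).1.trans (hX i hi)) hW.1, hM _ W i hi rfl, hW.2,
      Finset.subset_union_left⟩, (hχ W i hi).1⟩
  refine hstep.trans ?_
  have hterm : ∀ Z ∈ X.powerset, ∀ T ∈ B Z, (∑ i ∈ J with T ⊆ S i, w i) * wt (Z \ T) ≤
      wt Z * (q / p) ^ (l' + 1) := by
    intro Z hZ T hT
    simp only [B, Finset.mem_filter, Finset.mem_powerset] at hT hZ
    obtain ⟨-, hT1, hT2⟩ := hT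
    have hc := Finset.card_sdiff_of_subset hT2
    have hcT := Finset.card_le_card hT2
    have hcZ := Finset.card_le_card hZ
    have h1 : wt (Z \ T) * p ^ T.card ≤ wt Z := by
      simp only [hwt, hc]
      have e1 : p ^ (Z.card - T.card) * (1 - p) ^ (X.card - (Z.card - T.card)) * p ^ T.card =
          p ^ Z.card * (1 - p) ^ (X.card - Z.card) * (1 - p) ^ T.card := by
        rw [show X.card - (Z.card - T.card) = (X.card - Z.card) + T.card by omega, pow_add]
        conv_rhs => rw [show Z.card = (Z.card - T.card) + T.card by omega, pow_add]
        rw [show Z.card - T.card + T.card = Z.card by omega]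
        ring
      rw [e1]
      exact mul_le_of_le_one_right (hwt0 Z) (pow_le_one₀ (sub_nonneg.2 hp1) (by linarith))
    have h2 : (q / p) ^ T.card ≤ (q / p) ^ (l' + 1) :=
      pow_le_pow_of_le_one (by positivity) ((div_le_one hp).2 hqp) hT1
    calc (∑ i ∈ J with T ⊆ S i, w i) * wt (Z \ T)
        ≤ q ^ T.card * wt (Z \ T) := mul_le_mul_of_nonneg_right (hS T) (hwt0 _)
      _ = (wt (Z \ T) * p ^ T.card) * (q / p) ^ T.card := by
          rw [div_pow]; field_simp
      _ ≤ wt Z * (q / p) ^ T.card := mul_le_mul_of_nonneg_right h1 (by positivity)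
      _ ≤ wt Z * (q / p) ^ (l' + 1) := mul_le_mul_of_nonneg_left h2 (hwt0 Z)
  have hswap : ∑ i ∈ J, ∑ Z ∈ X.powerset, ∑ T ∈ B Z, (if T ⊆ S i then w i * wt (Z \ T) else 0) =
      ∑ Z ∈ X.powerset, ∑ T ∈ B Z, (∑ i ∈ J with T ⊆ S i, w i) * wt (Z \ T) := by
    rw [Finset.sum_comm]
    refine Finset.sum_congr rfl fun Z _ => ?_
    rw [Finset.sum_comm]
    refine Finset.sum_congr rfl fun T _ => ?_
    rw [Finset.sum_filter, Finset.sum_mul]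
    exact Finset.sum_congr rfl fun i _ => by split_ifs <;> simp
  rw [hswap]
  calc ∑ Z ∈ X.powerset, ∑ T ∈ B Z, (∑ i ∈ J with T ⊆ S i, w i) * wt (Z \ T)
      ≤ ∑ Z ∈ X.powerset, wt Z * (2 ^ l * (q / p) ^ (l' + 1)) := by
        refine Finset.sum_le_sum fun Z hZ => ?_
        refine (Finset.sum_le_card_nsmul _ _ _ (hterm Z hZ)).trans ?_
        rw [nsmul_eq_mul]
        have hB : ((B Z).card : ℝ) ≤ 2 ^ l := by
          have h1 : (B Z).card ≤ 2 ^ l :=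
            (Finset.card_filter_le _ _).trans (by
              rw [Finset.card_powerset]; exact Nat.pow_le_pow_right (by norm_num) (hMl Z))
          exact_mod_cast h1
        have h0 : 0 ≤ wt Z * (q / p) ^ (l' + 1) := mul_nonneg (hwt0 Z) (by positivity)
        nlinarith [mul_le_mul_of_nonneg_right hB h0]
    _ = 2 ^ l * (q / p) ^ (l' + 1) := binomExp_const p X _

/-- The probability that the binomial random subset of `X` contains no set `S i` with `i ∈ J`. -/
noncomputable def missProb (p : ℝ) (X : Finset α) (J : Finset ι) (S : ι → Finset α) : ℝ :=
  binomExp p X fun W => open Classical in if ∃ i ∈ J, S i ⊆ W then 0 else 1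

theorem missProb_le_one {p : ℝ} (h0 : 0 ≤ p) (h1 : p ≤ 1) (X : Finset α) (J : Finset ι)
    (S : ι → Finset α) : missProb p X J S ≤ 1 := by
  refine (binomExp_mono h0 h1 fun W _ => ?_).trans_eq (binomExp_const p X 1)
  split_ifs <;> norm_num

theorem missProb_anti {p p' : ℝ} (h0 : 0 ≤ p) (hpp : p ≤ p') (h1 : p' ≤ 1) (X : Finset α)
    (J : Finset ι) (S : ι → Finset α) : missProb p' X J S ≤ missProb p X J S := by
  classical
  rcases eq_or_lt_of_le (hpp.trans h1) with rfl | hlt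
  · rw [le_antisymm h1 hpp]
  set r := (p' - p) / (1 - p) with hr
  have hr0 : 0 ≤ r := div_nonneg (by linarith) (by linarith)
  have hr1 : r ≤ 1 := (div_le_one (by linarith)).2 (by linarith)
  have hp' : p' = p + r - p * r := by
    rw [hr]; field_simp [(sub_pos.2 hlt).ne']; ring
  rw [missProb, hp', ← binomExp_union, missProb]
  refine binomExp_mono h0 hlt.le fun W _ => ?_
  refine (binomExp_mono hr0 hr1 fun W' _ => ?_).trans_eq (binomExp_const r X _)
  by_cases h : ∃ i ∈ J, S i ⊆ W
  · obtain ⟨i, hi, hiW⟩ := h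
    rw [if_pos ⟨i, hi, hiW.trans Finset.subset_union_left⟩, if_pos ⟨i, hi, hiW⟩]
  · rw [if_neg h]; split_ifs <;> norm_num

/-- One round of exposure. -/
theorem missProb_round {w : ι → ℝ} (hw : ∀ i, 0 ≤ w i) {p p' q : ℝ} (hq : 0 ≤ q)
    (hqp : q ≤ p) (hp : 0 < p) (hp1 : p ≤ 1) (hp0' : 0 ≤ p') (hp1' : p' ≤ 1) {J : Finset ι}
    {S : ι → Finset α} {X : Finset α}
    (hS : IsSpread w q J S) (hX : ∀ i ∈ J, S i ⊆ X) {l : ℕ} (hl : ∀ i ∈ J, (S i).card ≤ l)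
    (l' : ℕ) {ε : ℝ}
    (hnext : ∀ (J' : Finset ι) (S' : ι → Finset α), IsSpread w q J' S' → (∀ i ∈ J', S' i ⊆ X) →
      (∀ i ∈ J', (S' i).card ≤ l') → (∑ i ∈ J', w i) * missProb p' X J' S' ≤ ε) :
    (∑ i ∈ J, w i) * missProb (p + p' - p * p') X J S ≤ 2 ^ l * (q / p) ^ (l' + 1) + ε := by
  classical
  choose χ hχ using fun W => exists_fragment J S W
  have h1 := binomExp_large_fragment_le hw hq hqp hp hp1 hS hX hl l' χ hχ
  rw [missProb, ← binomExp_union, ← binomExp_const_mul]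
  calc _ ≤ binomExp p X (fun W => (∑ i ∈ J with l' < (χ W i).card, w i) + ε) := by
        refine binomExp_mono hp.le hp1 fun W hW => ?_
        set J' := J.filter fun i => ¬ l' < (χ W i).card
        have hJ' : ∀ i ∈ J', i ∈ J ∧ (χ W i).card ≤ l' := fun i hi => by
          simpa [J'] using hi
        have hspread : IsSpread w q J' (χ W) := fun T => by
          refine le_trans (Finset.sum_le_sum_of_subset_of_nonneg ?_ fun i _ _ => hw i) (hS T)
          intro i hi
          rw [Finset.mem_filter] at hi ⊢
          exact ⟨(hJ' i hi.1).1, hi.2.trans (hχ W i (hJ' i hi.1).1).1⟩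
        have hε := hnext J' (χ W) hspread
          (fun i hi => (hχ W i (hJ' i hi).1).1.trans (hX i (hJ' i hi).1)) fun i hi => (hJ' i hi).2
        set F := binomExp p' X fun W₂ => if ∃ i ∈ J, S i ⊆ W ∪ W₂ then (0 : ℝ) else 1
        have hF1 : F ≤ missProb p' X J' (χ W) := by
          refine binomExp_mono hp0' hp1' fun W₂ _ => ?_
          by_cases h : ∃ i ∈ J', χ W i ⊆ W₂
          · obtain ⟨i, hi, hiW⟩ := h
            obtain ⟨j, hj, hjW⟩ := (hχ W i (hJ' i hi).1).2.2.1
            have hj' : S j ⊆ W ∪ W₂ := hjW.trans (by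
              rw [Finset.union_comm]; exact Finset.union_subset_union_right hiW)
            rw [if_pos ⟨j, hj, hj'⟩, if_pos ⟨i, hi, hiW⟩]
          · rw [if_neg h]; split_ifs <;> norm_num
        have hF2 := hF1.trans (missProb_le_one hp0' hp1' X J' (χ W))
        rw [← Finset.sum_filter_add_sum_filter_not J (fun i => l' < (χ W i).card) w, add_mul]
        refine add_le_add (mul_le_of_le_one_right (Finset.sum_nonneg fun i _ => hw i) hF2)
          (le_trans (mul_le_mul_of_nonneg_left hF1 (Finset.sum_nonneg fun i _ => hw i)) hε)
    _ ≤ _ := by rw [binomExp_add, binomExp_const]; linarith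

/-- The final round of exposure. -/
theorem missProb_final {w : ι → ℝ} (hw : ∀ i, 0 ≤ w i) {p q : ℝ} (hq : 0 ≤ q)
    (hqp : q ≤ p) (hp : 0 < p) (hp1 : p ≤ 1) {J : Finset ι}
    {S : ι → Finset α} {X : Finset α}
    (hS : IsSpread w q J S) (hX : ∀ i ∈ J, S i ⊆ X) {l : ℕ} (hl : ∀ i ∈ J, (S i).card ≤ l) :
    (∑ i ∈ J, w i) * missProb p X J S ≤ 2 ^ l * (q / p) := by
  have h := missProb_round hw hq hqp hp hp1 le_rfl zero_le_one hS hX hl 0 (p' := 0) (ε := 0) ?_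
  · simpa using h
  · intro J' S' _ _ hc
    rcases J'.eq_empty_or_nonempty with rfl | ⟨i, hi⟩
    · simp
    · have : missProb 0 X J' S' = 0 := by
        have h1 : ∀ W : Finset α, ∃ i ∈ J', S' i ⊆ W := fun W =>
          ⟨i, hi, by rw [Finset.card_eq_zero.1 (Nat.le_zero.1 (hc i hi))]; exact W.empty_subset⟩
        simp only [missProb, if_pos (h1 _)]
        exact binomExp_const 0 X 0
      rw [this, mul_zero]

theorem missProb_rounds {w : ι → ℝ} (hw : ∀ i, 0 ≤ w i) {q p' : ℝ} (hq : 0 < q)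
    (hq1 : 1024 * q ≤ 1) (hp1' : p' ≤ 1) (hqp' : q ≤ p') {X : Finset α} {s : ℕ}
    (m : ℕ) {J : Finset ι} {S : ι → Finset α}
    (hS : IsSpread w q J S) (hX : ∀ i ∈ J, S i ⊆ X) (hl : ∀ i ∈ J, (S i).card ≤ s * 2 ^ m) :
    (∑ i ∈ J, w i) * missProb (1 - (1 - 1024 * q) ^ m * (1 - p')) X J S ≤
      m * (1 / 16) ^ s + 2 ^ s * (q / p') := by
  induction m generalizing J S with
  | zero =>
    simpa using missProb_final hw hq.le hqp' (hq.trans_le hqp') hp1' hS hX (l := s) (by simpa using hl)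
  | succ m ih =>
    have ha0 : 0 ≤ (1 - 1024 * q) ^ m := pow_nonneg (by linarith) _
    have ha1 : (1 - 1024 * q) ^ m ≤ 1 := pow_le_one₀ (by linarith) (by linarith)
    have h := missProb_round hw hq.le (p := 1024 * q) (by linarith) (by linarith) hq1
      (p' := 1 - (1 - 1024 * q) ^ m * (1 - p')) (by nlinarith) (by nlinarith) hS hX hl (s * 2 ^ m)
      (fun J' S' h1 h2 h3 => ih h1 h2 h3)
    rw [show 1 - (1 - 1024 * q) ^ (m + 1) * (1 - p') = 1024 * q + (1 - (1 - 1024 * q) ^ m * (1 - p'))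
      - 1024 * q * (1 - (1 - 1024 * q) ^ m * (1 - p')) by ring]
    refine h.trans ?_
    have hq' : q / (1024 * q) = 1 / 1024 := by field_simp
    have he : (2 : ℝ) ^ (s * 2 ^ (m + 1)) * (q / (1024 * q)) ^ (s * 2 ^ m + 1) ≤ (1 / 16) ^ s := by
      rw [hq', show s * 2 ^ (m + 1) = 2 * (s * 2 ^ m) by ring, pow_mul]
      calc ((2 : ℝ) ^ 2) ^ (s * 2 ^ m) * (1 / 1024) ^ (s * 2 ^ m + 1)
          ≤ ((2 : ℝ) ^ 2) ^ (s * 2 ^ m) * (1 / 1024) ^ (s * 2 ^ m) := by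
            refine mul_le_mul_of_nonneg_left ?_ (by positivity)
            exact pow_le_pow_of_le_one (by norm_num) (by norm_num) (Nat.le_succ _)
        _ = (1 / 256) ^ (s * 2 ^ m) := by rw [← mul_pow]; norm_num
        _ ≤ (1 / 16) ^ (s * 2 ^ m) := pow_le_pow_left₀ (by norm_num) (by norm_num) _
        _ ≤ (1 / 16) ^ s := pow_le_pow_of_le_one (by norm_num) (by norm_num)
            (Nat.le_mul_of_pos_right s (by positivity))
    push_cast
    linarith

theorem sparsProb_eq_one_sub_binomExp (X : Finset α) (p : ℝ) (Q : Finset α → Prop) :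
    sparsProb X p Q = 1 - binomExp p X fun W => open Classical in if Q W then 0 else 1 := by
  classical
  have h1 : sparsProb X p Q = binomExp p X fun W => if Q W then 1 else 0 := by
    unfold sparsProb binomExp
    exact Finset.sum_congr rfl fun W _ => by by_cases h : Q W <;> simp [h]
  rw [h1, eq_sub_iff_add_eq, ← binomExp_add]
  refine Eq.trans ?_ (binomExp_const p X 1)
  congr 1
  funext W
  by_cases h : Q W <;> simp [h]

/-- The spread lemma: a `q`-spread probability distribution on sets of size at most `l` forces a
binomial random set of density `Ω(q log l)` to contain one of the sets with high probability. -/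
theorem one_sub_le_sparsProb_of_isSpread {w : ι → ℝ} (hw : ∀ i, 0 ≤ w i) (hw1 : ∑ i, w i = 1)
    {p q : ℝ} (hq : 0 < q) (hp1 : p ≤ 1) {X : Finset α} {S : ι → Finset α}
    (hS : IsSpread w q Finset.univ S) (hX : ∀ i, S i ⊆ X) {l : ℕ} (hl : ∀ i, (S i).card ≤ l)
    {m : ℕ} (hm4 : 4 ≤ m) (hlm : l ≤ 2 ^ m) (hp : 1025 * m * q ≤ p) {Q : Finset α → Prop}
    (hQ : ∀ i, ∀ E ⊆ X, S i ⊆ E → Q E) :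
    1 - (16 / m + 1 / Real.sqrt m) ≤ sparsProb X p Q := by
  classical
  rw [sparsProb_eq_one_sub_binomExp]
  refine sub_le_sub_left ?_ 1
  have hmR : (4 : ℝ) ≤ m := by exact_mod_cast hm4
  have hmq : q ≤ m * q := by nlinarith
  set s := Nat.log 4 m with hs
  have hs1 : 1 ≤ s := Nat.log_pos (by norm_num) hm4
  have hs4 : (4 : ℝ) ^ s ≤ m := by exact_mod_cast Nat.pow_log_le_self 4 (by omega)
  have hs4' : (m : ℝ) ≤ 4 ^ (s + 1) := by
    exact_mod_cast (Nat.lt_pow_succ_log_self (by norm_num) m).le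
  have hb : 0 ≤ (1 - 1024 * q) ^ m := pow_nonneg (by nlinarith) _
  have hb1 : (1 - 1024 * q) ^ m ≤ 1 := pow_le_one₀ (by nlinarith) (by linarith)
  have hbern : 1 + (m : ℝ) * (-(1024 * q)) ≤ (1 - 1024 * q) ^ m := by
    have := one_add_mul_le_pow (a := -(1024 * q)) (by nlinarith) m
    simpa [sub_eq_add_neg] using this
  have h := missProb_rounds hw hq (p' := m * q) (by nlinarith) (by nlinarith) hmq (s := s) m hS
    (fun i _ => hX i) (fun i _ => (hl i).trans (hlm.trans (Nat.le_mul_of_pos_left _ hs1)))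
  rw [hw1, one_mul] at h
  calc binomExp p X (fun W => if Q W then 0 else 1) ≤ missProb p X Finset.univ S := by
        refine binomExp_mono (by nlinarith) hp1 fun W hW => ?_
        by_cases hi : ∃ i ∈ (Finset.univ : Finset ι), S i ⊆ W
        · obtain ⟨i, -, hi'⟩ := hi
          rw [if_pos (hQ i W hW hi')]; split_ifs <;> norm_num
        · rw [if_neg hi]; split_ifs <;> norm_num
    _ ≤ missProb (1 - (1 - 1024 * q) ^ m * (1 - m * q)) X Finset.univ S := by
        refine missProb_anti ?_ ?_ hp1 X _ S
        · nlinarith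
        · nlinarith
    _ ≤ m * (1 / 16) ^ s + 2 ^ s * (q / (m * q)) := h
    _ ≤ 16 / m + 1 / Real.sqrt m := by
        refine add_le_add ?_ ?_
        · rw [le_div_iff₀ (by linarith)]
          have e : ((1 : ℝ) / 16) ^ s * (4 ^ (s + 1)) ^ 2 = 16 := by
            rw [← pow_mul, show (s + 1) * 2 = 2 * s + 2 by ring, pow_add, pow_mul, ← mul_assoc,
              ← mul_pow]; norm_num
          have e2 : (m : ℝ) ^ 2 ≤ (4 ^ (s + 1)) ^ 2 := pow_le_pow_left₀ (by linarith) hs4' 2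
          have e3 : (0 : ℝ) ≤ (1 / 16) ^ s := by positivity
          nlinarith [mul_le_mul_of_nonneg_left e2 e3]
        · have e : q / (m * q) = 1 / m := by field_simp
          have hsq : (2 : ℝ) ^ s ≤ Real.sqrt m := by
            refine Real.le_sqrt_of_sq_le ?_
            rw [← pow_mul, mul_comm, pow_mul]; norm_num; exact hs4
          have hsm := Real.mul_self_sqrt (show (0 : ℝ) ≤ m by linarith)
          have hs0 : 0 < Real.sqrt m := Real.sqrt_pos.2 (by linarith)
          rw [e, mul_one_div, div_le_div_iff₀ (by linarith) hs0]
          nlinarith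

end SpreadLemma

section Sampling

variable {α : Type*} [DecidableEq α]

set_option linter.unusedSectionVars false

theorem choose_mul_pow_le_mode {M a : ℕ} (ha : a ≤ M) (j : ℕ) (hj : j ≤ M) :
    M.choose j * (a ^ j * (M - a) ^ (M - j)) ≤ M.choose a * (a ^ a * (M - a) ^ (M - a)) := by
  have key : ∀ i, i < M → (i + 1) * (M.choose (i + 1) * (a ^ (i + 1) * (M - a) ^ (M - (i + 1)))) *
      (M - a) = (M - i) * a * (M.choose i * (a ^ i * (M - a) ^ (M - i))) := fun i hi => by
    have h1 := Nat.choose_succ_right_eq M i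
    have h2 : M - i = M - (i + 1) + 1 := by omega
    rw [show (i + 1) * (M.choose (i + 1) * (a ^ (i + 1) * (M - a) ^ (M - (i + 1)))) * (M - a) =
      (M.choose (i + 1) * (i + 1)) * (a ^ (i + 1) * ((M - a) ^ (M - (i + 1)) * (M - a))) by ring, h1,
      ← pow_succ, ← h2]
    ring
  rcases le_total j a with h | h
  · induction h using Nat.decreasingInduction with
    | self => exact le_rfl
    | of_succ i hi ih =>
      refine le_trans ?_ (ih (by omega))
      have hk := key i (by omega)
      rcases Nat.eq_zero_or_pos (M - a) with h0 | h0
      · have : M = a := by omega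
        subst this
        simp [Nat.sub_ne_zero_of_lt hi]
      · have h3 : (i + 1) * (M - a) ≤ (M - i) * a := by
          obtain ⟨b, rfl⟩ := Nat.exists_eq_add_of_le ha
          obtain ⟨c, rfl⟩ := Nat.exists_eq_add_of_le (show i + 1 ≤ a from hi)
          have : i + 1 + c + b - i = 1 + c + b := by omega
          rw [this, Nat.add_sub_cancel_left]
          nlinarith
        refine le_of_mul_le_mul_left (a := (i + 1) * (M - a)) ?_ (Nat.mul_pos (Nat.succ_pos _) h0)
        calc _ ≤ (M - i) * a * (M.choose i * (a ^ i * (M - a) ^ (M - i))) := Nat.mul_le_mul_right _ h3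
          _ = _ := by rw [← hk]; ring
  · induction j, h using Nat.le_induction with
    | base => exact le_rfl
    | succ i hi ih =>
      refine le_trans ?_ (ih (by omega))
      have hk := key i (by omega)
      rcases Nat.eq_zero_or_pos (M - a) with h0 | h0
      · omega
      · have h3 : (M - i) * a ≤ (i + 1) * (M - a) := by
          obtain ⟨b, rfl⟩ := Nat.exists_eq_add_of_le ha
          obtain ⟨c, rfl⟩ := Nat.exists_eq_add_of_le hi
          obtain ⟨e, rfl⟩ := Nat.exists_eq_add_of_le (show c ≤ b by omega)
          have : a + (c + e) - (a + c) = e := by omega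
          rw [this, Nat.add_sub_cancel_left]
          nlinarith
        refine le_of_mul_le_mul_left (a := (i + 1) * (M - a)) ?_ (Nat.mul_pos (Nat.succ_pos _) h0)
        calc _ = (M - i) * a * (M.choose i * (a ^ i * (M - a) ^ (M - i))) := by rw [← hk]; ring
          _ ≤ _ := Nat.mul_le_mul_right _ h3

theorem pow_self_le_mode {M a : ℕ} (ha : a ≤ M) :
    M ^ M ≤ (M + 1) * (M.choose a * (a ^ a * (M - a) ^ (M - a))) := by
  calc M ^ M = (a + (M - a)) ^ M := by rw [Nat.add_sub_cancel' ha]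
    _ = ∑ j ∈ Finset.range (M + 1), M.choose j * (a ^ j * (M - a) ^ (M - j)) := by
        rw [add_pow]; exact Finset.sum_congr rfl fun j _ => by simp only [Nat.cast_id]; ring
    _ ≤ ∑ j ∈ Finset.range (M + 1), M.choose a * (a ^ a * (M - a) ^ (M - a)) :=
        Finset.sum_le_sum fun j hj =>
          choose_mul_pow_le_mode ha j (Nat.lt_succ_iff.1 (Finset.mem_range.1 hj))
    _ = _ := by simp

/-- Elementary symmetric sums are at most `M + 1` times the value at the constant mean sequence. -/
theorem sum_powersetCard_prod_le {X : Finset α} {a : ℕ} (ha : 0 < a) (haX : a < X.card)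
    {y : α → ℝ} (hy : ∀ x, 0 < y x) {m : ℝ} (hm : 0 < m) (hmean : ∑ x ∈ X, y x ≤ m * X.card) :
    ∑ A ∈ X.powersetCard a, ∏ x ∈ A, y x ≤ (X.card + 1) * X.card.choose a * m ^ a := by
  set M := X.card with hM
  obtain ⟨b, hb⟩ := Nat.exists_eq_add_of_lt haX
  set c : ℝ := b + 1 with hc
  have hc0 : 0 < c := by positivity
  have hMc : (M : ℝ) = a + c := by rw [hc, hb]; push_cast; ring
  have ha0 : (0 : ℝ) < a := by exact_mod_cast ha
  set z : ℝ := a / (c * m)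
  have hz : 0 < z := by positivity
  have hzm : 1 + z * m = M / c := by rw [hMc]; simp only [z]; field_simp; ring
  have h1 : (∑ A ∈ X.powersetCard a, ∏ x ∈ A, y x) * z ^ a ≤ ∏ x ∈ X, (1 + z * y x) := by
    rw [Finset.prod_one_add, Finset.sum_mul]
    calc _ = ∑ A ∈ X.powersetCard a, ∏ x ∈ A, (z * y x) := by
          refine Finset.sum_congr rfl fun A hA => ?_
          rw [Finset.prod_mul_distrib, Finset.prod_const, (Finset.mem_powersetCard.1 hA).2, mul_comm]
      _ ≤ _ := Finset.sum_le_sum_of_subset_of_nonneg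
          (fun A hA => Finset.mem_powerset.2 (Finset.mem_powersetCard.1 hA).1)
          fun A _ _ => Finset.prod_nonneg fun x _ => (mul_pos hz (hy x)).le
  have hMpos : (0:ℝ) < M / c := div_pos (by rw [hMc]; positivity) hc0
  have h2 : ∏ x ∈ X, (1 + z * y x) ≤ (M / c) ^ M := by
    calc ∏ x ∈ X, (1 + z * y x)
        ≤ ∏ x ∈ X, ((M / c) * Real.exp (z * (y x - m) / (M / c))) := by
          refine Finset.prod_le_prod (fun x _ => by have := mul_pos hz (hy x); linarith) fun x _ => ?_
          have := Real.add_one_le_exp (z * (y x - m) / (M / c))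
          calc 1 + z * y x = M / c * (z * (y x - m) / (M / c) + 1) := by
                rw [mul_add, mul_div_cancel₀ _ hMpos.ne', mul_one, ← hzm]; ring
            _ ≤ _ := mul_le_mul_of_nonneg_left this hMpos.le
      _ = (M / c) ^ M * Real.exp (∑ x ∈ X, z * (y x - m) / (M / c)) := by
          rw [Finset.prod_mul_distrib, Finset.prod_const, Real.exp_sum]
      _ ≤ (M / c) ^ M * 1 := by
          refine mul_le_mul_of_nonneg_left (Real.exp_le_one_iff.2 ?_) (by positivity)
          rw [← Finset.sum_div, ← Finset.mul_sum, Finset.sum_sub_distrib, Finset.sum_const,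
            nsmul_eq_mul]
          refine div_nonpos_of_nonpos_of_nonneg (mul_nonpos_of_nonneg_of_nonpos hz.le ?_) hMpos.le
          linarith
      _ = _ := mul_one _
  have h3 : (M : ℝ) ^ M ≤ (M + 1) * (M.choose a * (a ^ a * c ^ (M - a))) := by
    have := pow_self_le_mode haX.le
    have hcn : ((M - a : ℕ) : ℝ) = c := by rw [Nat.cast_sub haX.le, hMc]; ring
    rw [← hcn]
    exact_mod_cast this
  have h4 : (∑ A ∈ X.powersetCard a, ∏ x ∈ A, y x) * z ^ a ≤
      ((M + 1) * M.choose a * m ^ a) * z ^ a := by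
    refine (h1.trans h2).trans ?_
    have : (c : ℝ) ^ M = c ^ a * c ^ (M - a) := by rw [← pow_add, Nat.add_sub_cancel' haX.le]
    rw [div_pow, div_le_iff₀ (by positivity), this]
    refine h3.trans (le_of_eq ?_)
    simp only [z, div_pow, mul_pow]
    field_simp
  exact le_of_mul_le_mul_right h4 (by positivity)

/-- Lower tail bound for the weight of a uniformly random `a`-subset. -/
theorem card_light_subsets_le {X : Finset α} {a : ℕ} (ha : 0 < a) (haX : a < X.card)
    {ρ : α → ℝ} (h0 : ∀ x, 0 ≤ ρ x) {η : ℝ} (hη : 0 ≤ η) (h1 : ∀ x, ρ x ≤ 1) :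
    (((X.powersetCard a).filter fun A =>
      ∑ x ∈ A, ρ x < ((∑ x ∈ X, ρ x) / X.card - η) * a).card : ℝ) ≤
      (X.card + 1) * Real.exp (-(η ^ 2 * a / 2)) * X.card.choose a := by
  set M := X.card with hM
  have hM0 : (0 : ℝ) < M := by exact_mod_cast (Nat.zero_le a).trans_lt haX
  set R := (∑ x ∈ X, ρ x) / M with hR
  set B := (X.powersetCard a).filter fun A => ∑ x ∈ A, ρ x < (R - η) * a
  have hexp : ∀ t : ℝ, 0 ≤ t → Real.exp (-t) ≤ 1 - t + t ^ 2 / 2 := fun t ht => by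
    have h := Real.quadratic_le_exp_of_nonneg ht
    rw [Real.exp_neg, inv_le_iff_one_le_mul₀ (Real.exp_pos t)]
    have : 0 < 1 - t + t ^ 2 / 2 := by nlinarith [sq_nonneg (t - 1)]
    nlinarith [mul_le_mul_of_nonneg_left h this.le, pow_nonneg ht 4]
  have hmean : ∑ x ∈ X, Real.exp (-(η * ρ x)) ≤ Real.exp (-(η * R) + η ^ 2 / 2) * M := by
    calc ∑ x ∈ X, Real.exp (-(η * ρ x)) ≤ ∑ x ∈ X, (1 - η * ρ x + η ^ 2 / 2) := by
          refine Finset.sum_le_sum fun x _ => (hexp _ (mul_nonneg hη (h0 x))).trans ?_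
          have : (η * ρ x) ^ 2 ≤ η ^ 2 := by
            rw [mul_pow]; exact mul_le_of_le_one_right (sq_nonneg _) (pow_le_one₀ (h0 x) (h1 x))
          linarith
      _ = (-(η * R) + η ^ 2 / 2 + 1) * M := by
          rw [Finset.sum_add_distrib, Finset.sum_sub_distrib, ← Finset.mul_sum]
          simp only [Finset.sum_const, nsmul_eq_mul]
          have : ∑ x ∈ X, ρ x = R * M := by rw [hR]; field_simp
          rw [this, ← hM]; ring
      _ ≤ _ := mul_le_mul_of_nonneg_right (Real.add_one_le_exp _) hM0.le
  have hE := sum_powersetCard_prod_le ha haX (y := fun x => Real.exp (-(η * ρ x)))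
    (fun x => Real.exp_pos _) (Real.exp_pos _) hmean
  have hB : (B.card : ℝ) * Real.exp (-(η * ((R - η) * a))) ≤
      ∑ A ∈ X.powersetCard a, ∏ x ∈ A, Real.exp (-(η * ρ x)) := by
    calc (B.card : ℝ) * Real.exp (-(η * ((R - η) * a)))
        = ∑ A ∈ B, Real.exp (-(η * ((R - η) * a))) := by simp
      _ ≤ ∑ A ∈ B, ∏ x ∈ A, Real.exp (-(η * ρ x)) := by
          refine Finset.sum_le_sum fun A hA => ?_
          rw [← Real.exp_sum]
          refine Real.exp_le_exp.2 ?_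
          rw [Finset.sum_neg_distrib, ← Finset.mul_sum]
          have := (Finset.mem_filter.1 hA).2
          nlinarith
      _ ≤ _ := Finset.sum_le_sum_of_subset_of_nonneg (Finset.filter_subset _ _)
          fun A _ _ => Finset.prod_nonneg fun x _ => (Real.exp_pos _).le
  refine le_of_mul_le_mul_right (hB.trans (hE.trans (le_of_eq ?_)))
    (Real.exp_pos (-(η * ((R - η) * a))))
  have h : Real.exp (a * (-(η * R) + η ^ 2 / 2)) =
      Real.exp (-(η ^ 2 * a / 2)) * Real.exp (-(η * ((R - η) * a))) := by
    rw [← Real.exp_add]; congr 1; ring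
  rw [← Real.exp_nat_mul, h]
  ring

/-- Most `a`-subsets of `X` contain the expected number of members of an `r`-uniform family. -/
theorem card_poor_subsets_le {X : Finset α} {a : ℕ} (ha : 0 < a) (haX : a < X.card)
    {η : ℝ} (hη : 0 ≤ η) (r : ℕ) (L : Finset (Finset α)) (hL : L ⊆ X.powersetCard r) :
    (((X.powersetCard a).filter fun A => ((L.filter fun F => F ⊆ A).card : ℝ) <
      L.card * (a / X.card) ^ r - r * η * a ^ r).card : ℝ) ≤
      (X.card + 1) ^ (r + 1) * Real.exp (-(η ^ 2 * a / 2)) * X.card.choose a := by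
  induction r generalizing L with
  | zero =>
    refine le_trans (le_of_eq ?_) (show (0 : ℝ) ≤ _ by positivity)
    rw [Nat.cast_eq_zero, Finset.card_eq_zero, Finset.filter_eq_empty_iff]
    intro A _
    have : L.filter (fun F => F ⊆ A) = L := Finset.filter_true_of_mem fun F hF => by
      have := hL hF
      rw [Finset.powersetCard_zero, Finset.mem_singleton] at this
      simp [this]
    simp [this]
  | succ r ih =>
    set M := X.card with hM
    set E := Real.exp (-(η ^ 2 * a / 2)) * M.choose a with hE
    have hE0 : 0 ≤ E := by positivity
    have hM0 : (0 : ℝ) < M := by exact_mod_cast (Nat.zero_le a).trans_lt haX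
    have ha0 : (0 : ℝ) < a := by exact_mod_cast ha
    let lk : α → Finset (Finset α) := fun x => (X.powersetCard r).filter
      fun F => x ∉ F ∧ insert x F ∈ L
    -- double counting
    have hcount : ∀ A ⊆ X, ∑ x ∈ A, (((lk x).filter fun F => F ⊆ A).card) =
        (r + 1) * (L.filter fun F => F ⊆ A).card := fun A hA => by
      have h1 : ∀ F ∈ L.filter (fun F => F ⊆ A), F.card = r + 1 := fun F hF =>
        (Finset.mem_powersetCard.1 (hL (Finset.mem_filter.1 hF).1)).2
      calc _ = (A.sigma fun x => (lk x).filter fun F => F ⊆ A).card := by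
            rw [Finset.card_sigma]
        _ = ((L.filter fun F => F ⊆ A).sigma fun F => F).card := by
            refine Finset.card_bij' (fun p _ => ⟨insert p.1 p.2, p.1⟩)
              (fun p _ => ⟨p.2, p.1.erase p.2⟩) ?_ ?_ ?_ ?_
            · rintro ⟨x, F⟩ h
              simp only [Finset.mem_sigma, Finset.mem_filter, lk] at h ⊢
              exact ⟨⟨h.2.1.2.2, Finset.insert_subset h.1 h.2.2⟩, Finset.mem_insert_self _ _⟩
            · rintro ⟨F, x⟩ h
              simp only [Finset.mem_sigma, Finset.mem_filter, lk, Finset.mem_powersetCard] at h ⊢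
              have hF := Finset.mem_powersetCard.1 (hL h.1.1)
              refine ⟨h.1.2 h.2, ⟨⟨(Finset.erase_subset _ _).trans hF.1, ?_⟩,
                Finset.notMem_erase _ _, ?_⟩, (Finset.erase_subset _ _).trans h.1.2⟩
              · rw [Finset.card_erase_of_mem h.2, hF.2]; rfl
              · rw [Finset.insert_erase h.2]; exact h.1.1
            · rintro ⟨x, F⟩ h
              simp only [Finset.mem_sigma, Finset.mem_filter, lk] at h
              simp [Finset.erase_insert h.2.1.2.1]
            · rintro ⟨F, x⟩ h
              simp only [Finset.mem_sigma] at h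
              simp [Finset.insert_erase h.2]
        _ = _ := by
            rw [Finset.card_sigma, Finset.sum_congr rfl h1]; simp [mul_comm]
    have hlk : ∀ x, (lk x).filter (fun F => F ⊆ X) = lk x := fun x =>
      Finset.filter_true_of_mem fun F hF =>
        (Finset.mem_powersetCard.1 (Finset.mem_filter.1 hF).1).1
    have hLX : L.filter (fun F => F ⊆ X) = L := Finset.filter_true_of_mem fun F hF =>
        (Finset.mem_powersetCard.1 (hL hF)).1
    have htot : ∑ x ∈ X, ((lk x).card : ℝ) = (r + 1) * L.card := by
      have := hcount X subset_rfl
      simp only [hlk, hLX] at this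
      exact_mod_cast this
    let ρ : α → ℝ := fun x => (lk x).card / (M : ℝ) ^ r
    have hρ0 : ∀ x, 0 ≤ ρ x := fun x => by positivity
    have hρ1 : ∀ x, ρ x ≤ 1 := fun x => by
      refine div_le_one_of_le₀ ?_ (by positivity)
      have h1 : (lk x).card ≤ M.choose r := by
        rw [hM, ← Finset.card_powersetCard]; exact Finset.card_filter_le _ _
      exact_mod_cast h1.trans (Nat.choose_le_pow M r)
    let B0 := (X.powersetCard a).filter fun A => ∑ x ∈ A, ρ x < ((∑ x ∈ X, ρ x) / M - η) * a
    let B : α → Finset (Finset α) := fun x => (X.powersetCard a).filter fun A =>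
      (((lk x).filter fun F => F ⊆ A).card : ℝ) < (lk x).card * (a / M) ^ r - r * η * a ^ r
    have hsub : ((X.powersetCard a).filter fun A => ((L.filter fun F => F ⊆ A).card : ℝ) <
        L.card * (a / M) ^ (r + 1) - (r + 1 : ℕ) * η * a ^ (r + 1)) ⊆ B0 ∪ X.biUnion B := by
      intro A hA
      rw [Finset.mem_filter] at hA
      obtain ⟨hAX, hA⟩ := hA
      by_contra hcon
      rw [Finset.mem_union, not_or, Finset.mem_biUnion] at hcon
      push Not at hcon
      have hA' := Finset.mem_powersetCard.1 hAX
      have h0 : ((∑ x ∈ X, ρ x) / M - η) * a ≤ ∑ x ∈ A, ρ x := by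
        have := hcon.1
        simp only [B0, Finset.mem_filter, not_and, not_lt] at this
        exact this hAX
      have hx : ∀ x ∈ A, (lk x).card * (a / M : ℝ) ^ r - r * η * a ^ r ≤
          ((lk x).filter fun F => F ⊆ A).card := fun x hx => by
        have := hcon.2 x (hA'.1 hx)
        simp only [B, Finset.mem_filter, not_and, not_lt] at this
        exact this hAX
      have hsum := Finset.sum_le_sum hx
      rw [Finset.sum_sub_distrib, Finset.sum_const, hA'.2, nsmul_eq_mul, ← Finset.sum_mul] at hsum
      have hc : (∑ x ∈ A, (((lk x).filter fun F => F ⊆ A).card : ℝ)) =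
          (r + 1) * (L.filter fun F => F ⊆ A).card := by exact_mod_cast hcount A hA'.1
      rw [hc] at hsum
      have hρA : ∑ x ∈ A, ρ x = (∑ x ∈ A, ((lk x).card : ℝ)) / (M : ℝ) ^ r := by
        simp only [ρ, Finset.sum_div]
      have hρX : ∑ x ∈ X, ρ x = (r + 1) * L.card / (M : ℝ) ^ r := by
        simp only [ρ, ← Finset.sum_div, htot]
      rw [hρA, hρX] at h0
      have h2 : (((r + 1) * L.card / (M : ℝ) ^ r) / M - η) * a * (a : ℝ) ^ r ≤
          (∑ x ∈ A, ((lk x).card : ℝ)) * (a / M : ℝ) ^ r := by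
        refine (mul_le_mul_of_nonneg_right h0 (by positivity)).trans (le_of_eq ?_)
        rw [div_pow]; ring
      have h3 : (((r + 1) * L.card / (M : ℝ) ^ r) / M - η) * a * (a : ℝ) ^ r =
          (r + 1) * (L.card * (a / M : ℝ) ^ (r + 1)) - η * a ^ (r + 1) := by
        rw [div_pow, pow_succ, pow_succ]; field_simp
      push_cast at hA
      have h4 : (a : ℝ) * (r * η * a ^ r) = r * (η * a ^ (r + 1)) := by ring
      have h5 : 0 ≤ η * (a : ℝ) ^ (r + 1) := by positivity
      have h6 : (0 : ℝ) ≤ r := by positivity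
      nlinarith [mul_nonneg h6 h5, mul_nonneg h6 (mul_nonneg h6 h5)]
    have hB0 : (B0.card : ℝ) ≤ (M + 1) * E := by
      have := card_light_subsets_le ha haX hρ0 hη hρ1
      rw [hE, ← mul_assoc]; exact this
    have hB : ∀ x, ((B x).card : ℝ) ≤ (M + 1) ^ (r + 1) * E := fun x => by
      have := ih (lk x) (Finset.filter_subset _ _)
      rw [hE, ← mul_assoc]; exact this
    calc _ ≤ ((B0 ∪ X.biUnion B).card : ℝ) := by exact_mod_cast Finset.card_le_card hsub
      _ ≤ B0.card + ∑ x ∈ X, ((B x).card : ℝ) := by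
          have := (Finset.card_union_le B0 (X.biUnion B)).trans
            (Nat.add_le_add_left Finset.card_biUnion_le _)
          exact_mod_cast this
      _ ≤ (M + 1) * E + M * ((M + 1) ^ (r + 1) * E) := by
          refine add_le_add hB0 ((Finset.sum_le_sum fun x _ => hB x).trans ?_)
          simp [hM]
      _ ≤ (M + 1) ^ (r + 2) * E := by
          have : (1 : ℝ) ≤ (M + 1) ^ r := one_le_pow₀ (by linarith)
          have h7 : (M + 1 : ℝ) + M * (M + 1) ^ (r + 1) ≤ (M + 1) ^ (r + 2) := by
            have h8 : (M + 1 : ℝ) ≤ (M + 1) ^ (r + 1) := by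
              rw [pow_succ]; exact le_mul_of_one_le_left (by linarith) this
            rw [pow_succ _ (r + 1)]; linarith
          linarith [mul_le_mul_of_nonneg_right h7 hE0]
      _ = _ := by rw [hE]; ring

end Sampling

section Links

variable {α : Type} [DecidableEq α]

set_option linter.unusedSectionVars false

/-- The `r`-subsets of `V` that extend `D` to an edge of `G`. -/
def lk (G : Finset (Finset α)) (V D : Finset α) (r : ℕ) : Finset (Finset α) :=
  (V.powersetCard r).filter fun F => Disjoint F D ∧ F ∪ D ∈ G

theorem mem_lk {G : Finset (Finset α)} {V D : Finset α} {r : ℕ} {F : Finset α} :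
    F ∈ lk G V D r ↔ (F ⊆ V ∧ F.card = r) ∧ Disjoint F D ∧ F ∪ D ∈ G := by
  rw [lk, Finset.mem_filter, Finset.mem_powersetCard]

theorem lk_mono {G : Finset (Finset α)} {V V' D : Finset α} {r : ℕ} (h : V ⊆ V') :
    lk G V D r ⊆ lk G V' D r := fun F hF => by
  rw [mem_lk] at hF ⊢
  exact ⟨⟨hF.1.1.trans h, hF.1.2⟩, hF.2⟩

theorem lk_filter_subset {G : Finset (Finset α)} {V A D : Finset α} {r : ℕ} (h : A ⊆ V) :
    (lk G V D r).filter (fun F => F ⊆ A) = lk G A D r := by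
  ext F
  simp only [Finset.mem_filter, mem_lk]
  constructor
  · rintro ⟨⟨⟨_, h1⟩, h2⟩, h3⟩; exact ⟨⟨h3, h1⟩, h2⟩
  · rintro ⟨⟨h1, h2⟩, h3⟩; exact ⟨⟨⟨h1.trans h, h2⟩, h3⟩, h1⟩

theorem card_powersetCard_meeting_le (V Z : Finset α) (r : ℕ) :
    ((V.powersetCard (r + 1)).filter fun F => ¬ Disjoint F Z).card ≤ Z.card * V.card ^ r := by
  have hsub : ((V.powersetCard (r + 1)).filter fun F => ¬ Disjoint F Z) ⊆
      (Z ×ˢ V.powersetCard r).image fun p => insert p.1 p.2 := fun F hF => by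
    rw [Finset.mem_filter, Finset.mem_powersetCard, Finset.not_disjoint_iff] at hF
    obtain ⟨⟨hFV, hF⟩, z, hzF, hz⟩ := hF
    refine Finset.mem_image.2 ⟨(z, F.erase z), ?_, Finset.insert_erase hzF⟩
    rw [Finset.mem_product, Finset.mem_powersetCard]
    exact ⟨hz, (Finset.erase_subset _ _).trans hFV, by rw [Finset.card_erase_of_mem hzF, hF]; rfl⟩
  refine (Finset.card_le_card hsub).trans (Finset.card_image_le.trans ?_)
  rw [Finset.card_product, Finset.card_powersetCard]
  exact Nat.mul_le_mul_left _ (Nat.choose_le_pow _ _)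

theorem card_lk_le_sdiff (G : Finset (Finset α)) (V Z D : Finset α) (r : ℕ) :
    (lk G V D (r + 1)).card ≤ (lk G (V \ Z) D (r + 1)).card + Z.card * V.card ^ r := by
  have : lk G V D (r + 1) ⊆ lk G (V \ Z) D (r + 1) ∪
      (V.powersetCard (r + 1)).filter fun F => ¬ Disjoint F Z := fun F hF => by
    rw [mem_lk] at hF
    rw [Finset.mem_union, mem_lk, Finset.mem_filter, Finset.mem_powersetCard]
    by_cases h : Disjoint F Z
    · exact Or.inl ⟨⟨Finset.subset_sdiff.2 ⟨hF.1.1, h⟩, hF.1.2⟩, hF.2⟩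
    · exact Or.inr ⟨hF.1, h⟩
  exact (Finset.card_le_card this).trans ((Finset.card_union_le _ _).trans
    (Nat.add_le_add_left (card_powersetCard_meeting_le V Z r) _))

/-- Random `M`-subsets of `X` inherit all link densities. -/
theorem card_bad_subsets_le (G : Finset (Finset α)) {X Y : Finset α} {M d r : ℕ} (hM : 0 < M)
    (hMX : M < X.card) {η θ : ℝ} (hη : 0 ≤ η)
    (hdeg : ∀ D ⊆ Y, D.card = d → θ * (X.card : ℝ) ^ r ≤ (lk G X D r).card) :
    (((X.powersetCard M).filter fun A => ∃ D ∈ Y.powersetCard d,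
      ((lk G A D r).card : ℝ) < (θ - r * η) * M ^ r).card : ℝ) ≤
      (Y.card : ℝ) ^ d * (X.card + 1) ^ (r + 1) * Real.exp (-(η ^ 2 * M / 2)) *
        X.card.choose M := by
  have hX0 : (0 : ℝ) < X.card := by exact_mod_cast (Nat.zero_le M).trans_lt hMX
  set E := ((X.card : ℝ) + 1) ^ (r + 1) * Real.exp (-(η ^ 2 * M / 2)) * X.card.choose M with hE
  have hE0 : 0 ≤ E := by positivity
  have hsub : ((X.powersetCard M).filter fun A => ∃ D ∈ Y.powersetCard d,
      ((lk G A D r).card : ℝ) < (θ - r * η) * M ^ r) ⊆ (Y.powersetCard d).biUnion fun D =>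
      (X.powersetCard M).filter fun A => (((lk G X D r).filter fun F => F ⊆ A).card : ℝ) <
        (lk G X D r).card * (M / X.card) ^ r - r * η * M ^ r := fun A hA => by
    rw [Finset.mem_filter] at hA
    obtain ⟨hA, D, hD, h⟩ := hA
    refine Finset.mem_biUnion.2 ⟨D, hD, Finset.mem_filter.2 ⟨hA, ?_⟩⟩
    rw [lk_filter_subset (Finset.mem_powersetCard.1 hA).1]
    refine h.trans_le ?_
    have h1 := hdeg D (Finset.mem_powersetCard.1 hD).1 (Finset.mem_powersetCard.1 hD).2
    have h2 : θ * (M : ℝ) ^ r ≤ (lk G X D r).card * (M / X.card : ℝ) ^ r := by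
      calc θ * (M : ℝ) ^ r = θ * (X.card : ℝ) ^ r * (M / X.card : ℝ) ^ r := by
            rw [div_pow]; field_simp
        _ ≤ _ := mul_le_mul_of_nonneg_right h1 (by positivity)
    linarith
  calc _ ≤ ∑ D ∈ Y.powersetCard d, E := by
        refine (Nat.cast_le.2 ((Finset.card_le_card hsub).trans Finset.card_biUnion_le)).trans ?_
        rw [Nat.cast_sum]
        exact Finset.sum_le_sum fun D _ =>
          card_poor_subsets_le hM hMX hη r _ (Finset.filter_subset _ _)
    _ = (Y.card.choose d : ℝ) * E := by simp
    _ ≤ (Y.card : ℝ) ^ d * E :=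
        mul_le_mul_of_nonneg_right (by exact_mod_cast Nat.choose_le_pow _ _) hE0
    _ = _ := by rw [hE]; ring

end Links

section Paths

variable {α : Type} [DecidableEq α]

set_option linter.unusedSectionVars false

/-- `LPath G u v U`: there is a loose path in `G` from `u` to `v` with vertex set `U`. -/
inductive LPath (G : Finset (Finset α)) (u : α) : α → Finset α → Prop
  | nil : LPath G u u {u}
  | snoc {v w : α} {U E : Finset α} : LPath G u v U → E ∈ G → w ∈ E → w ≠ v → E ∩ U = {v} →
      LPath G u w (U ∪ E)

variable {G : Finset (Finset α)} {u v w : α} {U U' : Finset α}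

theorem LPath.start_mem (h : LPath G u v U) : u ∈ U := by
  induction h with
  | nil => simp
  | snoc _ _ _ _ _ ih => exact Finset.mem_union_left _ ih

theorem LPath.end_mem (h : LPath G u v U) : v ∈ U := by
  cases h with
  | nil => simp
  | snoc _ _ h _ _ => exact Finset.mem_union_right _ h

theorem LPath.single {E : Finset α} (hE : E ∈ G) (hu : u ∈ E) (hv : v ∈ E) (h : v ≠ u) :
    LPath G u v E := by
  have := LPath.snoc (LPath.nil (G := G) (u := u)) hE hv h
    (by rw [Finset.inter_singleton_of_mem hu])
  rwa [Finset.union_eq_right.2 (Finset.singleton_subset_iff.2 hu)] at this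

theorem LPath.append (h : LPath G u v U) (h' : LPath G v w U') (hU : U ∩ U' = {v}) :
    LPath G u w (U ∪ U') := by
  induction h' with
  | nil => rwa [Finset.union_eq_left.2 (Finset.singleton_subset_iff.2 h.end_mem)]
  | @snoc v' w' U' E h1 hE hw hne hEU ih =>
    rw [← Finset.union_assoc]
    have hUU : U ∩ U' = {v} := by
      refine Finset.Subset.antisymm ?_ ?_
      · rw [← hU]; exact Finset.inter_subset_inter_left Finset.subset_union_left
      · exact Finset.singleton_subset_iff.2 (Finset.mem_inter.2 ⟨h.end_mem, h1.start_mem⟩)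
    refine LPath.snoc (ih hUU) hE hw hne ?_
    refine Finset.Subset.antisymm ?_ ?_
    · rw [Finset.inter_union_distrib_left, hEU]
      refine Finset.union_subset (fun x hx => ?_) subset_rfl
      have hx' := Finset.mem_inter.1 hx
      have : x ∈ U ∩ (U' ∪ E) := Finset.mem_inter.2 ⟨hx'.2, Finset.mem_union_right _ hx'.1⟩
      rw [hU, Finset.mem_singleton] at this
      rw [← hEU, this, Finset.mem_inter, ← this]
      exact ⟨hx'.1, this ▸ h1.start_mem⟩
    · refine Finset.singleton_subset_iff.2 (Finset.mem_inter.2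
        ⟨?_, Finset.mem_union_right _ h1.end_mem⟩)
      have : v' ∈ E ∩ U' := by rw [hEU]; simp
      exact (Finset.mem_inter.1 this).1

theorem LPath.card {k : ℕ} (hk : 1 ≤ k) (hG : ∀ e ∈ G, e.card = k) (h : LPath G u v U) :
    ∃ m, U.card = (k - 1) * m + 1 := by
  induction h with
  | nil => exact ⟨0, by simp⟩
  | @snoc v w U E h hE hw hne hEU ih =>
    obtain ⟨m, hm⟩ := ih
    refine ⟨m + 1, ?_⟩
    have := Finset.card_union_add_card_inter E U
    rw [hEU, Finset.card_singleton, hG E hE, hm, Finset.union_comm] at this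
    rw [mul_add]; omega

/-- The `t`-th edge of the loose cycle (or path) with vertex sequence `F`. -/
def blk (F : ℕ → α) (k t : ℕ) : Finset α := (Finset.range k).image fun j => F (t * (k - 1) + j)

theorem mem_blk {F : ℕ → α} {k t : ℕ} {x : α} :
    x ∈ blk F k t ↔ ∃ j < k, F (t * (k - 1) + j) = x := by simp [blk]

/-- A loose path listed as a vertex sequence. -/
theorem LPath.exists_fun {k : ℕ} (hk : 2 ≤ k) (hG : ∀ e ∈ G, e.card = k) (h : LPath G u v U) :
    ∃ (e : ℕ) (F : ℕ → α), U.card = (k - 1) * e + 1 ∧ F 0 = u ∧ F ((k - 1) * e) = v ∧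
      Set.InjOn F (Set.Iic ((k - 1) * e)) ∧ (Finset.range ((k - 1) * e + 1)).image F = U ∧
      ∀ t < e, blk F k t ∈ G := by
  induction h with
  | nil => exact ⟨0, fun _ => u, by simp, rfl, rfl,
      fun i hi j hj _ => by simp only [mul_zero, Set.mem_Iic] at hi hj; omega, by simp, by simp⟩
  | @snoc v w U E h hE hw hne hEU ih =>
    obtain ⟨e, F, hc, h0, hv, hinj, him, hb⟩ := ih
    have hvE : v ∈ E ∧ v ∈ U := Finset.mem_inter.1 (hEU ▸ Finset.mem_singleton_self v)
    set B := (E.erase v).erase w with hB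
    have hBc : B.card = k - 2 := by
      rw [hB, Finset.card_erase_of_mem (Finset.mem_erase.2 ⟨hne, hw⟩),
        Finset.card_erase_of_mem hvE.1, hG E hE]; rfl
    let g := (Finset.equivFinOfCardEq hBc).symm
    set L := (k - 1) * e with hL
    have hL' : (k - 1) * (e + 1) = L + (k - 1) := by rw [mul_add, mul_one]
    let F' : ℕ → α := fun i => if i ≤ L then F i else
      if h : i - L - 1 < k - 2 then (g ⟨i - L - 1, h⟩ : α) else w
    have hF1 : ∀ i ≤ L, F' i = F i := fun i hi => by simp [F', hi]
    have hF2 : ∀ i (h : i < k - 2), F' (L + 1 + i) = (g ⟨i, h⟩ : α) := fun i h => by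
      have h1 : ¬ (L + 1 + i ≤ L) := by omega
      have h2 : L + 1 + i - L - 1 = i := by omega
      simp [F', h1, h2, h]
    have hF3 : F' (L + (k - 1)) = w := by
      have h1 : ¬ (L + (k - 1) ≤ L) := by omega
      have h2 : ¬ (L + (k - 1) - L - 1 < k - 2) := by omega
      simp only [F', if_neg h1, dif_neg h2]
    have hblk : blk F' k e = E := by
      ext x
      rw [mem_blk]
      constructor
      · rintro ⟨j, hj, rfl⟩
        rw [mul_comm, ← hL]
        rcases Nat.eq_zero_or_pos j with rfl | hj0
        · rw [add_zero, hF1 L le_rfl, hv]; exact hvE.1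
        · rcases Nat.lt_or_ge (j - 1) (k - 2) with h1 | h1
          · rw [show L + j = L + 1 + (j - 1) by omega, hF2 _ h1]
            have := (g ⟨j - 1, h1⟩).2
            simp only [hB, Finset.mem_erase] at this
            exact this.2.2
          · rw [show j = k - 1 by omega, hF3]; exact hw
      · intro hx
        rw [mul_comm, ← hL]
        by_cases h1 : x = v
        · exact ⟨0, by omega, by rw [add_zero, hF1 L le_rfl, hv, h1]⟩
        by_cases h2 : x = w
        · exact ⟨k - 1, by omega, by rw [hF3, h2]⟩
        have hxB : x ∈ B := by simp [hB, h1, h2, hx]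
        refine ⟨1 + (g.symm ⟨x, hxB⟩ : ℕ), ?_, ?_⟩
        · have := (g.symm ⟨x, hxB⟩).2; omega
        · rw [← add_assoc, hF2 _ (g.symm ⟨x, hxB⟩).2]; simp
    have himg : (Finset.range (L + (k - 1) + 1)).image F' = U ∪ E := by
      ext x
      simp only [Finset.mem_image, Finset.mem_range, Finset.mem_union]
      constructor
      · rintro ⟨i, hi, rfl⟩
        rcases le_or_gt i L with h1 | h1
        · left
          rw [hF1 i h1, ← him]
          exact Finset.mem_image_of_mem _ (Finset.mem_range.2 (by omega))
        · right
          rw [← hblk, mem_blk]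
          exact ⟨i - L, by omega, by rw [mul_comm, ← hL, Nat.add_sub_cancel' h1.le]⟩
      · rintro (hx | hx)
        · rw [← him, Finset.mem_image] at hx
          obtain ⟨i, hi, rfl⟩ := hx
          rw [Finset.mem_range] at hi
          exact ⟨i, by omega, hF1 i (by omega)⟩
        · rw [← hblk, mem_blk] at hx
          obtain ⟨j, hj, rfl⟩ := hx
          exact ⟨L + j, by omega, by rw [mul_comm e, ← hL]⟩
    have hcard : (U ∪ E).card = L + (k - 1) + 1 := by
      have := Finset.card_union_add_card_inter E U
      rw [hEU, Finset.card_singleton, hG E hE, hc, Finset.union_comm] at this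
      omega
    refine ⟨e + 1, F', by rw [hcard, hL'], by rw [hF1 0 (Nat.zero_le _), h0],
      by rw [hL', hF3], ?_, by rw [hL', himg], fun t ht => ?_⟩
    · have h1 : ((Finset.range (L + (k - 1) + 1)).image F').card =
        (Finset.range (L + (k - 1) + 1)).card := by rw [himg, hcard, Finset.card_range]
      have h2 := Finset.card_image_iff.1 h1
      rw [hL']
      refine h2.mono fun i hi => ?_
      rw [Finset.mem_coe, Finset.mem_range]
      exact Nat.lt_succ_of_le hi
    · rcases Nat.lt_succ_iff_lt_or_eq.1 ht with h1 | rfl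
      · have : blk F' k t = blk F k t := by
          refine Finset.image_congr fun j hj => ?_
          rw [Finset.mem_coe, Finset.mem_range] at hj
          refine hF1 _ ?_
          have := Nat.mul_le_mul_left (k - 1) h1
          rw [Nat.mul_succ] at this
          rw [mul_comm t]; omega
        rw [this]; exact hb t h1
      · rw [hblk]; exact hE

end Paths

section Cycles

variable {α : Type} [DecidableEq α]

set_option linter.unusedSectionVars false

/-- `F` lists a loose Hamilton cycle of `G` on the vertex set `V`. -/
structure IsHC (G : Finset (Finset α)) (k : ℕ) (V : Finset α) (F : ℕ → α) : Prop where
  per : ∀ i, F (i + V.card) = F i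
  inj : Set.InjOn F (Set.Iio V.card)
  img : (Finset.range V.card).image F = V
  blk_mem : ∀ t, blk F k t ∈ G

variable {G : Finset (Finset α)} {k q : ℕ} {V : Finset α} {F : ℕ → α}

theorem blk_shift (F : ℕ → α) (k s t : ℕ) :
    blk (fun i => F (i + s * (k - 1))) k t = blk F k (t + s) := by
  refine Finset.image_congr fun j _ => ?_
  show F _ = F _
  congr 1; ring

theorem IsHC.apply_mod (h : IsHC G k V F) (i : ℕ) : F (i % V.card) = F i := by
  have : ∀ m r, F (r + V.card * m) = F r := fun m r => by
    induction m with
    | zero => simp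
    | succ m ih => rw [mul_add, mul_one, ← add_assoc, h.per, ih]
  conv_rhs => rw [← Nat.mod_add_div i V.card]
  rw [this]

theorem IsHC.eq_iff (h : IsHC G k V F) (hV : 0 < V.card) {i j : ℕ} :
    F i = F j ↔ i % V.card = j % V.card := by
  rw [← h.apply_mod i, ← h.apply_mod j]
  exact h.inj.eq_iff (Nat.mod_lt _ hV) (Nat.mod_lt _ hV)

theorem IsHC.eq_of_lt (h : IsHC G k V F) {i j : ℕ} (hi : i < V.card) (hj : j < V.card)
    (hij : F i = F j) : i = j := h.inj hi hj hij

theorem IsHC.mem (h : IsHC G k V F) (hV : 0 < V.card) (i : ℕ) : F i ∈ V := by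
  have := Finset.mem_image_of_mem F (Finset.mem_range.2 (Nat.mod_lt i hV))
  rwa [h.img, h.apply_mod] at this

theorem IsHC.exists_lt (h : IsHC G k V F) {x : α} (hx : x ∈ V) : ∃ i < V.card, F i = x := by
  rw [← h.img, Finset.mem_image] at hx
  simpa using hx

theorem IsHC.rotate (h : IsHC G k V F) (hV : 0 < V.card) (s : ℕ) :
    IsHC G k V (fun i => F (i + s * (k - 1))) := by
  have hinj : Set.InjOn (fun i => F (i + s * (k - 1))) (Set.Iio V.card) := fun i hi j hj hij => by
    have h1 := (h.eq_iff hV).1 hij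
    have h2 : i ≡ j [MOD V.card] := Nat.ModEq.add_right_cancel' _ h1
    exact Nat.ModEq.eq_of_lt_of_lt h2 hi hj
  refine ⟨fun i => ?_, hinj, ?_, fun t => ?_⟩
  · show F _ = F _
    rw [add_right_comm, h.per]
  · refine Finset.eq_of_subset_of_card_le (fun x hx => ?_) ?_
    · obtain ⟨i, -, rfl⟩ := Finset.mem_image.1 hx
      exact h.mem hV _
    · rw [Finset.card_image_of_injOn, Finset.card_range]
      exact hinj.mono fun i hi => Finset.mem_range.1 hi
  · rw [blk_shift]; exact h.blk_mem _

theorem IsHC.blk_inter_image (h : IsHC G k V F) (hk : 2 ≤ k) {t : ℕ}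
    (ht : (t + 1) * (k - 1) < V.card) :
    blk F k t ∩ (Finset.range (t * (k - 1) + 1)).image F = {F (t * (k - 1))} := by
  rw [add_mul, one_mul] at ht
  ext x
  rw [Finset.mem_inter, mem_blk, Finset.mem_image, Finset.mem_singleton]
  constructor
  · rintro ⟨⟨j, hj, rfl⟩, i, hi, hij⟩
    rw [Finset.mem_range] at hi
    have := h.eq_of_lt (by omega) (by omega) hij
    rw [show j = 0 by omega, add_zero]
  · rintro rfl
    exact ⟨⟨0, by omega, by simp⟩, _, Finset.mem_range.2 (Nat.lt_succ_self _), rfl⟩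

theorem image_range_union_blk (F : ℕ → α) (hk : 2 ≤ k) (t : ℕ) :
    (Finset.range (t * (k - 1) + 1)).image F ∪ blk F k t =
      (Finset.range ((t + 1) * (k - 1) + 1)).image F := by
  ext x
  simp only [Finset.mem_union, Finset.mem_image, Finset.mem_range, mem_blk, add_mul, one_mul]
  constructor
  · rintro (⟨i, hi, rfl⟩ | ⟨j, hj, rfl⟩)
    · exact ⟨i, by omega, rfl⟩
    · exact ⟨_, by omega, rfl⟩
  · rintro ⟨i, hi, rfl⟩
    rcases le_or_gt i (t * (k - 1)) with h | h
    · exact Or.inl ⟨i, by omega, rfl⟩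
    · exact Or.inr ⟨i - t * (k - 1), by omega, by rw [Nat.add_sub_cancel' h.le]⟩

theorem IsHC.segment (h : IsHC G k V F) (hk : 2 ≤ k) {y : α} (hy : y ∈ blk F k 0)
    (hy1 : y ≠ F (k - 1)) {t : ℕ} (ht : (t + 1) * (k - 1) < V.card) :
    LPath G y (F ((t + 1) * (k - 1))) ((Finset.range ((t + 1) * (k - 1) + 1)).image F) := by
  induction t with
  | zero =>
    have : blk F k 0 = (Finset.range ((0 + 1) * (k - 1) + 1)).image F := by
      rw [blk, show (0 + 1) * (k - 1) + 1 = k by omega]; simp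
    rw [← this]
    refine LPath.single (h.blk_mem 0) hy ?_ ?_
    · exact mem_blk.2 ⟨k - 1, by omega, by simp⟩
    · simpa using hy1.symm
  | succ t ih =>
    have ht1 : (t + 1) * (k - 1) < V.card := by
      refine lt_of_le_of_lt (Nat.mul_le_mul_right _ (by omega)) ht
    rw [← image_range_union_blk F hk]
    refine LPath.snoc (ih ht1) (h.blk_mem _) ?_ ?_ (h.blk_inter_image hk ht)
    · exact mem_blk.2 ⟨k - 1, by omega, by congr 1; rw [add_mul (t + 1) 1, one_mul]⟩
    · intro he
      have := h.eq_of_lt ht ht1 he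
      rw [add_mul _ 1, one_mul] at this
      omega

theorem IsHC.connect (h : IsHC G k V F) (hk : 2 ≤ k) (hq : V.card = (k - 1) * q) (hq3 : 3 ≤ q)
    {y z : α} (hy : y ∈ V) (hz : z ∈ V) (hyz : y ≠ z) : ∃ U ⊆ V, LPath G y z U := by
  have hV : 0 < V.card := by rw [hq]; exact Nat.mul_pos (by omega) (by omega)
  suffices H : ∀ F, IsHC G k V F → (∃ i < k - 1, F i = y) → ∃ U ⊆ V, LPath G y z U by
    obtain ⟨p, -, hp⟩ := h.exists_lt hy
    exact H _ (h.rotate hV (p / (k - 1))) ⟨p % (k - 1), Nat.mod_lt _ (by omega), by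
      rw [mul_comm, Nat.mod_add_div, hp]⟩
  rintro F h ⟨i, hi, rfl⟩
  have hbV : ∀ t, blk F k t ⊆ V := fun t x hx => by
    obtain ⟨j, -, rfl⟩ := mem_blk.1 hx
    exact h.mem hV _
  have hrV : ∀ m, (Finset.range m).image F ⊆ V := fun m x hx => by
    obtain ⟨j, -, rfl⟩ := Finset.mem_image.1 hx
    exact h.mem hV _
  have hy0 : F i ∈ blk F k 0 := mem_blk.2 ⟨i, by omega, by simp⟩
  have h3 : (k - 1) * 3 ≤ (k - 1) * q := Nat.mul_le_mul_left _ hq3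
  have hy1 : F i ≠ F (k - 1) := fun he => by
    have := h.eq_of_lt (by omega) (by omega) he
    omega
  obtain ⟨j, hj, rfl⟩ := h.exists_lt hz
  have hjt : j / (k - 1) * (k - 1) + j % (k - 1) = j := by rw [mul_comm]; exact Nat.div_add_mod _ _
  have hjm : j % (k - 1) < k - 1 := Nat.mod_lt _ (by omega)
  have hzt : F j ∈ blk F k (j / (k - 1)) := mem_blk.2 ⟨j % (k - 1), by omega, by rw [hjt]⟩
  have htq : j / (k - 1) < q := by
    rw [Nat.div_lt_iff_lt_mul (by omega), mul_comm, ← hq]; exact hj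
  set t := j / (k - 1)
  rcases Nat.eq_zero_or_pos t with ht0 | ht0
  · rw [ht0] at hzt
    exact ⟨_, hbV 0, LPath.single (h.blk_mem 0) hy0 hzt hyz.symm⟩
  obtain ⟨s, hs⟩ := Nat.exists_eq_add_of_le' ht0
  rcases Nat.lt_or_ge (t + 1) q with htq' | htq'
  · have ht1 : (t + 1) * (k - 1) < V.card := by
      rw [hq, mul_comm]; exact Nat.mul_lt_mul_of_pos_left htq' (by omega)
    have hseg := h.segment hk hy0 hy1 (t := s) (by
      rw [← hs]; exact lt_of_le_of_lt (Nat.mul_le_mul_right _ (by omega)) ht1)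
    rw [← hs] at hseg
    by_cases hz0 : F j = F (t * (k - 1))
    · rw [hz0]; exact ⟨_, hrV _, hseg⟩
    · exact ⟨_, Finset.union_subset (hrV _) (hbV t), LPath.snoc hseg (h.blk_mem t) hzt hz0
        (h.blk_inter_image hk ht1)⟩
  · have hqt : q = t + 1 := by omega
    have hF0 : F 0 ∈ blk F k t := mem_blk.2 ⟨k - 1, by omega, by
      rw [← h.per 0, hq, hqt]; congr 1; ring⟩
    by_cases hy2 : F i = F 0
    · rw [hy2] at hyz ⊢
      exact ⟨_, hbV t, LPath.single (h.blk_mem t) hF0 hzt hyz.symm⟩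
    · have hF00 : F 0 ∈ blk F k 0 := mem_blk.2 ⟨0, by omega, by simp⟩
      have h2t : 2 * (k - 1) ≤ t * (k - 1) := Nat.mul_le_mul_right _ (by omega)
      have hVt : V.card = t * (k - 1) + (k - 1) := by rw [hq, hqt]; ring
      refine ⟨_, Finset.union_subset (hbV 0) (hbV t), LPath.snoc (LPath.single (h.blk_mem 0)
        hy0 hF00 (Ne.symm hy2)) (h.blk_mem t) hzt (fun he => ?_) ?_⟩
      · have := h.eq_of_lt hj hV he
        omega
      · ext x
        rw [Finset.mem_inter, Finset.mem_singleton]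
        constructor
        · rintro ⟨hx, hx'⟩
          obtain ⟨a, ha, rfl⟩ := mem_blk.1 hx
          obtain ⟨b, hb, hab⟩ := mem_blk.1 hx'
          rw [zero_mul, zero_add] at hab
          rcases Nat.lt_or_ge a (k - 1) with h1 | h1
          · have := h.eq_of_lt (by omega) (by omega) hab
            omega
          · rw [show t * (k - 1) + a = 0 + V.card by omega, h.per]
        · rintro rfl
          exact ⟨hF0, hF00⟩

theorem IsHC.break_at (h : IsHC G k V F) (hk : 2 ≤ k) (hq : V.card = (k - 1) * q) (hq2 : 2 ≤ q)
    (t : ℕ) : ∃ x a S U, LPath G x a U ∧ x ∉ S ∧ insert x S = blk F k t ∧ insert x S ∈ G ∧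
      a ∈ S ∧ U ∪ S = V ∧ U ∩ S = {a} := by
  have hV : 0 < V.card := by rw [hq]; exact Nat.mul_pos (by omega) (by omega)
  have h2 : (k - 1) * 2 ≤ (k - 1) * q := Nat.mul_le_mul_left _ hq2
  obtain ⟨s, rfl⟩ := Nat.exists_eq_add_of_le' hq2
  have hVs : V.card = (s + 1) * (k - 1) + (k - 1) := by rw [hq]; ring
  have hbt : blk (fun i => F (i + (t + 1) * (k - 1))) k (s + 1) = blk F k t := by
    rw [blk_shift]
    refine Finset.image_congr fun j _ => ?_
    show F _ = F _
    rw [← h.per (t * (k - 1) + j), hq]; congr 1; ring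
  have h' := h.rotate hV (t + 1)
  rw [← hbt]
  generalize (fun i => F (i + (t + 1) * (k - 1))) = F' at h'
  have hxS : F' 0 ∉ (Finset.range (k - 1)).image fun j => F' ((s + 1) * (k - 1) + j) := by
    rw [Finset.mem_image]
    rintro ⟨j, hj, he⟩
    rw [Finset.mem_range] at hj
    have := h'.eq_of_lt (by omega) hV he
    have : 0 < (s + 1) * (k - 1) := Nat.mul_pos (by omega) (by omega)
    omega
  have hins : insert (F' 0) ((Finset.range (k - 1)).image fun j => F' ((s + 1) * (k - 1) + j)) =
      blk F' k (s + 1) := by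
    rw [blk]
    conv_rhs => rw [show k = (k - 1) + 1 by omega, Finset.range_add_one, Finset.image_insert]
    rw [Nat.add_sub_cancel, ← hVs, ← h'.per 0, zero_add]
  refine ⟨F' 0, F' ((s + 1) * (k - 1)), _, _, h'.segment hk (mem_blk.2 ⟨0, by omega, by simp⟩)
    (fun he => ?_) (t := s) (by omega), hxS, hins, hins ▸ h'.blk_mem _, ?_, ?_, ?_⟩
  · have := h'.eq_of_lt hV (by omega) he
    omega
  · exact Finset.mem_image.2 ⟨0, Finset.mem_range.2 (by omega), rfl⟩
  · conv_rhs => rw [← h'.img]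
    ext x
    simp only [Finset.mem_union, Finset.mem_image, Finset.mem_range]
    constructor
    · rintro (⟨i, hi, rfl⟩ | ⟨j, hj, rfl⟩)
      · exact ⟨i, by omega, rfl⟩
      · exact ⟨_, by omega, rfl⟩
    · rintro ⟨i, hi, rfl⟩
      rcases le_or_gt i ((s + 1) * (k - 1)) with h | h
      · exact Or.inl ⟨i, by omega, rfl⟩
      · exact Or.inr ⟨i - (s + 1) * (k - 1), by omega, by rw [Nat.add_sub_cancel' h.le]⟩
  · ext x
    simp only [Finset.mem_inter, Finset.mem_image, Finset.mem_range, Finset.mem_singleton]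
    constructor
    · rintro ⟨⟨i, hi, rfl⟩, j, hj, hij⟩
      have := h'.eq_of_lt (by omega) (by omega) hij
      rw [show i = (s + 1) * (k - 1) by omega]
    · rintro rfl
      exact ⟨⟨_, by omega, rfl⟩, 0, by omega, rfl⟩

theorem IsHC.exists_disjoint_blk (h : IsHC G k V F) (hk : 2 ≤ k) (hq : V.card = (k - 1) * q)
    (H : Finset α) (hH : 2 * H.card < q) : ∃ t, Disjoint (blk F k t) H := by
  by_contra! hcon
  have hV : 0 < V.card := by rw [hq]; exact Nat.mul_pos (by omega) (by omega)
  have hj : ∀ t, ∃ j < k, F (t * (k - 1) + j) ∈ H := fun t => by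
    obtain ⟨x, hx, hxH⟩ := Finset.not_disjoint_iff.1 (hcon t)
    obtain ⟨j, hj, rfl⟩ := mem_blk.1 hx
    exact ⟨j, hj, hxH⟩
  choose j hjk hjH using hj
  have hcard : (Finset.range q).card ≤ (H ×ˢ (Finset.univ : Finset Bool)).card := by
    refine Finset.card_le_card_of_injOn
      (fun t => (F (t * (k - 1) + j t), decide (j t = k - 1))) (fun t _ => ?_) ?_
    · exact Finset.mem_coe.2 (Finset.mem_product.2 ⟨hjH t, Finset.mem_univ _⟩)
    · intro t ht t' ht' he
      simp only [Finset.coe_range, Set.mem_Iio, Prod.mk.injEq, decide_eq_decide] at ht ht' he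
      obtain ⟨he, hf⟩ := he
      have hlt : ∀ s < q, j s ≠ k - 1 → s * (k - 1) + j s < V.card := fun s hs hjs => by
        have h1 := hjk s
        have h2 : (s + 1) * (k - 1) ≤ q * (k - 1) := Nat.mul_le_mul_right _ hs
        rw [hq, mul_comm (k - 1)]
        rw [add_mul, one_mul] at h2
        omega
      by_cases h1 : j t = k - 1
      · rw [h1, hf.1 h1, h.eq_iff hV, hq, ← Nat.succ_mul, ← Nat.succ_mul, mul_comm t.succ,
          mul_comm t'.succ, Nat.mul_mod_mul_left, Nat.mul_mod_mul_left] at he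
        have h3 := Nat.eq_of_mul_eq_mul_left (by omega : 0 < k - 1) he
        have h4 : t + 1 ≡ t' + 1 [MOD q] := h3
        exact (Nat.ModEq.add_right_cancel' _ h4).eq_of_lt_of_lt ht ht'
      · have h2 : j t' ≠ k - 1 := fun h2 => h1 (hf.2 h2)
        have h3 := h.eq_of_lt (hlt t ht h1) (hlt t' ht' h2) he
        have h4 := hjk t
        have h5 := hjk t'
        have h6 : ∀ s, j s < k → j s ≠ k - 1 → (s * (k - 1) + j s) / (k - 1) = s := fun s a b => by
          rw [mul_comm, Nat.mul_add_div (by omega), Nat.div_eq_of_lt (by omega), add_zero]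
        rw [← h6 t h4 h1, h3, h6 t' h5 h2]
  rw [Finset.card_range, Finset.card_product, Finset.card_univ, Fintype.card_bool] at hcard
  omega

end Cycles

section Handlers

variable {α : Type} [DecidableEq α]

set_option linter.unusedSectionVars false

variable {G : Finset (Finset α)} {k : ℕ} {V : Finset α}

/-- A loose path from `u` to `y` on `Q` that can absorb a loose cycle containing the edge
`insert x S` in which `x` is a link vertex. -/
def Handles (G : Finset (Finset α)) (u y : α) (Q S : Finset α) (x : α) : Prop :=
  ∃ t T b U₁ U₂, LPath G u t U₁ ∧ LPath G b y U₂ ∧ t ∈ T ∧ insert x T ∈ G ∧ insert b S ∈ G ∧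
    T ∩ U₁ = {t} ∧ Disjoint (U₁ ∪ T) U₂ ∧ Q = U₁ ∪ T ∪ U₂

theorem Handles.splice {u y x a : α} {Q S U : Finset α} (h : Handles G u y Q S x)
    (hU : LPath G x a U) (hxS : x ∉ S) (ha : a ∈ S) (hUS : U ∩ S = {a})
    (hd : Disjoint Q (U ∪ S)) : LPath G u y (Q ∪ (U ∪ S)) := by
  obtain ⟨t, T, b, U₁, U₂, h1, h2, ht, hT, hS, hTU, hdis, rfl⟩ := h
  have hb := h2.start_mem
  have hx := hU.start_mem
  have ha' := hU.end_mem
  have htU := h1.end_mem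
  have p1 : LPath G u x (U₁ ∪ insert x T) := by
    refine LPath.snoc h1 hT (Finset.mem_insert_self _ _) ?_ ?_
    · rintro rfl
      exact Finset.disjoint_left.1 hd (by simp [htU]) (Finset.mem_union_left _ hx)
    · rw [Finset.insert_inter_of_notMem, hTU]
      exact fun hx1 => Finset.disjoint_left.1 hd (by simp [hx1]) (Finset.mem_union_left _ hx)
  have p2 := p1.append hU (by
    ext w
    simp only [Finset.disjoint_left, Finset.mem_union, Finset.mem_inter, Finset.mem_insert,
      Finset.mem_singleton] at *
    constructor
    · rintro ⟨h | h | h, h'⟩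
      · exact absurd (Or.inl h') (hd (Or.inl (Or.inl h)))
      · exact h
      · exact absurd (Or.inl h') (hd (Or.inl (Or.inr h)))
    · rintro rfl; exact ⟨Or.inr (Or.inl rfl), hx⟩)
  have hba : b ≠ a := fun he => Finset.disjoint_left.1 hd (Finset.mem_union_right _ hb)
    (he ▸ Finset.mem_union_right _ ha)
  have p3 := LPath.snoc p2 hS (Finset.mem_insert_self _ _) hba (by
    ext w
    have hS' := Finset.ext_iff.1 hUS w
    simp only [Finset.disjoint_left, Finset.mem_union, Finset.mem_inter, Finset.mem_insert,
      Finset.mem_singleton] at *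
    constructor
    · rintro ⟨rfl | h, h'⟩
      · exfalso
        rcases h' with (h' | rfl | h') | h'
        · exact hdis (Or.inl h') hb
        · exact hd (Or.inr hb) (Or.inl hx)
        · exact hdis (Or.inr h') hb
        · exact hd (Or.inr hb) (Or.inl h')
      · rcases h' with (h' | rfl | h') | h'
        · exact absurd (Or.inr h) (hd (Or.inl (Or.inl h')))
        · exact absurd h hxS
        · exact absurd (Or.inr h) (hd (Or.inl (Or.inr h')))
        · exact hS'.1 ⟨h', h⟩
    · rintro rfl; exact ⟨Or.inr ha, Or.inr ha'⟩)
  have p4 := p3.append h2 (by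
    ext w
    simp only [Finset.disjoint_left, Finset.mem_union, Finset.mem_inter, Finset.mem_insert,
      Finset.mem_singleton] at *
    constructor
    · rintro ⟨((h | rfl | h) | h) | h | h, h'⟩
      · exact absurd h' (hdis (Or.inl h))
      · exact absurd (Or.inl hx) (hd (Or.inr h'))
      · exact absurd h' (hdis (Or.inr h))
      · exact absurd (Or.inl h) (hd (Or.inr h'))
      · exact h
      · exact absurd (Or.inr h) (hd (Or.inr h'))
    · rintro rfl; exact ⟨Or.inr (Or.inl rfl), hb⟩)
  convert p4 using 1
  ext w
  simp only [Finset.mem_union, Finset.mem_insert]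
  constructor
  · tauto
  · rintro ((((h | rfl | h) | h) | rfl | h) | h) <;> tauto

theorem Handles.extend {u y y' x : α} {Q S P : Finset α} (h : Handles G u y Q S x)
    (hP : LPath G y y' P) (hQP : Q ∩ P = {y}) : Handles G u y' (Q ∪ P) S x := by
  obtain ⟨t, T, b, U₁, U₂, h1, h2, ht, hT, hS, hTU, hdis, rfl⟩ := h
  have hy := h2.end_mem
  have hyP := hP.start_mem
  refine ⟨t, T, b, U₁, U₂ ∪ P, h1, h2.append hP ?_, ht, hT, hS, hTU, ?_, ?_⟩
  · ext w
    have := Finset.ext_iff.1 hQP w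
    simp only [Finset.mem_union, Finset.mem_inter, Finset.mem_singleton] at this ⊢
    constructor
    · rintro ⟨h, h'⟩; exact this.1 ⟨Or.inr h, h'⟩
    · rintro rfl; exact ⟨hy, hyP⟩
  · rw [Finset.disjoint_union_right]
    refine ⟨hdis, Finset.disjoint_left.2 fun w hw hwP => ?_⟩
    have : w ∈ (U₁ ∪ T ∪ U₂) ∩ P := Finset.mem_inter.2 ⟨Finset.mem_union_left _ hw, hwP⟩
    rw [hQP, Finset.mem_singleton] at this
    exact Finset.disjoint_left.1 hdis hw (this ▸ hy)
  · rw [Finset.union_assoc _ U₂ P]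

/-- `R` allows to link any two vertices of `V` outside `R`. -/
def IsReservoir (G : Finset (Finset α)) (V R : Finset α) : Prop :=
  ∀ y ∈ V \ R, ∀ z ∈ V \ R, y ≠ z → ∃ U ⊆ insert y (insert z R), LPath G y z U

set_option maxHeartbeats 1000000 in
theorem exists_handler_path {M z : ℕ} (hk : 2 ≤ k) (hG : ∀ e ∈ G, e.card = k)
    (hres : ∀ Z : Finset α, Z.card ≤ z → ∃ R ⊆ V \ Z, R.card = M ∧ IsReservoir G V R)
    (P : Finset (Finset α × α))
    (hfr : ∀ p ∈ P, insert p.2 p.1 ∈ G ∧ ∀ Z : Finset α, Z.card ≤ z → ∃ T ⊆ V, ∃ b ∈ V,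
      Disjoint T Z ∧ b ∉ Z ∧ b ∉ T ∧ insert p.2 T ∈ G ∧ insert b T ∈ G ∧ insert b p.1 ∈ G)
    {u : α} {Z₀ : Finset α} (hu : u ∈ V) (huZ : u ∉ Z₀)
    (hz : Z₀.card + 1 + k + P.card * (M + k + 2) ≤ z) :
    ∃ y Q, LPath G u y Q ∧ Q ⊆ V ∧ Disjoint Q Z₀ ∧ Q.card ≤ 1 + P.card * (M + k + 2) ∧
      ∀ p ∈ P, Handles G u y Q p.1 p.2 := by
  induction P using Finset.induction_on with
  | empty => exact ⟨u, {u}, LPath.nil, by simpa using hu, by simpa using huZ, by simp, by simp⟩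
  | insert p P hp ih =>
    rw [Finset.card_insert_of_notMem hp] at hz ⊢
    rw [add_mul, one_mul] at hz ⊢
    obtain ⟨y, Q, hQ, hQV, hQZ, hQc, hQh⟩ :=
      ih (fun p hp => hfr p (Finset.mem_insert_of_mem hp)) (by omega)
    obtain ⟨hpG, hpf⟩ := hfr p (Finset.mem_insert_self _ _)
    have hc1 : (Q ∪ Z₀).card ≤ z := (Finset.card_union_le _ _).trans (by omega)
    obtain ⟨T, hTV, b, hbV, hTZ, hbZ, hbT, hxT, hbTG, hbS⟩ := hpf _ hc1
    have hTc : T.card = k - 1 := by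
      have := hG _ hbTG
      rw [Finset.card_insert_of_notMem hbT] at this
      omega
    obtain ⟨t, ht⟩ : T.Nonempty := Finset.card_pos.1 (by omega)
    have hc2 : (Q ∪ Z₀ ∪ insert b T).card ≤ z := by
      refine (Finset.card_union_le _ _).trans ?_
      have := Finset.card_union_le Q Z₀
      have := hG _ hbTG
      omega
    obtain ⟨R, hR, hRc, hRres⟩ := hres _ hc2
    have hRV : ∀ w ∈ R, w ∈ V ∧ w ∉ Q ∧ w ∉ Z₀ ∧ w ≠ b ∧ w ∉ T := fun w hw => by
      have := hR hw
      simp only [Finset.mem_sdiff, Finset.mem_union, Finset.mem_insert, not_or] at this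
      tauto
    have hTQ : ∀ w ∈ T, w ∉ Q ∧ w ∉ Z₀ := fun w hw => by
      have := Finset.disjoint_left.1 hTZ hw
      simpa using this
    have hbQ : b ∉ Q ∧ b ∉ Z₀ := by simpa using hbZ
    have hy := hQ.end_mem
    have hyt : y ≠ t := fun he => (hTQ t ht).1 (he ▸ hy)
    obtain ⟨U, hUR, hU⟩ := hRres y (Finset.mem_sdiff.2 ⟨hQV hy, fun h => (hRV _ h).2.1 hy⟩)
      t (Finset.mem_sdiff.2 ⟨hTV ht, fun h => (hRV _ h).2.2.2.2 ht⟩) hyt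
    have hUw : ∀ w ∈ U, w = y ∨ w = t ∨ w ∈ R := fun w hw => by simpa using hUR hw
    have hQU : Q ∩ U = {y} := by
      ext w
      rw [Finset.mem_inter, Finset.mem_singleton]
      constructor
      · rintro ⟨h, h'⟩
        rcases hUw w h' with h1 | rfl | h1
        · exact h1
        · exact absurd h (hTQ _ ht).1
        · exact absurd h (hRV w h1).2.1
      · rintro rfl; exact ⟨hy, hU.start_mem⟩
    have hTU : T ∩ U = {t} := by
      ext w
      rw [Finset.mem_inter, Finset.mem_singleton]
      constructor
      · rintro ⟨h, h'⟩
        rcases hUw w h' with rfl | h1 | h1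
        · exact absurd hy (hTQ _ h).1
        · exact h1
        · exact absurd h (hRV w h1).2.2.2.2
      · rintro rfl; exact ⟨ht, hU.end_mem⟩
    have hbU : b ∉ U := fun h => by
      rcases hUw b h with rfl | rfl | h1
      · exact hbQ.1 hy
      · exact hbT ht
      · exact (hRV b h1).2.2.2.1 rfl
    have q1 := hQ.append hU hQU
    have hTQU : T ∩ (Q ∪ U) = {t} := by
      rw [Finset.inter_union_distrib_left, hTU,
        Finset.disjoint_iff_inter_eq_empty.1 (Finset.disjoint_left.2 fun w hw => (hTQ w hw).1),
        Finset.empty_union]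
    have hbt : b ≠ t := fun he => hbT (he ▸ ht)
    have q2 : LPath G y b (U ∪ insert b T) := by
      refine LPath.snoc hU hbTG (Finset.mem_insert_self _ _) hbt ?_
      rw [Finset.insert_inter_of_notMem hbU, hTU]
    have hQU2 : Q ∩ (U ∪ insert b T) = {y} := by
      rw [Finset.inter_union_distrib_left, hQU, Finset.inter_insert_of_notMem hbQ.1,
        Finset.disjoint_iff_inter_eq_empty.1 (Finset.disjoint_left.2 fun w hw h => (hTQ w h).1 hw),
        Finset.union_empty]
    refine ⟨b, Q ∪ (U ∪ insert b T), hQ.append q2 hQU2, ?_, ?_, ?_, ?_⟩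
    · refine Finset.union_subset hQV (Finset.union_subset (fun w hw => ?_)
        (Finset.insert_subset hbV hTV))
      rcases hUw w hw with rfl | rfl | h1
      · exact hQV hy
      · exact hTV ht
      · exact (hRV w h1).1
    · rw [Finset.disjoint_union_left, Finset.disjoint_union_left]
      refine ⟨hQZ, Finset.disjoint_left.2 fun w hw => ?_, ?_⟩
      · rcases hUw w hw with rfl | rfl | h1
        · exact Finset.disjoint_left.1 hQZ hy
        · exact (hTQ _ ht).2
        · exact (hRV w h1).2.2.1
      · rw [Finset.disjoint_insert_left]
        exact ⟨hbQ.2, Finset.disjoint_left.2 fun w hw => (hTQ w hw).2⟩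
    · have h1 := Finset.card_union_le Q (U ∪ insert b T)
      have h2 := Finset.card_union_le U (insert b T)
      have h3 := hG _ hbTG
      have h4 := Finset.card_le_card hUR
      have h5 := Finset.card_insert_le y (insert t R)
      have h6 := Finset.card_insert_le t R
      omega
    · intro p' hp'
      rcases Finset.mem_insert.1 hp' with rfl | hp'
      · refine ⟨t, T, b, Q ∪ U, {b}, q1, LPath.nil, ht, hxT, hbS, hTQU, ?_, ?_⟩
        · rw [Finset.disjoint_singleton_right]
          simp [hbQ.1, hbU, hbT]
        · ext w
          simp only [Finset.mem_union, Finset.mem_insert, Finset.mem_singleton]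
          tauto
      · exact (hQh p' hp').extend q2 hQU2

end Handlers

theorem card_superset_mul_pow_le {α : Type} [DecidableEq α] {X e : Finset α} {M : ℕ} (he : e ⊆ X)
    (hMX : M ≤ X.card) :
    ((X.powersetCard M).filter fun A => e ⊆ A).card * X.card ^ e.card ≤
      M ^ e.card * X.card.choose M := by
  have key : ∀ j ≤ M, (X.card - j).choose (M - j) * X.card ^ j ≤ M ^ j * X.card.choose M := by
    intro j
    induction j with
    | zero => intro _; simp
    | succ j ih =>
      intro hj
      have ih := ih (by omega)
      obtain ⟨a, ha⟩ := Nat.exists_eq_add_of_le' (show 1 ≤ M - j by omega)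
      obtain ⟨b, hb⟩ := Nat.exists_eq_add_of_le' (show 1 ≤ X.card - j by omega)
      have h1 := Nat.add_one_mul_choose_eq b a
      rw [show X.card - (j + 1) = b by omega, show M - (j + 1) = a by omega]
      rw [ha, hb] at ih
      have hM : M = a + 1 + j := by omega
      have hX : X.card = b + 1 + j := by omega
      have hab : a ≤ b := by omega
      have h2 : (a + 1) * X.card ≤ M * (b + 1) := by
        rw [hM, hX]; nlinarith
      refine Nat.le_of_mul_le_mul_left (c := b + 1) ?_ (Nat.succ_pos b)
      calc (b + 1) * (b.choose a * X.card ^ (j + 1))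
          = ((b + 1).choose (a + 1) * X.card ^ j) * ((a + 1) * X.card) := by
            rw [pow_succ, ← mul_assoc, h1]; ring
        _ ≤ (M ^ j * X.card.choose M) * (M * (b + 1)) := Nat.mul_le_mul ih h2
        _ = _ := by ring
  by_cases h : e.card ≤ M
  · refine le_trans (Nat.mul_le_mul_right _ ?_) (key _ h)
    calc _ ≤ ((X \ e).powersetCard (M - e.card)).card := by
          refine Finset.card_le_card_of_injOn (fun A => A \ e) (fun A hA => ?_) ?_
          · rw [Finset.mem_coe, Finset.mem_filter, Finset.mem_powersetCard] at hA
            rw [Finset.mem_coe, Finset.mem_powersetCard, Finset.card_sdiff_of_subset hA.2, hA.1.2]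
            exact ⟨Finset.sdiff_subset_sdiff hA.1.1 subset_rfl, rfl⟩
          · intro A hA B hB hAB
            rw [Finset.mem_coe, Finset.mem_filter] at hA hB
            have hAB' : A \ e = B \ e := hAB
            rw [← Finset.sdiff_union_of_subset hA.2, hAB', Finset.sdiff_union_of_subset hB.2]
      _ = _ := by rw [Finset.card_powersetCard, Finset.card_sdiff_of_subset he]
  · rw [Finset.card_eq_zero.2, zero_mul]
    · exact Nat.zero_le _
    · refine Finset.filter_eq_empty_iff.2 fun A hA heA => h ?_
      rw [← (Finset.mem_powersetCard.1 hA).2]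
      exact Finset.card_le_card heA

theorem exists_const_pow_le_choose (j : ℕ) :
    ∃ c : ℝ, 0 < c ∧ ∀ n : ℕ, 2 * j + 2 ≤ n → c * (n : ℝ) ^ j ≤ (n - 1).choose j := by
  refine ⟨1 / (2 ^ j * j.factorial), by positivity, fun n hn => ?_⟩
  have h1 := Nat.pow_sub_le_descFactorial (n - 1) j
  rw [Nat.descFactorial_eq_factorial_mul_choose] at h1
  have h2 : (n : ℝ) / 2 ≤ ((n - 1 + 1 - j : ℕ) : ℝ) := by
    rw [Nat.sub_add_cancel (by omega), Nat.cast_sub (by omega)]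
    have : (2 * j + 2 : ℝ) ≤ n := by exact_mod_cast hn
    linarith
  have h3 : ((n : ℝ) / 2) ^ j ≤ j.factorial * (n - 1).choose j :=
    (pow_le_pow_left₀ (by positivity) h2 j).trans (by exact_mod_cast h1)
  rw [div_pow] at h3
  rw [div_mul_eq_mul_div, one_mul, div_le_iff₀ (by positivity)]
  rw [div_le_iff₀ (by positivity)] at h3
  linarith

section Friends

variable {α : Type} [DecidableEq α]

set_option linter.unusedSectionVars false

variable {G : Finset (Finset α)} {k : ℕ} {V : Finset α}

theorem mem_lk_singleton (hk : 2 ≤ k) {T : Finset α} {x : α} (hG : ∀ e ∈ G, e.card = k) :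
    T ∈ lk G V {x} (k - 1) ↔ T ⊆ V ∧ x ∉ T ∧ insert x T ∈ G := by
  rw [mem_lk, Finset.disjoint_singleton_right, Finset.union_comm, ← Finset.insert_eq]
  constructor
  · rintro ⟨⟨h1, -⟩, h2⟩; exact ⟨h1, h2⟩
  · rintro ⟨h1, h2, h3⟩
    refine ⟨⟨h1, ?_⟩, h2, h3⟩
    have := hG _ h3
    rw [Finset.card_insert_of_notMem h2] at this
    omega

theorem card_lk_insert_sum_le {d : ℕ} (hd1 : 1 ≤ d) (hdk : d ≤ k - 1) (hk : 2 ≤ k) {x : α} :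
    ∑ D ∈ (V.erase x).powersetCard (d - 1), (lk G V (insert x D) (k - d)).card ≤
      2 ^ (k - 1) * (lk G V {x} (k - 1)).card := by
  rw [← Finset.card_sigma]
  have : 2 ^ (k - 1) * (lk G V {x} (k - 1)).card =
      ((lk G V {x} (k - 1)).sigma fun E => E.powerset).card := by
    rw [Finset.card_sigma, Finset.sum_congr rfl fun E hE => by
      rw [Finset.card_powerset, (mem_lk.1 hE).1.2]]
    simp [mul_comm]
  rw [this]
  refine Finset.card_le_card_of_injOn (fun p => ⟨p.1 ∪ p.2, p.1⟩) ?_ ?_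
  · rintro ⟨D, F⟩ h
    simp only [Finset.mem_coe, Finset.mem_sigma, Finset.mem_powersetCard, mem_lk,
      Finset.disjoint_insert_right, Finset.mem_powerset] at h ⊢
    obtain ⟨⟨hD, hDc⟩, ⟨hF, hFc⟩, ⟨hxF, hFD⟩, hGe⟩ := h
    have hxD : x ∉ D := fun h => (Finset.mem_erase.1 (hD h)).1 rfl
    refine ⟨⟨⟨Finset.union_subset (hD.trans (Finset.erase_subset _ _)) hF, ?_⟩, ?_, ?_⟩,
      Finset.subset_union_left⟩
    · rw [Finset.card_union_of_disjoint hFD.symm, hDc, hFc]; omega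
    · simp [hxD, hxF]
    · convert hGe using 1
      ext w; simp; tauto
  · rintro ⟨D, F⟩ h ⟨D', F'⟩ h' he
    simp only [Finset.mem_coe, Finset.mem_sigma, mem_lk, Finset.disjoint_insert_right] at h h'
    simp only [Sigma.mk.injEq, heq_eq_eq] at he
    obtain ⟨he, rfl⟩ := he
    have h1 : F = (D ∪ F) \ D := by
      rw [Finset.union_sdiff_cancel_left h.2.2.1.2.symm]
    have h2 : F' = (D ∪ F') \ D := by
      rw [Finset.union_sdiff_cancel_left h'.2.2.1.2.symm]
    rw [h1, h2, he]

theorem exists_min_vertex_degree {d : ℕ} (hd1 : 1 ≤ d) (hdk : d ≤ k - 1) (hk : 2 ≤ k) {κ : ℝ}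
    (hκ : 0 < κ) : ∃ γ : ℝ, 0 < γ ∧ ∀ (α : Type) [DecidableEq α] (G : Finset (Finset α))
      (V : Finset α), (∀ e ∈ G, e.card = k) → 2 * d + 2 ≤ V.card →
      (∀ D ⊆ V, D.card = d → κ * (V.card : ℝ) ^ (k - d) ≤ (lk G V D (k - d)).card) →
      ∀ x ∈ V, γ * (V.card : ℝ) ^ (k - 1) ≤ (lk G V {x} (k - 1)).card := by
  obtain ⟨c, hc, hc'⟩ := exists_const_pow_le_choose (d - 1)
  refine ⟨c * κ / 2 ^ (k - 1), by positivity, fun α _ G V hG hV hdeg x hx => ?_⟩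
  have h1 := card_lk_insert_sum_le (G := G) (V := V) (x := x) hd1 hdk hk
  have h2 : ∀ D ∈ (V.erase x).powersetCard (d - 1), κ * (V.card : ℝ) ^ (k - d) ≤
      (lk G V (insert x D) (k - d)).card := fun D hD => by
    rw [Finset.mem_powersetCard] at hD
    refine hdeg _ (Finset.insert_subset hx (hD.1.trans (Finset.erase_subset _ _))) ?_
    rw [Finset.card_insert_of_notMem fun h => (Finset.mem_erase.1 (hD.1 h)).1 rfl, hD.2]
    omega
  have h3 := Finset.sum_le_sum h2
  rw [Finset.sum_const, Finset.card_powersetCard, Finset.card_erase_of_mem hx, nsmul_eq_mul] at h3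
  have h4 : (∑ D ∈ (V.erase x).powersetCard (d - 1), ((lk G V (insert x D) (k - d)).card : ℝ)) ≤
      2 ^ (k - 1) * (lk G V {x} (k - 1)).card := by exact_mod_cast h1
  have h5 := mul_le_mul_of_nonneg_right (hc' V.card (by omega))
    (show 0 ≤ κ * (V.card : ℝ) ^ (k - d) by positivity)
  rw [div_mul_eq_mul_div, div_le_iff₀ (by positivity)]
  have h6 : (V.card : ℝ) ^ (k - 1) = (V.card : ℝ) ^ (d - 1) * (V.card : ℝ) ^ (k - d) := by
    rw [← pow_add]; congr 1; omega
  rw [h6]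
  calc _ = c * (V.card : ℝ) ^ (d - 1) * (κ * (V.card : ℝ) ^ (k - d)) := by ring
    _ ≤ _ := by linarith

/-- The pairs `(T, b)` that can swap the edge `insert x S` into a path. -/
def comp (G : Finset (Finset α)) (k : ℕ) (V S : Finset α) (x : α) : Finset (Finset α × α) :=
  ((V.powersetCard (k - 1)) ×ˢ V).filter fun p =>
    p.1 ∈ lk G V {x} (k - 1) ∧ p.1 ∈ lk G V {p.2} (k - 1) ∧ S ∈ lk G V {p.2} (k - 1)

theorem card_unfriendly_le {γ B : ℝ} {S X : Finset α} (hγ : 0 < γ) (hX : X ⊆ V)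
    (hS : ∀ x ∈ X, S ∈ lk G V {x} (k - 1))
    (hdeg : ∀ x ∈ V, γ * (V.card : ℝ) ^ (k - 1) ≤ (lk G V {x} (k - 1)).card)
    (hB : ∀ x ∈ X, ((comp G k V S x).card : ℝ) ≤ B) :
    γ ^ 2 * (V.card : ℝ) ^ (k - 1) * X.card ≤ B * (if X.card = 0 then 0 else 1) := by
  rcases Finset.eq_empty_or_nonempty X with rfl | hne
  · simp
  have hXc : 0 < X.card := Finset.card_pos.2 hne
  rw [if_neg hXc.ne', mul_one]
  have hX0 : (0 : ℝ) < X.card := by exact_mod_cast hXc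
  have hV0 : (0 : ℝ) < V.card := by exact_mod_cast hXc.trans_le (Finset.card_le_card hX)
  set P := V.powersetCard (k - 1) with hP
  have hPc : (P.card : ℝ) ≤ (V.card : ℝ) ^ (k - 1) := by
    rw [hP, Finset.card_powersetCard]; exact_mod_cast Nat.choose_le_pow _ _
  let f : Finset α → ℕ := fun T => (X.filter fun x => T ∈ lk G V {x} (k - 1)).card
  have hfilt : ∀ x, P.filter (fun T => T ∈ lk G V {x} (k - 1)) = lk G V {x} (k - 1) := fun x => by
    ext T
    rw [Finset.mem_filter, hP, Finset.mem_powersetCard]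
    exact ⟨fun h => h.2, fun h => ⟨(mem_lk.1 h).1, h⟩⟩
  have h1 : ∑ T ∈ P, f T = ∑ x ∈ X, (lk G V {x} (k - 1)).card := by
    simp only [f, Finset.card_filter]
    rw [Finset.sum_comm]
    refine Finset.sum_congr rfl fun x _ => ?_
    rw [← Finset.card_filter, hfilt]
  have h2 : ∑ T ∈ P, f T ^ 2 ≤ ∑ x ∈ X, (comp G k V S x).card := by
    have : ∀ T, f T ^ 2 = ∑ x ∈ X, if T ∈ lk G V {x} (k - 1) then
        (X.filter fun b => T ∈ lk G V {b} (k - 1)).card else 0 := fun T => by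
      rw [sq, ← Finset.sum_filter, Finset.sum_const, smul_eq_mul]
    simp only [this]
    rw [Finset.sum_comm]
    refine Finset.sum_le_sum fun x hx => ?_
    rw [← Finset.sum_filter, ← Finset.card_sigma]
    refine Finset.card_le_card_of_injOn (fun p => (p.1, p.2)) ?_ ?_
    · rintro ⟨T, b⟩ h
      simp only [Finset.mem_coe, Finset.mem_sigma, Finset.mem_filter] at h
      simp only [comp, Finset.mem_coe, Finset.mem_filter, Finset.mem_product]
      exact ⟨⟨h.1.1, hX h.2.1⟩, h.1.2, h.2.2, hS b h.2.1⟩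
    · rintro ⟨T, b⟩ _ ⟨T', b'⟩ _ he
      simpa using he
  have h3 : (∑ T ∈ P, (f T : ℝ)) ^ 2 ≤ P.card * ∑ T ∈ P, (f T : ℝ) ^ 2 :=
    sq_sum_le_card_mul_sum_sq
  have h4 : γ * (V.card : ℝ) ^ (k - 1) * X.card ≤ ∑ T ∈ P, (f T : ℝ) := by
    have : (∑ T ∈ P, (f T : ℝ)) = ∑ x ∈ X, ((lk G V {x} (k - 1)).card : ℝ) := by exact_mod_cast h1
    rw [this]
    calc _ = ∑ x ∈ X, γ * (V.card : ℝ) ^ (k - 1) := by simp; ring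
      _ ≤ _ := Finset.sum_le_sum fun x hx => hdeg x (hX hx)
  have h5 : ∑ T ∈ P, (f T : ℝ) ^ 2 ≤ X.card * B := by
    calc ∑ T ∈ P, (f T : ℝ) ^ 2 ≤ ∑ x ∈ X, ((comp G k V S x).card : ℝ) := by exact_mod_cast h2
      _ ≤ ∑ x ∈ X, B := Finset.sum_le_sum hB
      _ = _ := by simp
  have h50 : 0 ≤ ∑ T ∈ P, (f T : ℝ) ^ 2 := Finset.sum_nonneg fun _ _ => sq_nonneg _
  have h6 : (γ * (V.card : ℝ) ^ (k - 1) * X.card) ^ 2 ≤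
      (V.card : ℝ) ^ (k - 1) * (X.card * B) :=
    calc _ ≤ (∑ T ∈ P, (f T : ℝ)) ^ 2 := pow_le_pow_left₀ (by positivity) h4 2
      _ ≤ _ := h3
      _ ≤ (V.card : ℝ) ^ (k - 1) * ∑ T ∈ P, (f T : ℝ) ^ 2 := mul_le_mul_of_nonneg_right hPc h50
      _ ≤ _ := mul_le_mul_of_nonneg_left h5 (by positivity)
  refine le_of_mul_le_mul_left (a := (V.card : ℝ) ^ (k - 1) * X.card) ?_ (by positivity)
  calc _ = (γ * (V.card : ℝ) ^ (k - 1) * X.card) ^ 2 := by ring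
    _ ≤ _ := h6
    _ = _ := by ring

theorem exists_comp_avoiding (hk : 2 ≤ k) (hG : ∀ e ∈ G, e.card = k) {S : Finset α} {x : α} {z : ℕ}
    (hc : 2 * z * V.card ^ (k - 1) < (comp G k V S x).card) {Z : Finset α} (hZ : Z.card ≤ z) :
    ∃ T ⊆ V, ∃ b ∈ V, Disjoint T Z ∧ b ∉ Z ∧ b ∉ T ∧ insert x T ∈ G ∧ insert b T ∈ G ∧
      insert b S ∈ G := by
  by_contra! hcon
  have hsub : comp G k V S x ⊆ (((V.powersetCard (k - 2 + 1)).filter fun F => ¬ Disjoint F Z) ×ˢ V) ∪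
      ((V.powersetCard (k - 1)) ×ˢ Z) := fun p hp => by
    rw [comp, Finset.mem_filter, Finset.mem_product, Finset.mem_powersetCard,
      mem_lk_singleton hk hG, mem_lk_singleton hk hG, mem_lk_singleton hk hG] at hp
    obtain ⟨⟨⟨h1, h2⟩, h3⟩, h4, h5, h6⟩ := hp
    rw [Finset.mem_union, Finset.mem_product, Finset.mem_product, Finset.mem_filter,
      Finset.mem_powersetCard, Finset.mem_powersetCard, show k - 2 + 1 = k - 1 by omega]
    by_cases hd : Disjoint p.1 Z
    · refine Or.inr ⟨⟨h1, h2⟩, ?_⟩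
      by_contra hb
      exact hcon p.1 h1 p.2 h3 hd hb h5.2.1 h4.2.2 h5.2.2 h6.2.2
    · exact Or.inl ⟨⟨⟨h1, h2⟩, hd⟩, h3⟩
  have h1 := (Finset.card_le_card hsub).trans (Finset.card_union_le _ _)
  rw [Finset.card_product, Finset.card_product, Finset.card_powersetCard] at h1
  have h2 := card_powersetCard_meeting_le V Z (k - 2)
  have h3 := Nat.choose_le_pow V.card (k - 1)
  have h4 : V.card ^ (k - 1) = V.card ^ (k - 2) * V.card := by
    rw [← pow_succ]; congr 1; omega
  have h5 : Z.card * V.card ^ (k - 2) * V.card ≤ z * V.card ^ (k - 1) := by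
    rw [h4, mul_assoc]; exact Nat.mul_le_mul_right _ hZ
  have h6 := Nat.mul_le_mul_right V.card h2
  have h7 := Nat.mul_le_mul h3 hZ
  rw [mul_assoc] at hc
  rw [mul_comm _ z] at h7
  omega

end Friends

/-- Every large `k`-graph of relative minimum `d`-degree `β` has a loose Hamilton cycle. -/
def HamBB (k d : ℕ) (β : ℝ) (n₀ : ℕ) : Prop :=
  ∀ (α : Type) [DecidableEq α] (G : Finset (Finset α)) (V : Finset α), (∀ e ∈ G, e.card = k) →
    n₀ ≤ V.card → (k - 1) ∣ V.card →
    (∀ D ⊆ V, D.card = d → β * (V.card : ℝ) ^ (k - d) ≤ (lk G V D (k - d)).card) →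
    ∃ F, IsHC G k V F

section Connect

variable {α : Type} [DecidableEq α] {G : Finset (Finset α)} {k d : ℕ} {V : Finset α}

theorem exists_sample {X Y : Finset α} {d r M : ℕ} {η θ : ℝ} {Bad : Finset α → Prop}
    [DecidablePred Bad] (hM : 0 < M) (hMX : M < X.card) (hη : 0 ≤ η)
    (hdeg : ∀ D ⊆ Y, D.card = d → θ * (X.card : ℝ) ^ r ≤ (lk G X D r).card)
    (hsmall : (Y.card : ℝ) ^ d * (X.card + 1) ^ (r + 1) * Real.exp (-(η ^ 2 * M / 2)) < 1 / 2)
    (hBad : (((X.powersetCard M).filter Bad).card : ℝ) ≤ 1 / 2 * X.card.choose M) :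
    ∃ A ⊆ X, A.card = M ∧ ¬ Bad A ∧
      ∀ D ⊆ Y, D.card = d → (θ - r * η) * (M : ℝ) ^ r ≤ (lk G A D r).card := by
  by_contra! hcon
  have h1 := card_bad_subsets_le G hM hMX hη hdeg
  have hC : (0 : ℝ) < X.card.choose M := by exact_mod_cast Nat.choose_pos hMX.le
  have h2 : (X.powersetCard M) ⊆ (X.powersetCard M).filter Bad ∪
      (X.powersetCard M).filter fun A => ∃ D ∈ Y.powersetCard d,
      ((lk G A D r).card : ℝ) < (θ - r * η) * M ^ r := fun A hA => by
    rw [Finset.mem_union, Finset.mem_filter, Finset.mem_filter]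
    by_cases hb : Bad A
    · exact Or.inl ⟨hA, hb⟩
    · have hA' := Finset.mem_powersetCard.1 hA
      obtain ⟨D, hD, hDc, hlt⟩ := hcon A hA'.1 hA'.2 hb
      exact Or.inr ⟨hA, D, Finset.mem_powersetCard.2 ⟨hD, hDc⟩, hlt⟩
  have h3 := (Finset.card_le_card h2).trans (Finset.card_union_le _ _)
  rw [Finset.card_powersetCard] at h3
  have h4 := (Nat.cast_le (α := ℝ)).2 h3
  rw [Nat.cast_add] at h4
  have h5 := mul_lt_mul_of_pos_right hsmall hC
  linarith

theorem le_card_lk_sdiff {β κ : ℝ} {r : ℕ} (hβ : 0 ≤ β) (hκ : 0 < κ) (hr : 1 ≤ r)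
    {Y Z : Finset α} (hZ : (Z.card : ℝ) ≤ κ / 2 * V.card)
    (hdeg : ∀ D ⊆ Y, D.card = d → (β + κ) * (V.card : ℝ) ^ r ≤ (lk G V D r).card) :
    ∀ D ⊆ Y, D.card = d → (β + κ / 2) * ((V \ Z).card : ℝ) ^ r ≤ (lk G (V \ Z) D r).card := by
  intro D hD hDc
  obtain ⟨r, rfl⟩ := Nat.exists_eq_add_of_le' hr
  have h1 := hdeg D hD hDc
  have h2 : ((lk G V D (r + 1)).card : ℝ) ≤
      (lk G (V \ Z) D (r + 1)).card + Z.card * (V.card : ℝ) ^ r := by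
    exact_mod_cast card_lk_le_sdiff G V Z D r
  have h3 : (Z.card : ℝ) * (V.card : ℝ) ^ r ≤ κ / 2 * (V.card : ℝ) ^ (r + 1) := by
    rw [pow_succ' _ r, ← mul_assoc]
    exact mul_le_mul_of_nonneg_right hZ (by positivity)
  have h4 : ((V \ Z).card : ℝ) ^ (r + 1) ≤ (V.card : ℝ) ^ (r + 1) :=
    pow_le_pow_left₀ (by positivity)
      (by exact_mod_cast Finset.card_le_card Finset.sdiff_subset) _
  have h5 := mul_le_mul_of_nonneg_left h4 (show 0 ≤ β + κ / 2 by positivity)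
  nlinarith

theorem exists_reservoir {β κ : ℝ} {n₀ M q z : ℕ} (hk : 2 ≤ k) (hdk : d ≤ k - 1) (hβ : 0 ≤ β)
    (hκ : 0 < κ) (hBB : HamBB k d β n₀) (hG : ∀ e ∈ G, e.card = k) (hM : 0 < M) {η : ℝ}
    (hη : 0 ≤ η) (hηκ : (k - d : ℕ) * η ≤ κ / 4) (hMz : M + z < V.card) (hMq : M + 2 = (k - 1) * q)
    (hq : 3 ≤ q) (hMn : n₀ ≤ M + 2) (hz : (z : ℝ) ≤ κ / 2 * V.card)
    (hsmall : (V.card : ℝ) ^ d * (V.card + 1) ^ (k - d + 1) * Real.exp (-(η ^ 2 * M / 2)) < 1 / 2)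
    (hMβ : β * ((M : ℝ) + 2) ^ (k - d) ≤ (β + κ / 4) * (M : ℝ) ^ (k - d))
    (hdeg : ∀ D ⊆ V, D.card = d → (β + κ) * (V.card : ℝ) ^ (k - d) ≤ (lk G V D (k - d)).card)
    (Z : Finset α) (hZ : Z.card ≤ z) :
    ∃ R ⊆ V \ Z, R.card = M ∧ IsReservoir G V R := by
  have hZ' : (Z.card : ℝ) ≤ κ / 2 * V.card := le_trans (by exact_mod_cast hZ) hz
  have hX := Finset.le_card_sdiff Z V
  have hXV : (V \ Z).card ≤ V.card := Finset.card_le_card Finset.sdiff_subset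
  obtain ⟨R, hR, hRc, -, hRd⟩ := exists_sample (Bad := fun _ => False) hM
    (show M < (V \ Z).card by omega) hη (le_card_lk_sdiff hβ hκ (by omega) hZ' hdeg)
    (lt_of_le_of_lt (by gcongr) hsmall) (by simp)
  refine ⟨R, hR, hRc, fun y hy w hw hyw => ?_⟩
  rw [Finset.mem_sdiff] at hy hw
  have hc : (insert y (insert w R)).card = M + 2 := by
    rw [Finset.card_insert_of_notMem, Finset.card_insert_of_notMem hw.2, hRc]
    simp [hyw, hy.2]
  obtain ⟨F, hF⟩ := hBB α G (insert y (insert w R)) hG (by omega) (by rw [hc, hMq]; simp)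
    fun D hD hDc => by
      rw [hc]
      have h1 := hRd D (hD.trans (Finset.insert_subset hy.1 (Finset.insert_subset hw.1
        (hR.trans Finset.sdiff_subset)))) hDc
      have h2 : ((lk G R D (k - d)).card : ℝ) ≤ (lk G (insert y (insert w R)) D (k - d)).card := by
        exact_mod_cast Finset.card_le_card (lk_mono
          ((Finset.subset_insert _ _).trans (Finset.subset_insert _ _)))
      refine le_trans ?_ (h1.trans h2)
      push_cast
      refine hMβ.trans (mul_le_mul_of_nonneg_right ?_ (by positivity))
      linarith
  exact hF.connect hk (hc.trans hMq) hq (by simp) (by simp) hyw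

/-- The pairs `(S, x)` such that `insert x S` is an edge with too few swaps. -/
def unfriendly (G : Finset (Finset α)) (k z : ℕ) (V : Finset α) : Finset (Finset α × α) :=
  ((V.powersetCard (k - 1)) ×ˢ V).filter fun p => p.1 ∈ lk G V {p.2} (k - 1) ∧
    (comp G k V p.1 p.2).card ≤ 2 * z * V.card ^ (k - 1)

theorem card_unfriendly_pairs_le {γ : ℝ} {z : ℕ} (hγ : 0 < γ) (hV : 0 < V.card)
    (hdeg : ∀ x ∈ V, γ * (V.card : ℝ) ^ (k - 1) ≤ (lk G V {x} (k - 1)).card) :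
    ((unfriendly G k z V).card : ℝ) * γ ^ 2 ≤ (V.card : ℝ) ^ (k - 1) * (2 * z) := by
  have h1 : (unfriendly G k z V).card = ∑ S ∈ V.powersetCard (k - 1), (V.filter fun x =>
      S ∈ lk G V {x} (k - 1) ∧ (comp G k V S x).card ≤ 2 * z * V.card ^ (k - 1)).card := by
    rw [← Finset.card_sigma]
    refine Finset.card_bij' (fun p _ => ⟨p.1, p.2⟩) (fun p _ => (p.1, p.2)) ?_ ?_ ?_ ?_
    · intro p hp
      simp only [unfriendly, Finset.mem_filter, Finset.mem_product] at hp
      simp only [Finset.mem_sigma, Finset.mem_filter]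
      tauto
    · intro p hp
      simp only [Finset.mem_sigma, Finset.mem_filter] at hp
      simp only [unfriendly, Finset.mem_filter, Finset.mem_product]
      tauto
    · intros; rfl
    · intros; rfl
  have hV0 : (0 : ℝ) < (V.card : ℝ) ^ (k - 1) := by
    have : (0 : ℝ) < V.card := by exact_mod_cast hV
    positivity
  have h2 : ∀ S ∈ V.powersetCard (k - 1), ((V.filter fun x =>
      S ∈ lk G V {x} (k - 1) ∧ (comp G k V S x).card ≤ 2 * z * V.card ^ (k - 1)).card : ℝ) * γ ^ 2
      ≤ 2 * z := fun S _ => by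
    set X := V.filter fun x =>
      S ∈ lk G V {x} (k - 1) ∧ (comp G k V S x).card ≤ 2 * z * V.card ^ (k - 1) with hX
    have h3 := card_unfriendly_le (B := 2 * z * (V.card : ℝ) ^ (k - 1)) (S := S) (X := X) hγ
      (Finset.filter_subset _ _) (fun x hx => (Finset.mem_filter.1 hx).2.1) hdeg
      (fun x hx => by exact_mod_cast (Finset.mem_filter.1 hx).2.2)
    have h4 : 2 * (z : ℝ) * (V.card : ℝ) ^ (k - 1) * (if X.card = 0 then 0 else 1) ≤
        2 * z * (V.card : ℝ) ^ (k - 1) * 1 :=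
      mul_le_mul_of_nonneg_left (by split_ifs <;> norm_num) (by positivity)
    refine le_of_mul_le_mul_left ?_ hV0
    linarith
  have h3 : ((V.powersetCard (k - 1)).card : ℝ) ≤ (V.card : ℝ) ^ (k - 1) := by
    rw [Finset.card_powersetCard]; exact_mod_cast Nat.choose_le_pow _ _
  rw [h1]
  push_cast
  rw [Finset.sum_mul]
  refine (Finset.sum_le_sum h2).trans ?_
  rw [Finset.sum_const, nsmul_eq_mul]
  exact mul_le_mul_of_nonneg_right h3 (by positivity)

theorem exists_absorbing_pool {β κ γ : ℝ} {M z : ℕ} (hk : 2 ≤ k) (hdk : d ≤ k - 1)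
    (hβ : 0 ≤ β) (hκ : 0 < κ) (hγ : 0 < γ) (hG : ∀ e ∈ G, e.card = k) (hM : 0 < M) {η : ℝ}
    (hη : 0 ≤ η) (hηκ : (k - d : ℕ) * η ≤ κ / 4) (hMz : M + 4 ≤ V.card)
    (hz2 : (2 : ℝ) ≤ κ / 2 * V.card)
    (hsmall : (V.card : ℝ) ^ d * (V.card + 1) ^ (k - d + 1) * Real.exp (-(η ^ 2 * M / 2)) < 1 / 2)
    (hzM : 2 ^ (k + 2) * (z : ℝ) * (M : ℝ) ^ k ≤ γ ^ 2 * V.card)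
    (hdeg : ∀ D ⊆ V, D.card = d → (β + κ) * (V.card : ℝ) ^ (k - d) ≤ (lk G V D (k - d)).card)
    (hdeg1 : ∀ x ∈ V, γ * (V.card : ℝ) ^ (k - 1) ≤ (lk G V {x} (k - 1)).card)
    (Z : Finset α) (hZ : Z.card ≤ 2) :
    ∃ W ⊆ V \ Z, W.card = M ∧
      (∀ S x, insert x S ⊆ W → x ∉ S → insert x S ∈ G →
        2 * z * V.card ^ (k - 1) < (comp G k V S x).card) ∧
      ∀ D ⊆ V, D.card = d → (β + κ / 4) * (M : ℝ) ^ (k - d) ≤ (lk G W D (k - d)).card := by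
  have hZ' : (Z.card : ℝ) ≤ κ / 2 * V.card := le_trans (by exact_mod_cast hZ) hz2
  have hX := Finset.le_card_sdiff Z V
  have hXV : (V \ Z).card ≤ V.card := Finset.card_le_card Finset.sdiff_subset
  set X := V \ Z with hXdef
  have hX0 : (0 : ℝ) < X.card := by exact_mod_cast (show 0 < X.card by omega)
  have hV0 : (0 : ℝ) < V.card := by exact_mod_cast (show 0 < V.card by omega)
  have hXV2 : (V.card : ℝ) ≤ 2 * X.card := by exact_mod_cast (show V.card ≤ 2 * X.card by omega)
  have hbad : (((X.powersetCard M).filter fun A => ∃ p ∈ unfriendly G k z V,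
      insert p.2 p.1 ⊆ A).card : ℝ) ≤ 1 / 2 * X.card.choose M := by
    have h1 : ((X.powersetCard M).filter fun A => ∃ p ∈ unfriendly G k z V,
      insert p.2 p.1 ⊆ A) ⊆ (unfriendly G k z V).biUnion fun p =>
        (X.powersetCard M).filter fun A => insert p.2 p.1 ⊆ A := fun A hA => by
      rw [Finset.mem_filter] at hA
      obtain ⟨hA, p, hp, hpA⟩ := hA
      exact Finset.mem_biUnion.2 ⟨p, hp, Finset.mem_filter.2 ⟨hA, hpA⟩⟩
    have h2 : ∀ p ∈ unfriendly G k z V,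
        (((X.powersetCard M).filter fun A => insert p.2 p.1 ⊆ A).card : ℝ) ≤
        (M : ℝ) ^ k * X.card.choose M / (X.card : ℝ) ^ k := fun p hp => by
      rw [le_div_iff₀ (by positivity)]
      by_cases hpX : insert p.2 p.1 ⊆ X
      · have h3 := card_superset_mul_pow_le hpX (show M ≤ X.card by omega)
        rw [unfriendly, Finset.mem_filter] at hp
        rw [hG _ ((mem_lk_singleton hk hG).1 hp.2.1).2.2] at h3
        exact_mod_cast h3
      · rw [Finset.card_eq_zero.2]
        · push_cast; rw [zero_mul]; positivity
        · exact Finset.filter_eq_empty_iff.2 fun A hA h =>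
            hpX (h.trans (Finset.mem_powersetCard.1 hA).1)
    have h3 : (((X.powersetCard M).filter fun A => ∃ p ∈ unfriendly G k z V,
      insert p.2 p.1 ⊆ A).card : ℝ) ≤ (unfriendly G k z V).card *
        ((M : ℝ) ^ k * X.card.choose M / (X.card : ℝ) ^ k) := by
      calc _ ≤ (((unfriendly G k z V).biUnion fun p =>
            (X.powersetCard M).filter fun A => insert p.2 p.1 ⊆ A).card : ℝ) := by
            exact_mod_cast Finset.card_le_card h1
        _ ≤ ∑ p ∈ unfriendly G k z V,
            (((X.powersetCard M).filter fun A => insert p.2 p.1 ⊆ A).card : ℝ) := by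
            exact_mod_cast Finset.card_biUnion_le
        _ ≤ _ := by
            refine (Finset.sum_le_sum h2).trans ?_
            rw [Finset.sum_const, nsmul_eq_mul]
    refine h3.trans ?_
    have h4 := card_unfriendly_pairs_le (z := z) hγ (show 0 < V.card by omega) hdeg1
    have h5 : ((unfriendly G k z V).card : ℝ) * (M : ℝ) ^ k ≤ 1 / 2 * (X.card : ℝ) ^ k := by
      have hγ2 : 0 < γ ^ 2 := by positivity
      refine le_of_mul_le_mul_right ?_ (mul_pos hγ2 hV0)
      have h6 : (V.card : ℝ) ^ k ≤ 2 ^ k * (X.card : ℝ) ^ k := by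
        rw [← mul_pow]; exact pow_le_pow_left₀ hV0.le hXV2 _
      have h7 : (V.card : ℝ) ^ k = (V.card : ℝ) ^ (k - 1) * V.card := by
        rw [← pow_succ]; congr 1; omega
      have h8 : 0 < (X.card : ℝ) ^ k := by positivity
      calc ((unfriendly G k z V).card : ℝ) * (M : ℝ) ^ k * (γ ^ 2 * V.card)
          = ((unfriendly G k z V).card * γ ^ 2) * ((M : ℝ) ^ k * V.card) := by ring
        _ ≤ ((V.card : ℝ) ^ (k - 1) * (2 * z)) * ((M : ℝ) ^ k * V.card) := by gcongr
        _ = (V.card : ℝ) ^ k * (2 * z * (M : ℝ) ^ k) := by rw [h7]; ring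
        _ ≤ (2 ^ k * (X.card : ℝ) ^ k) * (2 * z * (M : ℝ) ^ k) := by gcongr
        _ = 1 / 2 * (X.card : ℝ) ^ k * (2 ^ (k + 2) * (z : ℝ) * (M : ℝ) ^ k) := by ring
        _ ≤ _ := by gcongr
    rw [mul_div_assoc', div_le_iff₀ (by positivity), ← mul_assoc]
    nlinarith [mul_le_mul_of_nonneg_right h5 (show (0 : ℝ) ≤ X.card.choose M by positivity)]
  obtain ⟨W, hW, hWc, hWb, hWd⟩ := exists_sample
    (Bad := fun A => ∃ p ∈ unfriendly G k z V, insert p.2 p.1 ⊆ A) hM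
    (show M < X.card by omega) hη (le_card_lk_sdiff hβ hκ (by omega) hZ' hdeg)
    (lt_of_le_of_lt (by gcongr) hsmall) hbad
  refine ⟨W, hW, hWc, fun S x hSx hx hSG => ?_, fun D hD hDc => ?_⟩
  · by_contra! hcon
    refine hWb ⟨(S, x), ?_, hSx⟩
    have hWV := hW.trans (Finset.sdiff_subset : X ⊆ V)
    have hS : S ∈ lk G V {x} (k - 1) := (mem_lk_singleton hk hG).2
      ⟨(Finset.subset_insert _ _).trans (hSx.trans hWV), hx, hSG⟩
    rw [unfriendly, Finset.mem_filter, Finset.mem_product, Finset.mem_powersetCard]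
    exact ⟨⟨(mem_lk.1 hS).1, hWV (hSx (Finset.mem_insert_self _ _))⟩, hS, hcon⟩
  · refine le_trans (mul_le_mul_of_nonneg_right ?_ (by positivity)) (hWd D hD hDc)
    linarith

end Connect

section Connect

variable {α : Type} [DecidableEq α] {G : Finset (Finset α)} {k d : ℕ} {V : Finset α}

set_option maxHeartbeats 1000000 in
/-- Absorption: combining handlers, reservoirs and an almost spanning cycle. -/
theorem exists_spanning_path {β κ γ η : ℝ} {n₀ M M₁ q z a b : ℕ} (hk : 2 ≤ k)
    (hdk : d ≤ k - 1) (hβ : 0 ≤ β) (hκ : 0 < κ) (hγ : 0 < γ) (hBB : HamBB k d β n₀)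
    (hG : ∀ e ∈ G, e.card = k) (hη : 0 ≤ η) (hηκ : (k - d : ℕ) * η ≤ κ / 4)
    (hM₁ : 0 < M₁) (hM₁M : M₁ ≤ M) (hMq : M₁ + 2 = (k - 1) * q) (hq : 3 ≤ q) (hMn : n₀ ≤ M₁ + 2)
    (hMM : M + 2 * M₁ + 1 = (k - 1) * b) (hMH : (k - 1) * (2 * (2 * M₁ + k) + 1) ≤ M)
    (hz : M ^ k * (M₁ + k + 2) + M + 2 * M₁ + k + 5 ≤ z)
    (hzV : M₁ + z + n₀ + 2 * k < V.card) (hzκ : (z : ℝ) ≤ κ / 2 * V.card)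
    (hsmall : (V.card : ℝ) ^ d * (V.card + 1) ^ (k - d + 1) * Real.exp (-(η ^ 2 * M₁ / 2)) < 1 / 2)
    (hM₁β : β * ((M₁ : ℝ) + 2) ^ (k - d) ≤ (β + κ / 4) * (M₁ : ℝ) ^ (k - d))
    (hMβ : β * ((M : ℝ) + (2 * M₁ + k)) ^ (k - d) ≤ (β + κ / 4) * (M : ℝ) ^ (k - d))
    (hzM : 2 ^ (k + 2) * (z : ℝ) * (M : ℝ) ^ k ≤ γ ^ 2 * V.card)
    (hdeg : ∀ D ⊆ V, D.card = d → (β + κ) * (V.card : ℝ) ^ (k - d) ≤ (lk G V D (k - d)).card)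
    (hdeg1 : ∀ x ∈ V, γ * (V.card : ℝ) ^ (k - 1) ≤ (lk G V {x} (k - 1)).card)
    (hN : V.card = (k - 1) * a + 1) {u v : α} (hu : u ∈ V) (hv : v ∈ V) (huv : u ≠ v) :
    LPath G u v V := by
  have hres := fun Z hZ => exists_reservoir (V := V) hk hdk hβ hκ hBB hG hM₁ hη hηκ (by omega) hMq
    hq hMn hzκ hsmall hM₁β hdeg Z hZ
  obtain ⟨W, hWV, hWc, hWf, hWd⟩ := exists_absorbing_pool (z := z) (M := M) (Z := {u, v}) hk hdk hβ
    hκ hγ hG (by omega) hη hηκ (by omega) (le_trans (by exact_mod_cast (by omega : 2 ≤ z)) hzκ)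
    (lt_of_le_of_lt (by gcongr) hsmall) hzM hdeg hdeg1
    ((Finset.card_insert_le _ _).trans (by simp))
  set P := ((W.powersetCard (k - 1)) ×ˢ W).filter fun p => p.2 ∉ p.1 ∧ insert p.2 p.1 ∈ G with hP
  have hPc : P.card ≤ M ^ k := by
    refine (Finset.card_filter_le _ _).trans ?_
    rw [Finset.card_product, Finset.card_powersetCard, hWc]
    calc _ ≤ M ^ (k - 1) * M := Nat.mul_le_mul_right _ (Nat.choose_le_pow _ _)
      _ = M ^ k := by rw [← pow_succ]; congr 1; omega
  have hPM := Nat.mul_le_mul_right (M₁ + k + 2) hPc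
  have hvW : v ∉ W := fun h => by simpa using (Finset.mem_sdiff.1 (hWV h)).2
  have huW : u ∉ W := fun h => by simpa using (Finset.mem_sdiff.1 (hWV h)).2
  have hWV' : W ⊆ V := hWV.trans Finset.sdiff_subset
  have hZ₀c : (insert v W).card = M + 1 := by rw [Finset.card_insert_of_notMem hvW, hWc]
  obtain ⟨y, Q, hQ, hQV, hQZ, hQc, hQh⟩ := exists_handler_path (z := z) hk hG hres P
    (fun p hp => by
      rw [hP, Finset.mem_filter, Finset.mem_product, Finset.mem_powersetCard] at hp
      refine ⟨hp.2.2, fun Z hZ => exists_comp_avoiding hk hG (hWf _ _ ?_ hp.2.1 hp.2.2) hZ⟩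
      exact Finset.insert_subset hp.1.2 hp.1.1.1)
    hu (Z₀ := insert v W) (by simp [huv, huW]) (by rw [hZ₀c]; omega)
  have hQv : v ∉ Q := fun h => Finset.disjoint_left.1 hQZ h (Finset.mem_insert_self _ _)
  have hQW : Disjoint Q W := hQZ.mono_right (Finset.subset_insert _ _)
  have hZ₁c : (Q ∪ insert v W).card = Q.card + (M + 1) := by
    rw [Finset.card_union_of_disjoint hQZ, hZ₀c]
  obtain ⟨R₁, hR₁V, hR₁c, hR₁⟩ := hres (Q ∪ insert v W) (by omega)
  have hR₁d : Disjoint (Q ∪ insert v W) R₁ := (Finset.subset_sdiff.1 hR₁V).2.symm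
  have hZ₂c : (Q ∪ insert v W ∪ R₁).card = Q.card + (M + 1) + M₁ := by
    rw [Finset.card_union_of_disjoint hR₁d, hZ₁c, hR₁c]
  obtain ⟨R₂, hR₂V, hR₂c, hR₂⟩ := hres (Q ∪ insert v W ∪ R₁) (by omega)
  have hR₂d : Disjoint (Q ∪ insert v W ∪ R₁) R₂ := (Finset.subset_sdiff.1 hR₂V).2.symm
  have hZ₃c : (Q ∪ insert v W ∪ R₁ ∪ R₂).card = Q.card + (M + 1) + M₁ + M₁ := by
    rw [Finset.card_union_of_disjoint hR₂d, hZ₂c, hR₂c]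
  have hR₁V' := hR₁V.trans Finset.sdiff_subset
  have hR₂V' := hR₂V.trans Finset.sdiff_subset
  set Z₃ := Q ∪ insert v W ∪ R₁ ∪ R₂ with hZ₃
  have hZ₃V : Z₃ ⊆ V := by
    rw [hZ₃]
    exact Finset.union_subset (Finset.union_subset (Finset.union_subset hQV
      (Finset.insert_subset hv hWV')) hR₁V') hR₂V'
  obtain ⟨m, hm⟩ := hQ.card (k := k) (by omega) hG
  have hV'c := Finset.card_sdiff_add_card_eq_card hZ₃V
  have hV'd : (k - 1) ∣ (V \ Z₃).card := by
    refine (Nat.dvd_add_right (Dvd.intro (m + b) rfl : (k - 1) ∣ (k - 1) * (m + b))).1 ⟨a, ?_⟩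
    rw [mul_add, ← hMM]; omega
  obtain ⟨q₀, hq₀⟩ := hV'd
  obtain ⟨F, hF⟩ := hBB α G (V \ Z₃) hG (by omega) ⟨q₀, hq₀⟩ fun D hD hDc => by
    refine le_trans (mul_le_mul_of_nonneg_right ?_ (by positivity))
      (le_card_lk_sdiff (Z := Z₃) hβ hκ (by omega) ?_ hdeg D (hD.trans Finset.sdiff_subset) hDc)
    · linarith
    · exact le_trans (by exact_mod_cast (by omega)) hzκ
  have hq₀2 : 2 ≤ q₀ := by
    by_contra! h
    have := Nat.mul_le_mul_left (k - 1) (show q₀ ≤ 1 by omega)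
    omega
  obtain ⟨x₀, a₀, S₀, U₀, hU₀, hx₀, -, hxS₀, ha₀, hUS₀, hUS₀'⟩ := hF.break_at hk hq₀ hq₀2 0
  have hmem : ∀ w, w ∈ V → (w ∈ U₀ ∨ w ∈ S₀ ↔ w ∉ Q ∧ w ≠ v ∧ w ∉ W ∧ w ∉ R₁ ∧ w ∉ R₂) :=
    fun w hw => by
      rw [← Finset.mem_union, hUS₀, hZ₃]
      simp only [Finset.mem_sdiff, Finset.mem_union, Finset.mem_insert]
      tauto
  have hUS₀V : ∀ w, w ∈ U₀ ∨ w ∈ S₀ → w ∈ V := fun w hw => by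
    rw [← Finset.mem_union, hUS₀] at hw
    exact (Finset.mem_sdiff.1 hw).1
  have hUSm : ∀ w, w ∈ U₀ → w ∈ S₀ → w = a₀ := fun w h1 h2 => by
    simpa [h1, h2] using Finset.ext_iff.1 hUS₀' w
  have hxU := hU₀.start_mem
  have haU := hU₀.end_mem
  have hxm := (hmem x₀ (hUS₀V _ (Or.inl hxU))).1 (Or.inl hxU)
  have ham := (hmem a₀ (hUS₀V _ (Or.inl haU))).1 (Or.inl haU)
  have hyQ := hQ.end_mem
  have hyR₁ : y ∉ R₁ := fun h => Finset.disjoint_left.1 hR₁d (Finset.mem_union_left _ hyQ) h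
  have hvR₂ : v ∉ R₂ := fun h => Finset.disjoint_left.1 hR₂d (by simp) h
  obtain ⟨A₁, hA₁, hA₁p⟩ := hR₁ y (Finset.mem_sdiff.2 ⟨hQV hyQ, hyR₁⟩) x₀
    (Finset.mem_sdiff.2 ⟨hUS₀V _ (Or.inl hxU), hxm.2.2.2.1⟩) (fun h => hxm.1 (h ▸ hyQ))
  obtain ⟨A₂, hA₂, hA₂p⟩ := hR₂ a₀
    (Finset.mem_sdiff.2 ⟨hUS₀V _ (Or.inl haU), ham.2.2.2.2⟩) v
    (Finset.mem_sdiff.2 ⟨hv, hvR₂⟩) ham.2.1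
  have hR₁d' : ∀ w, w ∈ R₁ → w ∉ Q ∧ w ≠ v ∧ w ∉ W := fun w hw => by
    have := Finset.disjoint_right.1 hR₁d hw
    simp at this
    tauto
  have hR₂d' : ∀ w, w ∈ R₂ → w ∉ Q ∧ w ≠ v ∧ w ∉ W ∧ w ∉ R₁ := fun w hw => by
    have := Finset.disjoint_right.1 hR₂d hw
    simp at this
    tauto
  have hA₁m : ∀ w, w ∈ A₁ → w = y ∨ w = x₀ ∨ w ∈ R₁ := fun w hw => by simpa using hA₁ hw
  have hA₂m : ∀ w, w ∈ A₂ → w = a₀ ∨ w = v ∨ w ∈ R₂ := fun w hw => by simpa using hA₂ hw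
  have hyA := hA₁p.start_mem
  have hxA := hA₁p.end_mem
  have haA := hA₂p.start_mem
  have hvA := hA₂p.end_mem
  have hQW' : ∀ w, w ∈ Q → w ∉ W := fun w h => Finset.disjoint_left.1 hQW h
  have hax : x₀ ≠ a₀ := fun h => hx₀ (h ▸ ha₀)
  have hB₁ : LPath G y a₀ (A₁ ∪ U₀) := hA₁p.append hU₀ (by
    ext w
    have h1 := hA₁m w
    have h2 := hR₁d' w
    have h3 := fun h => (hmem w (hUS₀V w (Or.inl h))).1 (Or.inl h)
    simp only [Finset.mem_inter, Finset.mem_singleton]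
    grind)
  have hB : LPath G y v (A₁ ∪ U₀ ∪ A₂) := hB₁.append hA₂p (by
    ext w
    have h1 := hA₁m w
    have h1' := hA₂m w
    have h2 := hR₁d' w
    have h2' := hR₂d' w
    have h3 := fun h => (hmem w (hUS₀V w (Or.inl h))).1 (Or.inl h)
    simp only [Finset.mem_inter, Finset.mem_union, Finset.mem_singleton]
    grind)
  set B := A₁ ∪ U₀ ∪ A₂ with hBdef
  have hBm : ∀ w, w ∈ B ↔ w ∈ A₁ ∨ w ∈ U₀ ∨ w ∈ A₂ := fun w => by
    simp [hBdef]
  set H := ((R₁ ∪ R₂) \ (A₁ ∪ A₂)) ∪ S₀.erase a₀ with hH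
  have hHm : ∀ w, w ∈ H ↔ ((w ∈ R₁ ∨ w ∈ R₂) ∧ w ∉ A₁ ∧ w ∉ A₂) ∨ (w ≠ a₀ ∧ w ∈ S₀) := fun w => by
    simp [hH]
  have hQB : Q ∩ B = {y} := by
    ext w
    have h1 := hA₁m w
    have h1' := hA₂m w
    have h2 := hR₁d' w
    have h2' := hR₂d' w
    have h3 := fun h => (hmem w (hUS₀V w (Or.inl h))).1 (Or.inl h)
    simp only [Finset.mem_inter, Finset.mem_singleton, hBm]
    grind
  have hWB : ∀ w, w ∈ B → w ∉ W ∧ w ∉ H := fun w => by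
    have h1 := hA₁m w
    have h1' := hA₂m w
    have h2 := hR₁d' w
    have h2' := hR₂d' w
    have h3 := fun h => (hmem w (hUS₀V w (Or.inl h))).1 (Or.inl h)
    have h4 := hUSm w
    have h5 := fun h => (hmem w (hUS₀V w (Or.inr h))).1 (Or.inr h)
    have h6 := hQW' w
    rw [hBm, hHm]
    grind
  have hWQ : ∀ w, w ∈ Q → w ∉ H := fun w => by
    have h2 := hR₁d' w
    have h2' := hR₂d' w
    have h5 := fun h => (hmem w (hUS₀V w (Or.inr h))).1 (Or.inr h)
    rw [hHm]
    grind
  have hBV : B ⊆ V := fun w hw => by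
    rcases (hBm w).1 hw with h | h | h
    · rcases hA₁m w h with rfl | rfl | h
      exacts [hQV hyQ, hUS₀V _ (Or.inl hxU), hR₁V' h]
    · exact hUS₀V _ (Or.inl h)
    · rcases hA₂m w h with rfl | rfl | h
      exacts [hUS₀V _ (Or.inl haU), hv, hR₂V' h]
  have hHV : H ⊆ V := fun w hw => by
    rcases (hHm w).1 hw with ⟨h | h, -⟩ | ⟨-, h⟩
    exacts [hR₁V' h, hR₂V' h, hUS₀V _ (Or.inr h)]
  have hcover : Q ∪ B ∪ (W ∪ H) = V := by
    refine Finset.Subset.antisymm (Finset.union_subset (Finset.union_subset hQV hBV)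
      (Finset.union_subset hWV' hHV)) fun w hw => ?_
    have h1 := hmem w hw
    simp only [Finset.mem_union, hBm, hHm]
    grind
  have hdisj : Disjoint (Q ∪ B) (W ∪ H) := Finset.disjoint_left.2 fun w hw hw' => by
    have h1 := hQW' w
    have h2 := hWQ w
    have h3 := hWB w
    rw [Finset.mem_union] at hw hw'
    tauto
  obtain ⟨m', hm'⟩ := (hQ.append hB hQB).card (k := k) (by omega) hG
  have hW'c : (Q ∪ B).card + (W ∪ H).card = V.card := by
    rw [← Finset.card_union_of_disjoint hdisj, hcover]
  have hW'd : (k - 1) ∣ (W ∪ H).card := by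
    refine (Nat.dvd_add_right (Dvd.intro m' rfl : (k - 1) ∣ (k - 1) * m')).1 ⟨a, ?_⟩
    omega
  obtain ⟨q', hq'⟩ := hW'd
  have hHc : H.card ≤ 2 * M₁ + k := by
    have h1 : S₀.card = k - 1 := by
      have := hG _ hxS₀
      rw [Finset.card_insert_of_notMem hx₀] at this
      omega
    have h2 : H.card ≤ _ + _ := Finset.card_union_le ((R₁ ∪ R₂) \ (A₁ ∪ A₂)) (S₀.erase a₀)
    have h3 := Finset.card_le_card (Finset.sdiff_subset : (R₁ ∪ R₂) \ (A₁ ∪ A₂) ⊆ R₁ ∪ R₂)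
    have h4 := Finset.card_union_le R₁ R₂
    have h5 := Finset.card_erase_le (s := S₀) (a := a₀)
    omega
  have hWle : M ≤ (W ∪ H).card := by
    rw [← hWc]; exact Finset.card_le_card Finset.subset_union_left
  have hq'2 : 2 * (2 * M₁ + k) + 1 ≤ q' := by
    refine Nat.le_of_mul_le_mul_left (c := k - 1) ?_ (by omega)
    rw [← hq']; omega
  have hMM₁ : 2 * (2 * M₁ + k) + 1 ≤ M := (Nat.le_mul_of_pos_left _ (by omega)).trans hMH
  obtain ⟨F', hF'⟩ := hBB α G (W ∪ H) hG (by omega) ⟨q', hq'⟩ fun D hD hDc => by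
    have h1 := hWd D (hD.trans (Finset.union_subset hWV' hHV)) hDc
    have h2 : ((lk G W D (k - d)).card : ℝ) ≤ (lk G (W ∪ H) D (k - d)).card := by
      exact_mod_cast Finset.card_le_card (lk_mono Finset.subset_union_left)
    have h3 : ((W ∪ H).card : ℝ) ≤ (M : ℝ) + (2 * M₁ + k) := by
      have := Finset.card_union_le W H
      exact_mod_cast (by omega : (W ∪ H).card ≤ M + (2 * M₁ + k))
    calc β * ((W ∪ H).card : ℝ) ^ (k - d) ≤ β * ((M : ℝ) + (2 * M₁ + k)) ^ (k - d) := by gcongr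
      _ ≤ _ := hMβ.trans (h1.trans h2)
  obtain ⟨t, ht⟩ := hF'.exists_disjoint_blk hk hq' H (by omega)
  obtain ⟨x, a', S, U, hU, hxS, hb, hbG, haS, hUS, hUS'⟩ := hF'.break_at hk hq' (by omega) t
  have hSW : insert x S ⊆ W := fun w hw => by
    have h1 : w ∈ W ∪ H := by
      rw [← hUS]
      rcases Finset.mem_insert.1 hw with rfl | h
      exacts [Finset.mem_union_left _ hU.start_mem, Finset.mem_union_right _ h]
    exact (Finset.mem_union.1 h1).resolve_right (Finset.disjoint_left.1 ht (hb ▸ hw))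
  have hSc : S.card = k - 1 := by
    have := hG _ hbG
    rw [Finset.card_insert_of_notMem hxS] at this
    omega
  have hand := hQh (S, x) (by
    rw [hP, Finset.mem_filter, Finset.mem_product, Finset.mem_powersetCard]
    exact ⟨⟨⟨(Finset.subset_insert _ _).trans hSW, hSc⟩, hSW (Finset.mem_insert_self _ _)⟩, hxS, hbG⟩)
  have hsp := hand.splice hU hxS haS hUS' (by
    rw [hUS]; exact hdisj.mono_left Finset.subset_union_left)
  rw [hUS] at hsp
  have hfin := hsp.append hB (by
    rw [Finset.union_inter_distrib_right, hQB, Finset.disjoint_iff_inter_eq_empty.1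
      (hdisj.mono_left Finset.subset_union_right).symm, Finset.union_empty])
  rwa [Finset.union_right_comm, hcover] at hfin

end Connect

open Filter Topology

theorem eventually_const_mul_pow_le_two_pow (C : ℝ) (a : ℕ) :
    ∀ᶠ s : ℕ in atTop, C * (s : ℝ) ^ a ≤ 2 ^ s := by
  have h := tendsto_pow_const_div_const_pow_of_one_lt a (show (1 : ℝ) < 2 by norm_num)
  filter_upwards [h.eventually (gt_mem_nhds (show (0 : ℝ) < 1 / (|C| + 1) by positivity))] with s hs
  rw [div_lt_div_iff₀ (by positivity) (by positivity), one_mul] at hs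
  nlinarith [le_abs_self C, show (0 : ℝ) ≤ (s : ℝ) ^ a by positivity]

theorem exists_perturb_pow (β : ℝ) {κ : ℝ} (hβ : 0 ≤ β) (hκ : 0 < κ) (r : ℕ) :
    ∃ ε : ℝ, 0 < ε ∧ ∀ M c : ℝ, 0 ≤ M → 0 ≤ c → c ≤ ε * M →
      β * (M + c) ^ r ≤ (β + κ) * M ^ r := by
  have h : ContinuousAt (fun x : ℝ => β * (1 + x) ^ r) 0 := by fun_prop
  have h2 := (h.tendsto.eventually (gt_mem_nhds (show β * (1 + 0) ^ r < β + κ by simp; linarith)))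
  obtain ⟨ε, hε, h3⟩ := Metric.eventually_nhds_iff.1 h2
  refine ⟨ε / 2, by positivity, fun M c hM hc hcM => ?_⟩
  have h4 := h3 (y := ε / 2) (by rw [Real.dist_eq, sub_zero, abs_of_pos (by positivity)]; linarith)
  calc β * (M + c) ^ r ≤ β * ((1 + ε / 2) * M) ^ r := by gcongr; linarith
    _ = β * (1 + ε / 2) ^ r * M ^ r := by rw [mul_pow]; ring
    _ ≤ _ := by gcongr

theorem small_of_log {N s d r k M : ℕ} {η : ℝ} (hN : N + 1 ≤ 2 ^ (s + 1)) (hdr : d + (r + 1) = k + 1)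
    (h : ((s : ℝ) + 1) * (k + 1) + 1 ≤ η ^ 2 * M / 2) :
    (N : ℝ) ^ d * (N + 1) ^ (r + 1) * Real.exp (-(η ^ 2 * M / 2)) < 1 / 2 := by
  have hN1 : (N : ℝ) + 1 ≤ 2 ^ (s + 1) := by exact_mod_cast hN
  have h1 : (2 : ℝ) ≤ Real.exp 1 := by linarith [Real.add_one_le_exp 1]
  have h2 : (N : ℝ) ^ d * (N + 1) ^ (r + 1) ≤ Real.exp (((s : ℝ) + 1) * (k + 1)) := by
    calc (N : ℝ) ^ d * (N + 1) ^ (r + 1) ≤ (N + 1 : ℝ) ^ d * (N + 1) ^ (r + 1) := by gcongr; linarith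
      _ = (N + 1 : ℝ) ^ (k + 1) := by rw [← pow_add, hdr]
      _ ≤ ((Real.exp 1) ^ (s + 1)) ^ (k + 1) := by
          gcongr; exact hN1.trans (pow_le_pow_left₀ (by norm_num) h1 _)
      _ = _ := by
          rw [← pow_mul, ← Real.exp_nat_mul]; congr 1; push_cast; ring
  calc _ ≤ Real.exp (((s : ℝ) + 1) * (k + 1)) * Real.exp (-(η ^ 2 * M / 2)) := by gcongr
    _ = Real.exp (((s : ℝ) + 1) * (k + 1) + -(η ^ 2 * M / 2)) := by rw [Real.exp_add]
    _ ≤ Real.exp (-1) := Real.exp_le_exp.2 (by linarith)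
    _ < 1 / 2 := by
      rw [Real.exp_neg, ← one_div]
      exact one_div_lt_one_div_of_lt (by norm_num) (lt_trans (by norm_num) Real.exp_one_gt_d9)

set_option maxHeartbeats 400000 in
/-- Hamilton connectedness from Hamiltonicity. -/
theorem HamBB.connected {k d n₀ : ℕ} {β κ : ℝ} (hk : 2 ≤ k) (hd1 : 1 ≤ d) (hdk : d ≤ k - 1)
    (hβ : 0 ≤ β) (hκ : 0 < κ) (hBB : HamBB k d β n₀) :
    ∃ N₀ : ℕ, ∀ (α : Type) [DecidableEq α] (G : Finset (Finset α)) (V : Finset α) (a : ℕ),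
      (∀ e ∈ G, e.card = k) → N₀ ≤ V.card → V.card = (k - 1) * a + 1 →
      (∀ D ⊆ V, D.card = d → (β + κ) * (V.card : ℝ) ^ (k - d) ≤ (lk G V D (k - d)).card) →
      ∀ u ∈ V, ∀ v ∈ V, u ≠ v → LPath G u v V := by
  obtain ⟨γ, hγ, hγ'⟩ := exists_min_vertex_degree hd1 hdk hk hκ
  obtain ⟨ε, hε, hε'⟩ := exists_perturb_pow β hβ (show 0 < κ / 4 by positivity) (k - d)
  have hr : (0 : ℝ) < (k - d : ℕ) := by exact_mod_cast (by omega : 0 < k - d)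
  set η := κ / (4 * (k - d : ℕ)) with hη
  have hη0 : 0 < η := by positivity
  have hev : ∀ᶠ s : ℕ in atTop, (4 * k + 10 + n₀ ≤ s ∧ 3 / ε ≤ (s : ℝ) ∧
      (4 * (k + 2) + 4 * η ^ 2) / η ^ 2 ≤ (s : ℝ)) ∧ 5 * (s : ℝ) ^ (4 * k + 8) ≤ 2 ^ s ∧
      2 / κ * (s : ℝ) ^ (4 * k + 8) ≤ 2 ^ s ∧
      2 ^ (k + 2) / γ ^ 2 * (s : ℝ) ^ (8 * k + 8) ≤ 2 ^ s := by
    have hge : ∀ C : ℝ, ∀ᶠ s : ℕ in atTop, C ≤ s := fun C =>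
      tendsto_natCast_atTop_atTop.eventually (eventually_ge_atTop C)
    filter_upwards [eventually_ge_atTop (4 * k + 10 + n₀), hge (3 / ε),
      hge ((4 * (k + 2) + 4 * η ^ 2) / η ^ 2), eventually_const_mul_pow_le_two_pow 5 (4 * k + 8),
      eventually_const_mul_pow_le_two_pow (2 / κ) (4 * k + 8),
      eventually_const_mul_pow_le_two_pow (2 ^ (k + 2) / γ ^ 2) (8 * k + 8)] with s h1 h2 h3 h4 h5 h6
    exact ⟨⟨h1, h2, h3⟩, h4, h5, h6⟩
  obtain ⟨s₀, hs₀⟩ := eventually_atTop.1 hev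
  refine ⟨2 ^ s₀, fun α _ G V a hG hVc ha hdeg u hu v hv huv => ?_⟩
  set N := V.card with hN
  set s := Nat.log 2 N with hs
  have hN0 : N ≠ 0 := (Finset.card_pos.2 ⟨u, hu⟩).ne'
  have hs0 : s₀ ≤ s := (Nat.le_log_iff_pow_le (by norm_num) hN0).2 hVc
  have hN1 : 2 ^ s ≤ N := Nat.pow_log_le_self 2 hN0
  have hN2 : N + 1 ≤ 2 ^ (s + 1) := Nat.lt_pow_succ_log_self (by norm_num) N
  have hN1' : (2 : ℝ) ^ s ≤ N := by exact_mod_cast hN1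
  obtain ⟨⟨h1, h2, h3⟩, h4, h5, h6⟩ := hs₀ s hs0
  have h4' : 5 * s ^ (4 * k + 8) ≤ 2 ^ s := by exact_mod_cast h4
  obtain ⟨K, rfl⟩ : ∃ K, k = K + 1 := ⟨k - 1, by omega⟩
  simp only [Nat.add_sub_cancel] at ha ⊢
  have hs2 : 4 * K ≤ s := by omega
  have hsz : s ≤ s ^ (4 * (K + 1) + 8) := Nat.le_self_pow (by omega) _
  have hKs : 1 ≤ K := by omega
  have hss : s ^ 2 = s * s := sq s
  have hsss : s ^ 3 = s * s ^ 2 := by ring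
  have hs4 : s ^ 4 = s * s ^ 3 := by ring
  have hs1 : s ≤ s ^ 2 := Nat.le_self_pow (by omega) _
  have e1 : s ^ 2 ≤ K * s ^ 2 := Nat.le_mul_of_pos_left _ (by omega)
  have e2 : 4 * (K * s ^ 2) + 2 * s ^ 2 ≤ s ^ 3 := by
    rw [hsss]; nlinarith
  have e3 : s ^ 3 ≤ K * s ^ 3 := Nat.le_mul_of_pos_left _ (by omega)
  have e4 : K * s ^ 3 + 3 * s ^ 3 ≤ s ^ 4 := by rw [hs4]; nlinarith
  have hM₁2 : 2 ≤ K * s ^ 2 := by omega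
  have hMle : K * s ^ 3 + 3 ≤ s ^ 4 := by omega
  have hMk : (K * s ^ 3 + 3) ^ (K + 1) ≤ s ^ (4 * (K + 1)) := by
    rw [pow_mul]; exact Nat.pow_le_pow_left hMle _
  have hM₁c : ((K * s ^ 2 - 2 : ℕ) : ℝ) = K * (s : ℝ) ^ 2 - 2 := by
    rw [Nat.cast_sub hM₁2]; push_cast; ring
  have hs1' : (1 : ℝ) ≤ s := by exact_mod_cast (by omega : 1 ≤ s)
  have hz : (K * s ^ 3 + 3) ^ (K + 1) * ((K * s ^ 2 - 2) + (K + 1) + 2) + (K * s ^ 3 + 3) +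
      2 * (K * s ^ 2 - 2) + (K + 1) + 5 ≤ s ^ (4 * (K + 1) + 8) := by
    have hp : 1 ≤ s ^ (4 * (K + 1)) := Nat.one_le_pow _ _ (by omega)
    have h10 := Nat.mul_le_mul hMk (show (K * s ^ 2 - 2) + (K + 1) + 2 ≤ s ^ 4 by omega)
    have h11 : s ^ 4 * 2 ≤ s ^ 8 := by
      rw [show s ^ 8 = s ^ 4 * s ^ 4 by ring]
      exact Nat.mul_le_mul_left _ (by omega)
    have h12 := Nat.mul_le_mul_left (s ^ (4 * (K + 1))) h11
    rw [pow_add s]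
    have h13 := Nat.le_mul_of_pos_left (s ^ 4) hp
    rw [← mul_assoc] at h12
    generalize (K * s ^ 3 + 3) ^ (K + 1) = A at h10 ⊢
    omega
  have hη4 : ((K + 1 - d : ℕ) : ℝ) * η = κ / 4 := by rw [hη]; field_simp
  refine exists_spanning_path (n₀ := n₀) (M := K * s ^ 3 + 3) (M₁ := K * s ^ 2 - 2) (q := s ^ 2)
    (z := s ^ (4 * (K + 1) + 8)) (a := a) (b := s ^ 3 + 2 * s ^ 2) hk hdk hβ hκ hγ hBB hG hη0.le
    hη4.le (by omega) (by omega) (by simp; omega) (by omega) (by omega) ?_ ?_ hz (by omega) ?_ ?_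
    ?_ ?_ ?_ hdeg ?_ ha hu hv huv
  · simp only [Nat.add_sub_cancel, mul_add]; rw [mul_left_comm]; omega
  · simp only [Nat.add_sub_cancel]
    refine le_trans (Nat.mul_le_mul_left K (?_ : _ ≤ s ^ 3)) (by omega)
    omega
  · push_cast
    rw [div_mul_eq_mul_div, div_le_iff₀ hκ] at h5
    nlinarith
  · refine small_of_log (k := K + 1) hN2 (by omega) ?_
    rw [hM₁c]
    rw [div_le_iff₀ (by positivity)] at h3
    have : (s : ℝ) ^ 2 ≤ K * (s : ℝ) ^ 2 := by exact_mod_cast e1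
    have h7 : (1 : ℝ) ≤ K := by exact_mod_cast hKs
    have h8 : η ^ 2 * (s : ℝ) ^ 2 ≤ η ^ 2 * (K * (s : ℝ) ^ 2) := by gcongr
    have h9 := mul_le_mul_of_nonneg_right h3 (show (0 : ℝ) ≤ s by positivity)
    push_cast at h9 ⊢
    nlinarith [sq_nonneg η, mul_nonneg (sq_nonneg η) (show (0 : ℝ) ≤ s - 1 by linarith)]
  · refine hε' _ 2 (by positivity) (by norm_num) ?_
    rw [hM₁c]
    rw [div_le_iff₀ hε] at h2
    have h7 : (s : ℝ) ≤ K * (s : ℝ) ^ 2 - 2 := by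
      rw [← hM₁c]; exact_mod_cast (by
        have : 2 * s ≤ s ^ 2 := by rw [hss]; exact Nat.mul_le_mul_right _ (by omega)
        omega : s ≤ K * s ^ 2 - 2)
    nlinarith
  · refine hε' _ _ (by positivity) (by positivity) ?_
    rw [div_le_iff₀ hε] at h2
    have h7 : 2 * ((K * s ^ 2 - 2 : ℕ) : ℝ) + ((K + 1 : ℕ) : ℝ) ≤ 3 * (K * (s : ℝ) ^ 2) := by
      exact_mod_cast (by omega : 2 * (K * s ^ 2 - 2) + (K + 1) ≤ 3 * (K * s ^ 2))
    refine h7.trans ?_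
    have h8 := mul_le_mul_of_nonneg_right h2 (show (0 : ℝ) ≤ K * (s : ℝ) ^ 2 by positivity)
    push_cast
    nlinarith
  · rw [div_mul_eq_mul_div, div_le_iff₀ (by positivity)] at h6
    have h7 : ((K * s ^ 3 + 3 : ℕ) : ℝ) ^ (K + 1) ≤ (s : ℝ) ^ (4 * (K + 1)) := by exact_mod_cast hMk
    calc _ ≤ 2 ^ (K + 1 + 2) * ((s ^ (4 * (K + 1) + 8) : ℕ) : ℝ) * (s : ℝ) ^ (4 * (K + 1)) := by
          gcongr
      _ = 2 ^ (K + 1 + 2) * (s : ℝ) ^ (8 * (K + 1) + 8) := by push_cast; ring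
      _ ≤ _ := h6
      _ ≤ γ ^ 2 * N := by rw [mul_comm]; gcongr
  · refine hγ' α G V hG (by omega) fun D hD hDc => le_trans ?_ (hdeg D hD hDc)
    exact mul_le_mul_of_nonneg_right (by linarith) (by positivity)

theorem one_mem_threshold_set (k d : ℕ) (hdk : d ≤ k - 1) : (1 : ℝ) ∈
    {δ : ℝ | 0 ≤ δ ∧ δ ≤ 1 ∧ ∀ μ : ℝ, 0 < μ → ∃ n₀ : ℕ, ∀ n, n₀ ≤ n → (k - 1) ∣ n →
    ∀ G : Finset (Finset (Fin n)), IsHG k n G →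
      MinDegGE G d ((δ + μ) * (((n - d).choose (k - d) : ℕ) : ℝ)) → HasHamLCycle k 1 n G} := by
  refine ⟨zero_le_one, le_rfl, fun μ hμ => ⟨k, fun n hn _ G hG hdeg => ?_⟩⟩
  exfalso
  obtain ⟨S, -, hS⟩ := Finset.exists_subset_card_eq (s := (Finset.univ : Finset (Fin n))) (n := d)
    (by simp; omega)
  have h1 := hdeg S hS
  have h2 : (G.filter fun e => S ⊆ e).card ≤ (n - d).choose (k - d) := by
    have : ((Finset.univ \ S).powersetCard (k - d)).card = (n - d).choose (k - d) := by
      rw [Finset.card_powersetCard, Finset.card_sdiff_of_subset (Finset.subset_univ _), hS]; simp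
    rw [← this]
    refine Finset.card_le_card_of_injOn (fun e => e \ S) (fun e he => ?_) fun e he e' he' h => ?_
    · rw [Finset.mem_coe, Finset.mem_filter] at he
      rw [Finset.mem_coe, Finset.mem_powersetCard, Finset.card_sdiff_of_subset he.2, hG e he.1, hS]
      exact ⟨Finset.sdiff_subset_sdiff (Finset.subset_univ _) subset_rfl, rfl⟩
    · rw [Finset.mem_coe, Finset.mem_filter] at he he'
      have h' : e \ S = e' \ S := h
      rw [← Finset.sdiff_union_of_subset he.2, h', Finset.sdiff_union_of_subset he'.2]
  have h3 : ((G.filter fun e => S ⊆ e).card : ℝ) ≤ (n - d).choose (k - d) := by exact_mod_cast h2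
  have h4 : (0 : ℝ) < (n - d).choose (k - d) := by exact_mod_cast Nat.choose_pos (by omega)
  nlinarith

theorem exists_isHC_of_hasHamLCycle {α : Type} [DecidableEq α] {k d : ℕ} {G : Finset (Finset α)}
    {V : Finset α} {m : ℝ} (hG : ∀ e ∈ G, e.card = k)
    (h : ∀ G' : Finset (Finset (Fin V.card)), IsHG k V.card G' → MinDegGE G' d m →
      HasHamLCycle k 1 V.card G')
    (hdeg : ∀ D ⊆ V, D.card = d → m ≤ (lk G V D (k - d)).card) : ∃ F, IsHC G k V F := by
  let emb : Fin V.card ↪ α := V.equivFin.symm.toEmbedding.trans (Function.Embedding.subtype _)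
  have hembV : ∀ i, emb i ∈ V := fun i => (V.equivFin.symm i).2
  have hsurj : ∀ x ∈ V, ∃ i, emb i = x := fun x hx => ⟨V.equivFin ⟨x, hx⟩, by simp [emb]⟩
  set G' : Finset (Finset (Fin V.card)) := Finset.univ.filter fun s => s.map emb ∈ G with hG'
  have hmem : ∀ s, s ∈ G' ↔ s.map emb ∈ G := fun s => by simp [hG']
  obtain ⟨f, hper, hinj, hsur, hblk⟩ := h G'
    (fun e he => by rw [← hG _ ((hmem e).1 he), Finset.card_map]) fun S hS => by
      refine (hdeg (S.map emb) (fun x hx => ?_) (by rw [Finset.card_map, hS])).trans ?_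
      · obtain ⟨i, -, rfl⟩ := Finset.mem_map.1 hx
        exact hembV i
      have hsub : lk G V (S.map emb) (k - d) ⊆
          (G'.filter fun e => S ⊆ e).image fun e => e.map emb \ S.map emb := fun F hF => by
        rw [mem_lk] at hF
        obtain ⟨⟨hFV, -⟩, hd, hFG⟩ := hF
        rw [Finset.mem_image]
        have hmap : (Finset.univ.filter fun i => emb i ∈ F ∪ S.map emb).map emb =
            F ∪ S.map emb := by
          ext x
          simp only [Finset.mem_map, Finset.mem_filter, Finset.mem_univ, true_and]
          constructor
          · rintro ⟨i, hi, rfl⟩; exact hi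
          · intro hx
            have hxV : x ∈ V := by
              rcases Finset.mem_union.1 hx with hx | hx
              · exact hFV hx
              · obtain ⟨i, -, rfl⟩ := Finset.mem_map.1 hx
                exact hembV i
            obtain ⟨i, rfl⟩ := hsurj x hxV
            exact ⟨i, hx, rfl⟩
        refine ⟨Finset.univ.filter fun i => emb i ∈ F ∪ S.map emb, ?_, ?_⟩
        · rw [Finset.mem_filter, hmem, hmap]
          exact ⟨hFG, fun i hi => by simp [hi]⟩
        · rw [hmap, Finset.union_sdiff_cancel_right hd]
      exact_mod_cast (Finset.card_le_card hsub).trans Finset.card_image_le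
  refine ⟨fun i => emb (f i), fun i => by simp only [hper], fun i hi j hj hij =>
    hinj hi hj (emb.injective hij), ?_, fun t => ?_⟩
  · ext x
    rw [Finset.mem_image]
    constructor
    · rintro ⟨i, -, rfl⟩; exact hembV _
    · intro hx
      obtain ⟨j, rfl⟩ := hsurj x hx
      obtain ⟨i, hi, rfl⟩ := hsur j
      exact ⟨i, Finset.mem_range.2 hi, rfl⟩
  · have := (hmem _).1 (hblk t)
    convert this using 1
    ext x
    simp only [mem_blk, Finset.mem_map, Finset.mem_image, Finset.mem_univ, true_and]
    constructor
    · rintro ⟨j, hj, rfl⟩; exact ⟨_, ⟨⟨j, hj⟩, rfl⟩, rfl⟩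
    · rintro ⟨_, ⟨j, rfl⟩, rfl⟩; exact ⟨j, j.2, rfl⟩

theorem card_filter_superset_le {n k d : ℕ} {G : Finset (Finset (Fin n))} (hG : IsHG k n G)
    {D : Finset (Fin n)} (hD : D.card = d) :
    (G.filter fun e => D ⊆ e).card ≤ (lk G Finset.univ D (k - d)).card := by
  refine Finset.card_le_card_of_injOn (fun e => e \ D) (fun e he => ?_) fun e he e' he' h => ?_
  · rw [Finset.mem_coe, Finset.mem_filter] at he
    rw [Finset.mem_coe, mem_lk, Finset.sdiff_union_of_subset he.2,
      Finset.card_sdiff_of_subset he.2, hG e he.1, hD]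
    exact ⟨⟨Finset.subset_univ _, rfl⟩, Finset.sdiff_disjoint, he.1⟩
  · rw [Finset.mem_coe, Finset.mem_filter] at he he'
    have h' : e \ D = e' \ D := h
    rw [← Finset.sdiff_union_of_subset he.2, h', Finset.sdiff_union_of_subset he'.2]

theorem exists_hamBB {k d : ℕ} (hdk : d ≤ k - 1) {μ : ℝ} (hμ : 0 < μ) :
    ∃ β κ : ℝ, 0 ≤ β ∧ 0 < κ ∧ (∃ n₀, HamBB k d β n₀) ∧ ∃ n₁ : ℕ, ∀ n, n₁ ≤ n →
      ∀ G : Finset (Finset (Fin n)), IsHG k n G →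
      MinDegGE G d ((looseHamThreshold k d + μ) * (((n - d).choose (k - d) : ℕ) : ℝ)) →
      ∀ D : Finset (Fin n), D.card = d →
        (β + 2 * κ) * (n : ℝ) ^ (k - d) ≤ (lk G Finset.univ D (k - d)).card := by
  have hne := one_mem_threshold_set k d hdk
  set T := {δ : ℝ | 0 ≤ δ ∧ δ ≤ 1 ∧ ∀ μ : ℝ, 0 < μ → ∃ n₀ : ℕ, ∀ n, n₀ ≤ n → (k - 1) ∣ n →
    ∀ G : Finset (Finset (Fin n)), IsHG k n G →
      MinDegGE G d ((δ + μ) * (((n - d).choose (k - d) : ℕ) : ℝ)) → HasHamLCycle k 1 n G} with hT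
  have hth : looseHamThreshold k d = sInf T := rfl
  set τ := looseHamThreshold k d with hτ
  have hτ0 : 0 ≤ τ := by rw [hth]; exact Real.sInf_nonneg fun x hx => hx.1
  set r := k - d with hr
  have hf : (0 : ℝ) < r.factorial := by exact_mod_cast r.factorial_pos
  obtain ⟨δ, hδT, hδ⟩ := exists_lt_of_csInf_lt ⟨1, hne⟩ (show sInf T < τ + μ / 4 by linarith)
  refine ⟨(τ + μ / 2) / r.factorial, μ / (8 * r.factorial), by positivity, by positivity, ?_, ?_⟩
  · obtain ⟨n₀, hn₀⟩ := hδT.2.2 (μ / 4) (by positivity)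
    refine ⟨n₀, fun α _ G V hG hV hdvd hdeg => ?_⟩
    refine exists_isHC_of_hasHamLCycle hG (fun G' hG' hdeg' => hn₀ V.card hV hdvd G' hG' hdeg')
      fun D hD hDc => le_trans ?_ (hdeg D hD hDc)
    have h1 : ((V.card - d).choose r : ℝ) ≤ (V.card : ℝ) ^ r / r.factorial := by
      refine (Nat.choose_le_pow_div r (V.card - d)).trans ?_
      gcongr
      exact Nat.sub_le _ _
    calc (δ + μ / 4) * ((V.card - d).choose r : ℝ)
        ≤ (τ + μ / 2) * ((V.card : ℝ) ^ r / r.factorial) := by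
          refine mul_le_mul ?_ h1 (by positivity) (by positivity); linarith
      _ = _ := by ring
  · obtain ⟨ε, hε, hε'⟩ := exists_perturb_pow ((τ + 3 * μ / 4) / r.factorial)
      (κ := μ / (4 * r.factorial)) (by positivity) (by positivity) r
    obtain ⟨m, hm⟩ := exists_nat_ge (k / ε)
    refine ⟨k + m, fun n hn G hG hdeg D hD => ?_⟩
    have h1 := (hdeg D hD).trans (by exact_mod_cast card_filter_superset_le hG hD :
      ((G.filter fun e => D ⊆ e).card : ℝ) ≤ (lk G Finset.univ D r).card)
    refine le_trans ?_ h1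
    have h2 := Nat.pow_sub_le_descFactorial (n - d) r
    rw [Nat.descFactorial_eq_factorial_mul_choose] at h2
    have h3 : ((n : ℝ) - k) ^ r ≤ r.factorial * ((n - d).choose r : ℕ) := by
      have h4 : (n - k) ^ r ≤ r.factorial * (n - d).choose r :=
        (Nat.pow_le_pow_left (by omega) r).trans h2
      rw [← Nat.cast_sub (by omega)]
      exact_mod_cast h4
    have hnk : (m : ℝ) ≤ n - k := by
      rw [le_sub_iff_add_le]; exact_mod_cast (by omega : m + k ≤ n)
    have h5 := hε' ((n : ℝ) - k) k (by linarith [show (0 : ℝ) ≤ m by positivity]) (by positivity) (by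
      rw [div_le_iff₀ hε] at hm
      nlinarith)
    rw [sub_add_cancel] at h5
    calc _ = (τ + 3 * μ / 4) / r.factorial * (n : ℝ) ^ r := by field_simp; ring
      _ ≤ _ := h5
      _ = (τ + μ) / r.factorial * ((n : ℝ) - k) ^ r := by field_simp; ring
      _ ≤ (τ + μ) / r.factorial * (r.factorial * ((n - d).choose r : ℕ)) := by gcongr
      _ = _ := by field_simp

theorem choose_mul_descFactorial_gap (a b x y : ℕ) :
    (x + y + 1).choose x * (y + 1) * (a + x + (b + y) + 1).descFactorial (a + b) =
      (a + x + (b + y) + 1).choose (a + x) * (b + y + 1) *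
        ((a + x).descFactorial a * (b + y).descFactorial b) := by
  have h1 := Nat.add_choose_mul_factorial_mul_factorial x (y + 1)
  have h2 := Nat.factorial_mul_descFactorial (show a + b ≤ a + x + (b + y) + 1 by omega)
  rw [show a + x + (b + y) + 1 - (a + b) = x + y + 1 by omega] at h2
  have h3 := Nat.add_choose_mul_factorial_mul_factorial (a + x) (b + y + 1)
  have h4 := Nat.factorial_mul_descFactorial (show a ≤ a + x by omega)
  have h5 := Nat.factorial_mul_descFactorial (show b ≤ b + y by omega)
  rw [Nat.add_sub_cancel_left] at h4 h5
  rw [← Nat.choose_symm_add, Nat.factorial_succ] at h1 h3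
  refine Nat.eq_of_mul_eq_mul_right (Nat.mul_pos x.factorial_pos y.factorial_pos) ?_
  calc _ = ((x + (y + 1)).choose x * x.factorial * ((y + 1) * y.factorial)) *
        (a + x + (b + y) + 1).descFactorial (a + b) := by rw [← add_assoc x y 1]; ring
    _ = (a + x + (b + y) + 1).factorial := by rw [h1, ← add_assoc, h2]
    _ = _ := by
      rw [← add_assoc] at h3
      rw [← h3, ← h4, ← h5]; ring

theorem choose_mul_descFactorial_pin (a b x y : ℕ) :
    (x + y).choose x * (a + x + (b + y) + 1).descFactorial (a + b + 1) =
      (a + x + (b + y) + 1).choose (a + x) * (b + y + 1) *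
        ((a + x).descFactorial a * (b + y).descFactorial b) := by
  have h1 := Nat.add_choose_mul_factorial_mul_factorial x y
  have h2 := Nat.factorial_mul_descFactorial (show a + b + 1 ≤ a + x + (b + y) + 1 by omega)
  rw [show a + x + (b + y) + 1 - (a + b + 1) = x + y by omega] at h2
  have h3 := Nat.add_choose_mul_factorial_mul_factorial (a + x) (b + y + 1)
  have h4 := Nat.factorial_mul_descFactorial (show a ≤ a + x by omega)
  have h5 := Nat.factorial_mul_descFactorial (show b ≤ b + y by omega)
  rw [Nat.add_sub_cancel_left] at h4 h5
  rw [← Nat.choose_symm_add] at h1 h3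
  rw [Nat.factorial_succ] at h3
  refine Nat.eq_of_mul_eq_mul_right (Nat.mul_pos x.factorial_pos y.factorial_pos) ?_
  calc _ = ((x + y).choose x * x.factorial * y.factorial) *
        (a + x + (b + y) + 1).descFactorial (a + b + 1) := by ring
    _ = (a + x + (b + y) + 1).factorial := by rw [h1, h2]
    _ = _ := by
      rw [← add_assoc] at h3
      rw [← h3, ← h4, ← h5]; ring

section Pairs

variable {α : Type} [DecidableEq α]

/-- Ordered splittings of `V` into a set of size `m`, a single vertex and the rest. -/
def splits (V : Finset α) (m : ℕ) : Finset (Finset α × α) :=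
  ((V.powersetCard m) ×ˢ V).filter fun p => p.2 ∉ p.1

theorem mem_splits {V : Finset α} {m : ℕ} {p : Finset α × α} :
    p ∈ splits V m ↔ p.1 ⊆ V ∧ p.1.card = m ∧ p.2 ∈ V ∧ p.2 ∉ p.1 := by
  rw [splits, Finset.mem_filter, Finset.mem_product, Finset.mem_powersetCard]
  tauto

theorem card_filter_splits (V : Finset α) (m : ℕ) (P : Finset α → Prop) [DecidablePred P] :
    ((splits V m).filter fun p => P p.1).card =
      ((V.powersetCard m).filter P).card * (V.card - m) := by
  have : (((V.powersetCard m).filter P).sigma fun A => V \ A).card =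
      ((V.powersetCard m).filter P).card * (V.card - m) := by
    rw [Finset.card_sigma, Finset.sum_congr rfl fun A hA => ?_, Finset.sum_const, smul_eq_mul]
    rw [Finset.mem_filter, Finset.mem_powersetCard] at hA
    rw [Finset.card_sdiff_of_subset hA.1.1, hA.1.2]
  rw [← this]
  refine Finset.card_bij' (fun p _ => ⟨p.1, p.2⟩) (fun p _ => (p.1, p.2)) ?_ ?_ ?_ ?_
  · intro p hp
    simp only [Finset.mem_filter, mem_splits] at hp
    simp only [Finset.mem_sigma, Finset.mem_filter, Finset.mem_powersetCard, Finset.mem_sdiff]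
    tauto
  · intro p hp
    simp only [Finset.mem_sigma, Finset.mem_filter, Finset.mem_powersetCard,
      Finset.mem_sdiff] at hp
    simp only [Finset.mem_filter, mem_splits]
    tauto
  · intros; rfl
  · intros; rfl

theorem card_splits (V : Finset α) (m : ℕ) :
    (splits V m).card = V.card.choose m * (V.card - m) := by
  have := card_filter_splits V m fun _ => True
  simpa using this

theorem card_splits_containing_le {V X₁ X₂ : Finset α} {m a x b y : ℕ} (h₁ : X₁ ⊆ V) (h₂ : X₂ ⊆ V)
    (hd : Disjoint X₁ X₂) (ha : X₁.card = a) (hb : X₂.card = b) (hm : m = a + x)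
    (hV : V.card = a + x + (b + y) + 1) :
    ((splits V m).filter fun p => X₁ ⊆ p.1 ∧ X₂ ⊆ (V \ p.1).erase p.2).card ≤
      (x + y + 1).choose x * (y + 1) := by
  have hc : (V \ (X₁ ∪ X₂)).card = x + y + 1 := by
    rw [Finset.card_sdiff_of_subset (Finset.union_subset h₁ h₂),
      Finset.card_union_of_disjoint hd]; omega
  have := card_splits (V \ (X₁ ∪ X₂)) x
  rw [hc, show x + y + 1 - x = y + 1 by omega] at this
  rw [← this]
  refine Finset.card_le_card_of_injOn (fun p => (p.1 \ X₁, p.2)) (fun p hp => ?_)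
    fun p hp p' hp' h => ?_
  · rw [Finset.mem_coe, Finset.mem_filter, mem_splits] at hp
    rw [Finset.mem_coe, mem_splits]
    obtain ⟨⟨hA, hAc, hw, hwA⟩, hX₁, hX₂⟩ := hp
    refine ⟨fun z hz => ?_, ?_, ?_, fun h => hwA (Finset.mem_sdiff.1 h).1⟩
    · rw [Finset.mem_sdiff] at hz
      rw [Finset.mem_sdiff, Finset.mem_union]
      refine ⟨hA hz.1, ?_⟩
      rintro (h | h)
      · exact hz.2 h
      · exact (Finset.mem_sdiff.1 (Finset.mem_erase.1 (hX₂ h)).2).2 hz.1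
    · show (p.1 \ X₁).card = x
      rw [Finset.card_sdiff_of_subset hX₁]; omega
    · show p.2 ∈ _
      rw [Finset.mem_sdiff, Finset.mem_union]
      refine ⟨hw, ?_⟩
      rintro (h | h)
      · exact hwA (hX₁ h)
      · exact (Finset.mem_erase.1 (hX₂ h)).1 rfl
  · rw [Finset.mem_coe, Finset.mem_filter] at hp hp'
    rw [Prod.mk.injEq] at h
    refine Prod.ext ?_ h.2
    rw [← Finset.sdiff_union_of_subset hp.2.1, h.1, Finset.sdiff_union_of_subset hp'.2.1]

theorem card_splits_pinned_le {V X₁ X₂ : Finset α} {m a x b y : ℕ} {w : α} (h₁ : X₁ ⊆ V)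
    (h₂ : X₂ ⊆ V) (hd : Disjoint X₁ X₂) (hw : w ∈ V) (hw1 : w ∉ X₁) (hw2 : w ∉ X₂)
    (ha : X₁.card = a) (hb : X₂.card = b) (hm : m = a + x) (hV : V.card = a + x + (b + y) + 1) :
    ((splits V m).filter fun p => p.2 = w ∧ X₁ ⊆ p.1 ∧ X₂ ⊆ (V \ p.1).erase p.2).card ≤
      (x + y).choose x := by
  have hc : (V \ insert w (X₁ ∪ X₂)).card = x + y := by
    rw [Finset.card_sdiff_of_subset (Finset.insert_subset hw (Finset.union_subset h₁ h₂)),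
      Finset.card_insert_of_notMem (by simp [hw1, hw2]), Finset.card_union_of_disjoint hd]; omega
  rw [← hc, ← Finset.card_powersetCard]
  refine Finset.card_le_card_of_injOn (fun p => p.1 \ X₁) (fun p hp => ?_)
    fun p hp p' hp' h => ?_
  · rw [Finset.mem_coe, Finset.mem_filter, mem_splits] at hp
    rw [Finset.mem_coe, Finset.mem_powersetCard]
    obtain ⟨⟨hA, hAc, -, hwA⟩, rfl, hX₁, hX₂⟩ := hp
    refine ⟨fun z hz => ?_, ?_⟩
    · rw [Finset.mem_sdiff] at hz
      rw [Finset.mem_sdiff, Finset.mem_insert, Finset.mem_union]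
      refine ⟨hA hz.1, ?_⟩
      rintro (rfl | h | h)
      · exact hwA hz.1
      · exact hz.2 h
      · exact (Finset.mem_sdiff.1 (Finset.mem_erase.1 (hX₂ h)).2).2 hz.1
    · rw [Finset.card_sdiff_of_subset hX₁]; omega
  · rw [Finset.mem_coe, Finset.mem_filter] at hp hp'
    have h' : p.1 \ X₁ = p'.1 \ X₁ := h
    refine Prod.ext ?_ (hp.2.1.trans hp'.2.1.symm)
    rw [← Finset.sdiff_union_of_subset hp.2.2.1, h', Finset.sdiff_union_of_subset hp'.2.2.1]

/-- The second part of a random splitting is as random as the first. -/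
theorem card_filter_splits_snd (V : Finset α) {m m' : ℕ} (hm : V.card = m + m' + 1)
    (P : Finset α → Prop) [DecidablePred P] :
    ((splits V m).filter fun p => P ((V \ p.1).erase p.2)).card =
      ((V.powersetCard m').filter P).card * (V.card - m') := by
  rw [← card_filter_splits]
  have hinv : ∀ p : Finset α × α, p.1 ⊆ V → p.2 ∈ V → p.2 ∉ p.1 →
      (V \ (V \ p.1).erase p.2).erase p.2 = p.1 := fun p h1 h2 h3 => by
    ext z
    simp only [Finset.mem_erase, Finset.mem_sdiff]
    by_cases hz : z = p.2
    · subst hz; simp [h3]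
    · have := @h1 z
      tauto
  have hcard : ∀ (p : Finset α × α) (a : ℕ), p.1 ⊆ V → p.1.card = a → p.2 ∈ V → p.2 ∉ p.1 →
      ((V \ p.1).erase p.2).card = V.card - a - 1 := fun p a h1 h2 h3 h4 => by
    rw [Finset.card_erase_of_mem (Finset.mem_sdiff.2 ⟨h3, h4⟩), Finset.card_sdiff_of_subset h1, h2]
  refine Finset.card_bij' (fun p _ => ((V \ p.1).erase p.2, p.2))
    (fun p _ => ((V \ p.1).erase p.2, p.2)) ?_ ?_ ?_ ?_
  · intro p hp
    simp only [Finset.mem_filter, mem_splits] at hp ⊢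
    obtain ⟨⟨h1, h2, h3, h4⟩, h5⟩ := hp
    refine ⟨⟨(Finset.erase_subset _ _).trans Finset.sdiff_subset, ?_, h3, by simp⟩, h5⟩
    rw [hcard p m h1 h2 h3 h4]; omega
  · intro p hp
    simp only [Finset.mem_filter, mem_splits] at hp ⊢
    obtain ⟨⟨h1, h2, h3, h4⟩, h5⟩ := hp
    refine ⟨⟨(Finset.erase_subset _ _).trans Finset.sdiff_subset, ?_, h3, by simp⟩, ?_⟩
    · rw [hcard p m' h1 h2 h3 h4]; omega
    · rwa [hinv p h1 h3 h4]
  · intro p hp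
    simp only [Finset.mem_filter, mem_splits] at hp
    exact Prod.ext (hinv p hp.1.1 hp.1.2.2.1 hp.1.2.2.2) rfl
  · intro p hp
    simp only [Finset.mem_filter, mem_splits] at hp
    exact Prod.ext (hinv p hp.1.1 hp.1.2.2.1 hp.1.2.2.2) rfl

end Pairs

def glue {α : Type} (L : ℕ) (F F' : ℕ → α) (q : ℕ) : α := if q ≤ L then F q else F' (q - L)

theorem glue_of_le {α : Type} {L : ℕ} {F F' : ℕ → α} {q : ℕ} (hq : q ≤ L) : glue L F F' q = F q := if_pos hq

theorem glue_of_lt {α : Type} {L : ℕ} {F F' : ℕ → α} {q : ℕ} (hq : L < q) : glue L F F' q = F' (q - L) :=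
  if_neg (by omega)

theorem glue_add {α : Type} {L : ℕ} {F F' : ℕ → α} (h : F L = F' 0) (q : ℕ) :
    glue L F F' (L + q) = F' q := by
  rcases Nat.eq_zero_or_pos q with rfl | hq
  · rw [Nat.add_zero, glue_of_le le_rfl, h]
  · rw [glue_of_lt (by omega), Nat.add_sub_cancel_left]

variable {α : Type} [DecidableEq α]

/-- `F` runs along a loose path with `e` edges of `G` from `u` to `v` with interior `V`. -/
structure IsHP (G : Finset (Finset α)) (k e : ℕ) (V : Finset α) (u v : α) (F : ℕ → α) : Prop where
  zero : F 0 = u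
  last : F ((k - 1) * e) = v
  img : (Finset.Ioo 0 ((k - 1) * e)).image F = V
  blk_mem : ∀ t < e, blk F k t ∈ G

theorem IsHP.injOn {G : Finset (Finset α)} {k e : ℕ} {V : Finset α} {u v : α} {F : ℕ → α}
    (h : IsHP G k e V u v F) (hV : V.card + 1 = (k - 1) * e) :
    Set.InjOn F (Finset.Ioo 0 ((k - 1) * e)) := by
  rw [← Finset.card_image_iff, h.img, Nat.card_Ioo]; omega

theorem IsHP.mem {G : Finset (Finset α)} {k e : ℕ} {V : Finset α} {u v : α} {F : ℕ → α}
    (h : IsHP G k e V u v F) {q : ℕ} (hq : q ∈ Finset.Ioo 0 ((k - 1) * e)) : F q ∈ V := by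
  rw [← h.img]; exact Finset.mem_image_of_mem F hq

theorem IsHP.glue {G : Finset (Finset α)} {k e₁ e₂ : ℕ} {A B : Finset α} {u w v : α}
    {F F' : ℕ → α} (hk : 2 ≤ k) (h1 : 1 ≤ e₁) (h2 : 1 ≤ e₂) (h : IsHP G k e₁ A u w F)
    (h' : IsHP G k e₂ B w v F') :
    IsHP G k (e₁ + e₂) (insert w (A ∪ B)) u v (glue ((k - 1) * e₁) F F') := by
  have hL1 : 1 ≤ (k - 1) * e₁ := Nat.mul_pos (by omega) h1
  have hL2 : 1 ≤ (k - 1) * e₂ := Nat.mul_pos (by omega) h2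
  have hg := glue_add (L := (k - 1) * e₁) (h.last.trans h'.zero.symm)
  refine ⟨?_, ?_, ?_, fun t ht => ?_⟩
  · rw [glue_of_le (by omega), h.zero]
  · rw [mul_add, hg, h'.last]
  · ext z
    rw [← h.img, ← h'.img]
    simp only [Finset.mem_image, Finset.mem_insert, Finset.mem_union, Finset.mem_Ioo, mul_add]
    constructor
    · rintro ⟨q, hq, rfl⟩
      rcases lt_trichotomy q ((k - 1) * e₁) with hlt | rfl | hgt
      · exact Or.inr (Or.inl ⟨q, ⟨hq.1, hlt⟩, (glue_of_le hlt.le).symm⟩)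
      · left; rw [glue_of_le le_rfl, h.last]
      · exact Or.inr (Or.inr ⟨q - (k - 1) * e₁, by omega, (glue_of_lt hgt).symm⟩)
    · rintro (rfl | ⟨q, hq, rfl⟩ | ⟨q, hq, rfl⟩)
      · exact ⟨(k - 1) * e₁, by omega, by rw [glue_of_le le_rfl, h.last]⟩
      · exact ⟨q, by omega, glue_of_le hq.2.le⟩
      · exact ⟨(k - 1) * e₁ + q, by omega, hg q⟩
  · by_cases hte : t < e₁
    · rw [show blk (LooseHam.glue ((k - 1) * e₁) F F') k t = blk F k t from ?_]
      · exact h.blk_mem t hte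
      · ext z
        rw [mem_blk, mem_blk]
        refine exists_congr fun j => and_congr_right fun hj => ?_
        rw [glue_of_le]
        calc t * (k - 1) + j ≤ t * (k - 1) + (k - 1) := by omega
          _ = (k - 1) * (t + 1) := by ring
          _ ≤ _ := Nat.mul_le_mul_left _ hte
    · obtain ⟨s, rfl⟩ := Nat.exists_eq_add_of_le (not_lt.1 hte)
      rw [show blk (LooseHam.glue ((k - 1) * e₁) F F') k (e₁ + s) = blk F' k s from ?_]
      · exact h'.blk_mem s (by omega)
      · ext z
        rw [mem_blk, mem_blk]
        refine exists_congr fun j => and_congr_right fun hj => ?_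
        rw [show (e₁ + s) * (k - 1) + j = (k - 1) * e₁ + (s * (k - 1) + j) by ring, hg]

/-- There is a probability distribution on spanning loose paths that is spread on the vertices. -/
def SpreadHP (G : Finset (Finset α)) (k : ℕ) (K : ℝ) (e : ℕ) (V : Finset α) (u v : α) : Prop :=
  ∃ (ι : Type) (_ : Fintype ι) (w : ι → ℝ) (F : ι → ℕ → α), (∀ i, 0 ≤ w i) ∧ ∑ i, w i = 1 ∧
    (∀ i, IsHP G k e V u v (F i)) ∧ ∀ s ⊆ Finset.Ioo 0 ((k - 1) * e), ∀ g : ℕ → α,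
      (∑ i, if ∀ p ∈ s, F i p = g p then w i else 0) * (V.card.descFactorial s.card : ℕ) ≤
        K ^ s.card

/-- Number of splittings compatible with prescribed positions. -/
theorem card_compatible_le {V : Finset α} {m m' L : ℕ} (hV : V.card = m + m' + 1) (hL : L = m + 1)
    {s : Finset ℕ} (hs : s ⊆ Finset.Ioo 0 (m + m' + 2)) {g : ℕ → α} (hg : Set.InjOn g s)
    (hgV : ∀ q ∈ s, g q ∈ V) :
    ((splits V m).filter fun p => (L ∈ s → p.2 = g L) ∧ (s.filter (· < L)).image g ⊆ p.1 ∧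
      (s.filter (L < ·)).image g ⊆ (V \ p.1).erase p.2).card * V.card.descFactorial s.card ≤
      V.card.choose m * (m' + 1) * (m.descFactorial (s.filter (· < L)).card *
        m'.descFactorial (s.filter (L < ·)).card) := by
  have hca : ((s.filter (· < L)).image g).card = (s.filter (· < L)).card :=
    Finset.card_image_of_injOn (hg.mono (Finset.coe_subset.2 (Finset.filter_subset _ _)))
  have hcb : ((s.filter (L < ·)).image g).card = (s.filter (L < ·)).card :=
    Finset.card_image_of_injOn (hg.mono (Finset.coe_subset.2 (Finset.filter_subset _ _)))
  have hX₁ : (s.filter (· < L)).image g ⊆ V := Finset.image_subset_iff.2 fun q hq =>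
    hgV q (Finset.mem_filter.1 hq).1
  have hX₂ : (s.filter (L < ·)).image g ⊆ V := Finset.image_subset_iff.2 fun q hq =>
    hgV q (Finset.mem_filter.1 hq).1
  have hd : Disjoint ((s.filter (· < L)).image g) ((s.filter (L < ·)).image g) := by
    rw [Finset.disjoint_left]
    intro z hz hz'
    rw [Finset.mem_image] at hz hz'
    obtain ⟨q, hq, rfl⟩ := hz
    obtain ⟨q', hq', he⟩ := hz'
    rw [Finset.mem_filter] at hq hq'
    have := hg hq'.1 hq.1 he
    omega
  have ham : (s.filter (· < L)).card ≤ m := by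
    calc _ ≤ (Finset.Ioo 0 L).card := Finset.card_le_card fun q hq => by
          rw [Finset.mem_filter] at hq
          have := hs hq.1
          rw [Finset.mem_Ioo] at *; omega
      _ = m := by rw [Nat.card_Ioo]; omega
  have hbm : (s.filter (L < ·)).card ≤ m' := by
    calc _ ≤ (Finset.Ioo L (m + m' + 2)).card := Finset.card_le_card fun q hq => by
          rw [Finset.mem_filter] at hq
          have := hs hq.1
          rw [Finset.mem_Ioo] at *; omega
      _ = m' := by rw [Nat.card_Ioo]; omega
  have hsplit : s.card = (s.filter (· < L)).card + (s.filter (L < ·)).card +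
      if L ∈ s then 1 else 0 := by
    have h1 : (if L ∈ s then 1 else 0) = (s.filter (· = L)).card := by
      rw [Finset.filter_eq']; split_ifs <;> simp
    rw [h1, ← Finset.card_union_of_disjoint, ← Finset.card_union_of_disjoint]
    · congr 1
      ext q
      simp only [Finset.mem_union, Finset.mem_filter]
      have := lt_trichotomy q L
      tauto
    · rw [Finset.disjoint_left]
      intro q
      simp only [Finset.mem_union, Finset.mem_filter]
      omega
    · rw [Finset.disjoint_left]
      intro q
      simp only [Finset.mem_filter]
      omega
  obtain ⟨x, hx⟩ := Nat.exists_eq_add_of_le ham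
  obtain ⟨y, hy⟩ := Nat.exists_eq_add_of_le hbm
  generalize (s.filter (· < L)).card = a at *
  generalize (s.filter (L < ·)).card = b at *
  subst hx hy
  by_cases hLs : L ∈ s
  · rw [if_pos hLs] at hsplit
    have hw1 : g L ∉ (s.filter (· < L)).image g := fun h => by
      rw [Finset.mem_image] at h
      obtain ⟨q, hq, he⟩ := h
      rw [Finset.mem_filter] at hq
      have := hg hq.1 hLs he
      omega
    have hw2 : g L ∉ (s.filter (L < ·)).image g := fun h => by
      rw [Finset.mem_image] at h
      obtain ⟨q, hq, he⟩ := h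
      rw [Finset.mem_filter] at hq
      have := hg hq.1 hLs he
      omega
    have := card_splits_pinned_le hX₁ hX₂ hd (hgV L hLs) hw1 hw2 hca hcb rfl hV
    rw [hsplit, hV, ← choose_mul_descFactorial_pin]
    refine Nat.mul_le_mul_right _ (le_trans (Finset.card_le_card fun p hp => ?_) this)
    rw [Finset.mem_filter] at hp ⊢
    exact ⟨hp.1, hp.2.1 hLs, hp.2.2⟩
  · rw [if_neg hLs, add_zero] at hsplit
    have := card_splits_containing_le hX₁ hX₂ hd hca hcb rfl hV
    rw [hsplit, hV, ← choose_mul_descFactorial_gap]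
    refine Nat.mul_le_mul_right _ (le_trans (Finset.card_le_card fun p hp => ?_) this)
    rw [Finset.mem_filter] at hp ⊢
    exact ⟨hp.1, hp.2.2⟩

variable {α : Type} [DecidableEq α]

open Classical in
/-- Combining spread path distributions over a large family of splittings. -/
theorem SpreadHP.combine {G : Finset (Finset α)} {k e₁ e₂ m m' : ℕ} {K φ : ℝ} {V : Finset α}
    {u v : α} (hk : 2 ≤ k) (hK : 1 ≤ K) (hφ : 0 ≤ φ) (hφ1 : φ < 1) (he1 : 1 ≤ e₁) (he2 : 1 ≤ e₂)
    (hm : m + 1 = (k - 1) * e₁) (hm' : m' + 1 = (k - 1) * e₂) (hV : V.card = m + m' + 1)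
    (good : Finset (Finset α × α)) (hsub : good ⊆ splits V m)
    (hcard : (1 - φ) * (splits V m).card ≤ good.card)
    (h1 : ∀ p ∈ good, SpreadHP G k K e₁ p.1 u p.2)
    (h2 : ∀ p ∈ good, SpreadHP G k K e₂ ((V \ p.1).erase p.2) p.2 v) :
    SpreadHP G k (K / (1 - φ)) (e₁ + e₂) V u v := by
  have hφ' : 0 < 1 - φ := by linarith
  have hsc : (splits V m).card = V.card.choose m * (m' + 1) := by
    rw [card_splits, hV, show m + m' + 1 - m = m' + 1 by omega]
  have hsp : 0 < (splits V m).card := by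
    rw [hsc]
    exact Nat.mul_pos (Nat.choose_pos (by omega)) (by omega)
  have hgp : (0 : ℝ) < good.card :=
    lt_of_lt_of_le (mul_pos hφ' (by exact_mod_cast hsp)) hcard
  choose ι₁ fι₁ w₁ F₁ hw₁ hs₁ hP₁ hS₁ using fun p : good => h1 p.1 p.2
  choose ι₂ fι₂ w₂ F₂ hw₂ hs₂ hP₂ hS₂ using fun p : good => h2 p.1 p.2
  set L := (k - 1) * e₁ with hL
  have hLm : L = m + 1 := hm.symm
  have hN : (k - 1) * (e₁ + e₂) = m + m' + 2 := by rw [mul_add, ← hL, ← hm']; omega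
  have hpV : ∀ p : good, p.1.1 ⊆ V ∧ p.1.1.card = m ∧ p.1.2 ∈ V ∧ p.1.2 ∉ p.1.1 :=
    fun p => mem_splits.1 (hsub p.2)
  have hrest : ∀ p : good, ((V \ p.1.1).erase p.1.2).card = m' := fun p => by
    obtain ⟨h1, h2, h3, h4⟩ := hpV p
    rw [Finset.card_erase_of_mem (Finset.mem_sdiff.2 ⟨h3, h4⟩), Finset.card_sdiff_of_subset h1]
    omega
  have hHP : ∀ (p : good) i j, IsHP G k (e₁ + e₂) V u v (LooseHam.glue L (F₁ p i) (F₂ p j)) :=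
    fun p i j => by
      have := (hP₁ p i).glue hk he1 he2 (hP₂ p j)
      convert this using 1
      obtain ⟨h1, h2, h3, h4⟩ := hpV p
      ext z
      simp only [Finset.mem_insert, Finset.mem_union, Finset.mem_erase, Finset.mem_sdiff]
      have := @h1 z
      by_cases hz : z = p.1.2
      · subst hz; simp [h3]
      · tauto
  refine ⟨Σ p : good, ι₁ p × ι₂ p, inferInstance, fun x => (good.card : ℝ)⁻¹ *
    (w₁ x.1 x.2.1 * w₂ x.1 x.2.2), fun x => LooseHam.glue L (F₁ x.1 x.2.1) (F₂ x.1 x.2.2),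
    fun x => mul_nonneg (inv_nonneg.2 hgp.le) (mul_nonneg (hw₁ _ _) (hw₂ _ _)), ?_,
    fun x => hHP _ _ _, ?_⟩
  · rw [Fintype.sum_sigma]
    simp only [Fintype.sum_prod_type, ← Finset.mul_sum, hs₂, hs₁, mul_one]
    rw [Finset.sum_const, Finset.card_univ, Fintype.card_coe, nsmul_eq_mul,
      mul_inv_cancel₀ hgp.ne']
  intro s hs g
  rcases s.eq_empty_or_nonempty with rfl | hne
  · simp only [Finset.notMem_empty, IsEmpty.forall_iff, implies_true, if_true, Finset.card_empty,
      Nat.descFactorial_zero, Nat.cast_one, mul_one, pow_zero]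
    refine le_of_eq ?_
    rw [Fintype.sum_sigma]
    simp only [Fintype.sum_prod_type, ← Finset.mul_sum, hs₂, hs₁, mul_one]
    rw [Finset.sum_const, Finset.card_univ, Fintype.card_coe, nsmul_eq_mul,
      mul_inv_cancel₀ hgp.ne']
  have hKφ : 1 ≤ K / (1 - φ) := by rw [le_div_iff₀ hφ']; linarith
  by_cases hex : ∃ (p : good) (i : ι₁ p) (j : ι₂ p), ∀ q ∈ s,
      LooseHam.glue L (F₁ p i) (F₂ p j) q = g q
  swap
  · rw [Finset.sum_eq_zero, zero_mul]
    · positivity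
    · rintro ⟨p, i, j⟩ -
      rw [if_neg]
      exact fun h => hex ⟨p, i, j, h⟩
  obtain ⟨p₀, i₀, j₀, h₀⟩ := hex
  have hginj : Set.InjOn g s := by
    have := (hHP p₀ i₀ j₀).injOn (by rw [hV, hN])
    intro x hx y hy hxy
    rw [← h₀ x hx, ← h₀ y hy] at hxy
    exact this (hs hx) (hs hy) hxy
  have hgV : ∀ q ∈ s, g q ∈ V := fun q hq => by
    rw [← h₀ q hq]; exact (hHP p₀ i₀ j₀).mem (hs hq)
  have hcount := card_compatible_le hV hLm (s := s) (by rwa [← hN]) hginj hgV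
  set sl := s.filter (· < L) with hsl
  set sr := s.filter (L < ·) with hsr
  set compat : Finset α × α → Prop := fun p => (L ∈ s → p.2 = g L) ∧ sl.image g ⊆ p.1 ∧
      sr.image g ⊆ (V \ p.1).erase p.2 with hcompat
  set D₁ : ℝ := ((m.descFactorial sl.card : ℕ) : ℝ) with hD₁
  set D₂ : ℝ := ((m'.descFactorial sr.card : ℕ) : ℝ) with hD₂
  have hslI : sl ⊆ Finset.Ioo 0 L := fun q hq => by
    rw [hsl, Finset.mem_filter] at hq
    have := hs hq.1
    rw [Finset.mem_Ioo] at *; omega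
  set sr' := sr.image (· - L) with hsr'
  have hsrI : sr' ⊆ Finset.Ioo 0 ((k - 1) * e₂) := fun q hq => by
    rw [hsr', Finset.mem_image] at hq
    obtain ⟨q, hq, rfl⟩ := hq
    rw [hsr, Finset.mem_filter] at hq
    have := hs hq.1
    rw [Finset.mem_Ioo] at *; omega
  have hsrc : sr'.card = sr.card := Finset.card_image_of_injOn fun x hx y hy hxy => by
    rw [Finset.mem_coe, hsr, Finset.mem_filter] at hx hy
    have hxy : x - L = y - L := hxy
    omega
  have hD₁p : 0 < D₁ := by
    rw [hD₁, Nat.cast_pos, Nat.descFactorial_pos]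
    calc _ ≤ (Finset.Ioo 0 L).card := Finset.card_le_card hslI
      _ = m := by rw [Nat.card_Ioo]; omega
  have hD₂p : 0 < D₂ := by
    rw [hD₂, Nat.cast_pos, Nat.descFactorial_pos, ← hsrc]
    calc _ ≤ (Finset.Ioo 0 ((k - 1) * e₂)).card := Finset.card_le_card hsrI
      _ = m' := by rw [Nat.card_Ioo]; omega
  have hb₁ : ∀ p : good, (∑ i, if ∀ q ∈ sl, F₁ p i q = g q then w₁ p i else 0) ≤
      K ^ sl.card / D₁ := fun p => by
    rw [le_div_iff₀ hD₁p]
    have := hS₁ p sl hslI g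
    rw [(hpV p).2.1] at this
    convert this using 5
  have hb₂ : ∀ p : good, (∑ j, if ∀ q ∈ sr', F₂ p j q = g (q + L) then w₂ p j else 0) ≤
      K ^ sr.card / D₂ := fun p => by
    rw [le_div_iff₀ hD₂p]
    have := hS₂ p sr' hsrI fun q => g (q + L)
    rw [hrest p, hsrc] at this
    convert this using 5
  have hterm : ∀ p : good, (∑ i, ∑ j, if ∀ q ∈ s, LooseHam.glue L (F₁ p i) (F₂ p j) q = g q then
      (good.card : ℝ)⁻¹ * (w₁ p i * w₂ p j) else 0) ≤
      if compat p.1 then (good.card : ℝ)⁻¹ * (K ^ sl.card / D₁ * (K ^ sr.card / D₂)) else 0 := by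
    intro p
    split_ifs with hc
    · refine le_trans ?_ (mul_le_mul_of_nonneg_left (mul_le_mul (hb₁ p) (hb₂ p)
        (Finset.sum_nonneg fun j _ => ?_) (by positivity)) (inv_nonneg.2 hgp.le))
      · rw [Finset.sum_mul_sum, Finset.mul_sum]
        refine Finset.sum_le_sum fun i _ => ?_
        rw [Finset.mul_sum]
        refine Finset.sum_le_sum fun j _ => ?_
        by_cases h : ∀ q ∈ s, LooseHam.glue L (F₁ p i) (F₂ p j) q = g q
        · rw [if_pos h, if_pos, if_pos]
          · intro q hq
            rw [hsr', Finset.mem_image] at hq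
            obtain ⟨q, hq, rfl⟩ := hq
            rw [hsr, Finset.mem_filter] at hq
            rw [← glue_of_lt (F := F₁ p i) (F' := F₂ p j) hq.2, h q hq.1, Nat.sub_add_cancel hq.2.le]
          · intro q hq
            rw [hsl, Finset.mem_filter] at hq
            rw [← glue_of_le (F := F₁ p i) (F' := F₂ p j) hq.2.le, h q hq.1]
        · rw [if_neg h]
          refine mul_nonneg (inv_nonneg.2 hgp.le) (mul_nonneg ?_ ?_) <;> split_ifs <;>
            first | exact le_rfl | exact hw₁ _ _ | exact hw₂ _ _
      · split_ifs <;> first | exact le_rfl | exact hw₂ _ _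
    · refine le_of_eq (Finset.sum_eq_zero fun i _ => Finset.sum_eq_zero fun j _ => if_neg ?_)
      intro h
      refine hc ⟨fun hLs => ?_, ?_, ?_⟩
      · rw [← h L hLs, glue_of_le le_rfl, (hP₁ p i).last]
      · refine Finset.image_subset_iff.2 fun q hq => ?_
        have hq' := hslI hq
        rw [hsl, Finset.mem_filter] at hq
        rw [← h q hq.1, glue_of_le hq.2.le]
        exact (hP₁ p i).mem hq'
      · refine Finset.image_subset_iff.2 fun q hq => ?_
        have hq' := hsrI (Finset.mem_image_of_mem _ hq)
        rw [hsr, Finset.mem_filter] at hq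
        rw [← h q hq.1, glue_of_lt hq.2]
        exact (hP₂ p j).mem hq'
  have hslsr : sl.card + sr.card ≤ s.card := by
    rw [← Finset.card_union_of_disjoint]
    · exact Finset.card_le_card (Finset.union_subset (Finset.filter_subset _ _)
        (Finset.filter_subset _ _))
    · rw [Finset.disjoint_left, hsl, hsr]
      intro q
      simp only [Finset.mem_filter]
      omega
  set S : ℝ := (((splits V m).filter compat).card : ℝ) with hS
  have hsum : (∑ x : Σ p : good, ι₁ p × ι₂ p,
      if ∀ q ∈ s, LooseHam.glue L (F₁ x.1 x.2.1) (F₂ x.1 x.2.2) q = g q then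
      (good.card : ℝ)⁻¹ * (w₁ x.1 x.2.1 * w₂ x.1 x.2.2) else 0) ≤
      S * ((good.card : ℝ)⁻¹ * (K ^ sl.card / D₁ * (K ^ sr.card / D₂))) := by
    rw [Fintype.sum_sigma]
    simp only [Fintype.sum_prod_type]
    refine le_trans (Finset.sum_le_sum fun p _ => hterm p) ?_
    rw [Finset.sum_coe_sort good fun p => if compat p then
      (good.card : ℝ)⁻¹ * (K ^ sl.card / D₁ * (K ^ sr.card / D₂)) else 0, ← Finset.sum_filter,
      Finset.sum_const, nsmul_eq_mul]
    refine mul_le_mul_of_nonneg_right ?_ (by positivity)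
    rw [hS, Nat.cast_le]
    exact Finset.card_le_card (Finset.filter_subset_filter _ hsub)
  have hcount' : S * (V.card.descFactorial s.card : ℕ) ≤ (splits V m).card * (D₁ * D₂) := by
    rw [hS, hsc, hD₁, hD₂]
    exact_mod_cast hcount
  have hpow : K ^ sl.card * K ^ sr.card ≤ K ^ s.card := by
    rw [← pow_add]; exact pow_le_pow_right₀ hK hslsr
  refine le_trans (mul_le_mul_of_nonneg_right hsum (Nat.cast_nonneg _)) ?_
  calc S * ((good.card : ℝ)⁻¹ * (K ^ sl.card / D₁ * (K ^ sr.card / D₂))) *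
        (V.card.descFactorial s.card : ℕ)
      = (S * (V.card.descFactorial s.card : ℕ)) * (K ^ sl.card * K ^ sr.card) /
          (good.card * (D₁ * D₂)) := by field_simp
    _ ≤ ((splits V m).card * (D₁ * D₂)) * K ^ s.card / (good.card * (D₁ * D₂)) := by
        gcongr
    _ = ((splits V m).card / good.card) * K ^ s.card := by field_simp
    _ ≤ (1 / (1 - φ)) * K ^ s.card := by
        refine mul_le_mul_of_nonneg_right ?_ (by positivity)
        rw [div_le_div_iff₀ hgp hφ']; linarith
    _ ≤ (1 / (1 - φ)) ^ s.card * K ^ s.card := by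
        refine mul_le_mul_of_nonneg_right ?_ (by positivity)
        refine le_self_pow₀ ?_ (Finset.card_pos.2 hne).ne'
        rw [le_div_iff₀ hφ']; linarith
    _ = _ := by rw [← mul_pow, div_mul_eq_mul_div, one_mul]

variable {α : Type} [DecidableEq α]

theorem SpreadHP.mono {G : Finset (Finset α)} {k e : ℕ} {K K' : ℝ} {V : Finset α} {u v : α}
    (h : SpreadHP G k K e V u v) (hK : 0 ≤ K) (hKK : K ≤ K') : SpreadHP G k K' e V u v := by
  obtain ⟨ι, hι, w, F, h1, h2, h3, h4⟩ := h
  exact ⟨ι, hι, w, F, h1, h2, h3, fun s hs g =>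
    (h4 s hs g).trans (pow_le_pow_left₀ hK hKK _)⟩

theorem spreadHP_of_isHP {G : Finset (Finset α)} {k e : ℕ} {K : ℝ} {V : Finset α} {u v : α}
    {F : ℕ → α} (h : IsHP G k e V u v F) (hK : (V.card : ℝ) ≤ K) : SpreadHP G k K e V u v := by
  refine ⟨Unit, inferInstance, fun _ => 1, fun _ => F, fun _ => zero_le_one, by simp, fun _ => h,
    fun s _ g => ?_⟩
  have h1 : ((V.card.descFactorial s.card : ℕ) : ℝ) ≤ K ^ s.card := by
    calc ((V.card.descFactorial s.card : ℕ) : ℝ) ≤ ((V.card ^ s.card : ℕ) : ℝ) := by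
          exact_mod_cast Nat.descFactorial_le_pow _ _
      _ = (V.card : ℝ) ^ s.card := by push_cast; rfl
      _ ≤ _ := pow_le_pow_left₀ (Nat.cast_nonneg _) hK _
  rw [Fintype.sum_unique]
  split_ifs
  · rwa [one_mul]
  · rw [zero_mul]; exact (Nat.cast_nonneg _).trans h1

theorem LPath.isHP {G : Finset (Finset α)} {k e : ℕ} {V : Finset α} {u v : α} (hk : 2 ≤ k)
    (hG : ∀ e ∈ G, e.card = k) (hu : u ∉ V) (hv : v ∉ V) (huv : u ≠ v)
    (hV : V.card + 1 = (k - 1) * e) (h : LPath G u v (insert u (insert v V))) :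
    ∃ F, IsHP G k e V u v F := by
  obtain ⟨e', F, hc, h0, hl, hinj, him, hb⟩ := h.exists_fun hk hG
  rw [Finset.card_insert_of_notMem (by simp [hu, huv]), Finset.card_insert_of_notMem hv, hV,
    Nat.add_right_cancel_iff] at hc
  obtain rfl : e = e' := Nat.eq_of_mul_eq_mul_left (by omega) hc
  have hpos : 0 < (k - 1) * e := by omega
  refine ⟨F, h0, hl, ?_, hb⟩
  ext z
  rw [Finset.mem_image]
  constructor
  · rintro ⟨q, hq, rfl⟩
    rw [Finset.mem_Ioo] at hq
    have : F q ∈ insert u (insert v V) := by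
      rw [← him]; exact Finset.mem_image_of_mem F (Finset.mem_range.2 (by omega))
    rw [Finset.mem_insert, Finset.mem_insert] at this
    rcases this with h | h | h
    · have := hinj (Set.mem_Iic.2 hq.2.le) (Set.mem_Iic.2 hpos.le) (h.trans h0.symm); omega
    · have := hinj (Set.mem_Iic.2 hq.2.le) (Set.mem_Iic.2 le_rfl) (h.trans hl.symm); omega
    · exact h
  · intro hz
    have : z ∈ (Finset.range ((k - 1) * e + 1)).image F := by rw [him]; simp [hz]
    rw [Finset.mem_image] at this
    obtain ⟨q, hq, rfl⟩ := this
    rw [Finset.mem_range] at hq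
    refine ⟨q, Finset.mem_Ioo.2 ⟨Nat.pos_of_ne_zero ?_, lt_of_le_of_ne (by omega) ?_⟩, rfl⟩
    · rintro rfl; exact hu (h0 ▸ hz)
    · rintro rfl; exact hv (hl ▸ hz)

theorem exists_forall_exp_ge (k : ℕ) {c : ℝ} (hc : 0 < c) : ∃ E : ℕ, ∀ e₀ : ℕ, E ≤ e₀ →
    ∀ j : ℕ, 8 * 2 ^ j * (4 * k * e₀ * 2 ^ j : ℝ) ^ (k + 1) ≤
      Real.exp (c * e₀ * (9 / 8) ^ j) := by
  set p := 6 * (k + 2) with hp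
  obtain ⟨E, hE⟩ := exists_nat_ge (8 * (4 * k : ℝ) ^ (k + 1) * p.factorial / c ^ p)
  refine ⟨E + 1, fun e₀ he j => ?_⟩
  have he1 : (1 : ℝ) ≤ e₀ := by exact_mod_cast (by omega : 1 ≤ e₀)
  have hee : (E : ℝ) ≤ e₀ := by exact_mod_cast (by omega : E ≤ e₀)
  have hpf : (0 : ℝ) < p.factorial := by exact_mod_cast p.factorial_pos
  have hcp : 0 < c ^ p := by positivity
  have h1 : 8 * (4 * k : ℝ) ^ (k + 1) * p.factorial ≤ e₀ * c ^ p := by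
    rw [← div_le_iff₀ hcp]; exact hE.trans hee
  refine le_trans ?_ (Real.pow_div_factorial_le_exp (c * e₀ * (9 / 8) ^ j) (by positivity) p)
  rw [le_div_iff₀ hpf]
  have h2 : (2 : ℝ) ^ j * (2 ^ j) ^ (k + 1) ≤ ((9 / 8 : ℝ) ^ j) ^ p := by
    have : ((9 / 8 : ℝ) ^ j) ^ p = (((9 / 8 : ℝ) ^ 6) ^ j) ^ (k + 2) := by
      rw [hp, ← pow_mul, ← pow_mul, ← pow_mul]
      congr 1
      ring
    rw [this, ← pow_succ']
    have : (2 : ℝ) ≤ (9 / 8) ^ 6 := by norm_num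
    gcongr
  have h3 : (e₀ : ℝ) * e₀ ^ (k + 1) ≤ e₀ ^ p := by
    rw [← pow_succ']
    exact pow_le_pow_right₀ he1 (by omega)
  calc 8 * 2 ^ j * (4 * k * e₀ * 2 ^ j : ℝ) ^ (k + 1) * p.factorial
      = (8 * (4 * k : ℝ) ^ (k + 1) * p.factorial) * e₀ ^ (k + 1) *
          (2 ^ j * (2 ^ j) ^ (k + 1)) := by rw [mul_pow, mul_pow]; ring
    _ ≤ (e₀ * c ^ p) * e₀ ^ (k + 1) * (((9 / 8 : ℝ) ^ j) ^ p) := by gcongr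
    _ = (e₀ * e₀ ^ (k + 1)) * c ^ p * (((9 / 8 : ℝ) ^ j) ^ p) := by ring
    _ ≤ e₀ ^ p * c ^ p * (((9 / 8 : ℝ) ^ j) ^ p) := by gcongr
    _ = _ := by rw [mul_pow, mul_pow]; ring

open Classical in
/-- One halving step: most splittings keep the degree condition. -/
theorem SpreadHP.halve {G : Finset (Finset α)} {k d r e₁ e₂ m m' : ℕ} {K φ θ η : ℝ} {V : Finset α}
    {u v : α} (hk : 2 ≤ k) (hK : 1 ≤ K) (hφ1 : φ < 1) (he1 : 1 ≤ e₁) (he2 : 1 ≤ e₂)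
    (hm0 : 0 < m) (hm0' : 0 < m')
    (hm : m + 1 = (k - 1) * e₁) (hm' : m' + 1 = (k - 1) * e₂) (hV : V.card = m + m' + 1)
    (hu : u ∉ V) (hv : v ∉ V) (hη : 0 ≤ η)
    (hdeg : ∀ D ⊆ insert u (insert v V), D.card = d →
      θ * (V.card : ℝ) ^ r ≤ (lk G V D r).card)
    (hφm : 2 * ((V.card + 2 : ℝ) ^ d * (V.card + 1) ^ (r + 1) * Real.exp (-(η ^ 2 * m / 2))) ≤ φ)
    (hφm' : 2 * ((V.card + 2 : ℝ) ^ d * (V.card + 1) ^ (r + 1) *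
      Real.exp (-(η ^ 2 * m' / 2))) ≤ φ)
    (hrec : ∀ e A x y, (e = e₁ ∨ e = e₂) → x ∉ A → y ∉ A → x ≠ y → A.card + 1 = (k - 1) * e →
      (∀ D ⊆ insert x (insert y A), D.card = d →
        (θ - r * η) * (A.card : ℝ) ^ r ≤ (lk G A D r).card) → SpreadHP G k K e A x y) :
    SpreadHP G k (K / (1 - φ)) (e₁ + e₂) V u v := by
  have hφ : 0 ≤ φ := le_trans (by positivity) hφm
  set Y := insert u (insert v V) with hY
  have hYc : (Y.card : ℝ) ≤ V.card + 2 := by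
    have h1 : Y.card ≤ _ := Finset.card_insert_le u (insert v V)
    have h2 := Finset.card_insert_le v V
    exact_mod_cast (by omega : Y.card ≤ V.card + 2)
  set bad : ℕ → Finset α → Prop := fun M A => ∃ D ∈ Y.powersetCard d,
    ((lk G A D r).card : ℝ) < (θ - r * η) * (M : ℝ) ^ r with hbad
  have hcount : ∀ M : ℕ, 0 < M → M < V.card →
      2 * ((V.card + 2 : ℝ) ^ d * (V.card + 1) ^ (r + 1) * Real.exp (-(η ^ 2 * M / 2))) ≤ φ →
      (((V.powersetCard M).filter (bad M)).card : ℝ) ≤ φ / 2 * V.card.choose M := by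
    intro M hM hMV hMφ
    refine (card_bad_subsets_le G hM hMV hη hdeg).trans ?_
    refine mul_le_mul_of_nonneg_right ?_ (Nat.cast_nonneg _)
    have : (Y.card : ℝ) ^ d ≤ (V.card + 2 : ℝ) ^ d :=
      pow_le_pow_left₀ (Nat.cast_nonneg _) hYc d
    calc _ ≤ (V.card + 2 : ℝ) ^ d * (V.card + 1) ^ (r + 1) * Real.exp (-(η ^ 2 * M / 2)) := by
          gcongr
      _ ≤ _ := by linarith
  have hc1 := hcount m hm0 (by omega) hφm
  have hc2 := hcount m' hm0' (by omega) hφm'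
  set good := (splits V m).filter fun p => ¬ bad m p.1 ∧ ¬ bad m' ((V \ p.1).erase p.2) with hgood
  have hs1 : (splits V m).card = V.card.choose m * (V.card - m) := card_splits V m
  have hs2 : (splits V m).card = V.card.choose m' * (V.card - m') := by
    have := card_filter_splits_snd V hV fun _ => True
    simpa using this
  have hb1 : (((splits V m).filter fun p => bad m p.1).card : ℝ) ≤
      φ / 2 * (splits V m).card := by
    rw [card_filter_splits V m (bad m), hs1]
    push_cast
    rw [← mul_assoc]
    gcongr
  have hb2 : (((splits V m).filter fun p => bad m' ((V \ p.1).erase p.2)).card : ℝ) ≤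
      φ / 2 * (splits V m).card := by
    rw [card_filter_splits_snd V hV (bad m'), hs2]
    push_cast
    rw [← mul_assoc]
    gcongr
  have hall : (splits V m).card ≤ good.card + (((splits V m).filter fun p => bad m p.1).card +
      ((splits V m).filter fun p => bad m' ((V \ p.1).erase p.2)).card) := by
    refine le_trans (Finset.card_le_card ?_) ((Finset.card_union_le _ _).trans
      (Nat.add_le_add_left (Finset.card_union_le _ _) _))
    intro p hp
    simp only [hgood, Finset.mem_union, Finset.mem_filter]
    tauto
  have hcomb : (1 - φ) * (splits V m).card ≤ good.card := by
    have : ((splits V m).card : ℝ) ≤ good.card +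
      ((((splits V m).filter fun p => bad m p.1).card : ℝ) +
      ((splits V m).filter fun p => bad m' ((V \ p.1).erase p.2)).card) := by exact_mod_cast hall
    linarith
  have hne : ∀ {z}, z ∈ V → u ≠ z ∧ z ≠ v := fun hz =>
    ⟨fun h => hu (h ▸ hz), fun h => hv (h ▸ hz)⟩
  have hkey : ∀ M A, A ⊆ V → A.card = M → ¬ bad M A → ∀ x ∈ Y, ∀ y ∈ Y,
      ∀ D ⊆ insert x (insert y A), D.card = d →
        (θ - r * η) * (A.card : ℝ) ^ r ≤ (lk G A D r).card := by
    intro M A hA hAc hb x hx y hy D hD hDc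
    rw [hAc]
    by_contra hlt
    refine hb ⟨D, Finset.mem_powersetCard.2 ⟨hD.trans ?_, hDc⟩, not_le.1 hlt⟩
    refine Finset.insert_subset hx (Finset.insert_subset hy (hA.trans ?_))
    exact (Finset.subset_insert _ _).trans (Finset.subset_insert _ _)
  have huY : u ∈ Y := Finset.mem_insert_self _ _
  have hvY : v ∈ Y := Finset.mem_insert_of_mem (Finset.mem_insert_self _ _)
  have hVY : ∀ {z}, z ∈ V → z ∈ Y := fun hz =>
    Finset.mem_insert_of_mem (Finset.mem_insert_of_mem hz)
  refine SpreadHP.combine hk hK hφ hφ1 he1 he2 hm hm' hV good (Finset.filter_subset _ _) hcomb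
    (fun p hp => ?_) (fun p hp => ?_)
  · rw [hgood, Finset.mem_filter, mem_splits] at hp
    obtain ⟨⟨h1, h2, h3, h4⟩, h5, h6⟩ := hp
    exact hrec e₁ p.1 u p.2 (Or.inl rfl) (fun h => hu (h1 h)) h4 (hne h3).1 (by rw [h2, hm])
      (hkey m p.1 h1 h2 h5 u huY p.2 (hVY h3))
  · rw [hgood, Finset.mem_filter, mem_splits] at hp
    obtain ⟨⟨h1, h2, h3, h4⟩, h5, h6⟩ := hp
    have hsub : (V \ p.1).erase p.2 ⊆ V := (Finset.erase_subset _ _).trans Finset.sdiff_subset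
    have hc : ((V \ p.1).erase p.2).card = m' := by
      rw [Finset.card_erase_of_mem (Finset.mem_sdiff.2 ⟨h3, h4⟩), Finset.card_sdiff_of_subset h1]
      omega
    exact hrec e₂ _ p.2 v (Or.inr rfl) (by simp) (fun h => hv (hsub h)) (hne h3).2
      (by rw [hc, hm']) (hkey m' _ hsub hc h6 p.2 (hVY h3) v hvY)

set_option maxHeartbeats 1600000 in
theorem HamBB.spreadHP {k d n₀ : ℕ} {β κ : ℝ} (hk : 2 ≤ k) (hd1 : 1 ≤ d) (hdk : d ≤ k - 1)
    (hβ : 0 ≤ β) (hκ : 0 < κ) (hBB : HamBB k d β n₀) :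
    ∃ (e₀ : ℕ) (K : ℝ), 1 ≤ e₀ ∧ 1 ≤ K ∧ ∀ (α : Type) [DecidableEq α] (G : Finset (Finset α)),
      (∀ e ∈ G, e.card = k) → ∀ (e : ℕ) (V : Finset α) (u v : α), 2 * e₀ ≤ e → u ∉ V → v ∉ V →
      V.card + 1 = (k - 1) * e →
      (∀ D ⊆ insert u (insert v V), D.card = d →
        (β + 2 * κ) * (V.card : ℝ) ^ (k - d) ≤ (lk G V D (k - d)).card) →
      SpreadHP G k K e V u v := by
  obtain ⟨N₀, hN₀⟩ := hBB.connected hk hd1 hdk hβ (half_pos hκ)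
  set r := k - d with hr
  have hr1 : 1 ≤ r := by omega
  have hr0 : (0 : ℝ) < r := by exact_mod_cast hr1
  obtain ⟨ε, hε, hε'⟩ := exists_perturb_pow (β + κ / 2) (by positivity) (half_pos hκ) r
  obtain ⟨E, hE⟩ := exists_forall_exp_ge k (show 0 < κ ^ 2 / (64 * r ^ 2) by positivity)
  obtain ⟨E', hE'⟩ := exists_nat_ge (2 / ε)
  set e₀ := E + E' + N₀ + 4 with he₀
  set K₀ : ℝ := 2 * k * e₀ with hK₀
  have hk0 : (1 : ℝ) ≤ k := by exact_mod_cast (by omega : 1 ≤ k)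
  have he0 : (1 : ℝ) ≤ e₀ := by exact_mod_cast (by omega : 1 ≤ e₀)
  have hK₀1 : 1 ≤ K₀ := by
    rw [hK₀]; nlinarith
  have hhalf : ∀ j : ℕ, (0 : ℝ) < (1 / 2) ^ j ∧ ((1 : ℝ) / 2) ^ j ≤ 1 := fun j =>
    ⟨by positivity, pow_le_one₀ (by norm_num) (by norm_num)⟩
  refine ⟨e₀, K₀ * 2, by omega, by linarith, ?_⟩
  intro α _ G hG
  have key : ∀ (j e : ℕ) (V : Finset α) (u v : α), e₀ * 2 ^ j ≤ e → e ≤ e₀ * 2 ^ (j + 1) →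
      u ∉ V → v ∉ V → (j = 0 → u ≠ v) → V.card + 1 = (k - 1) * e →
      (∀ D ⊆ insert u (insert v V), D.card = d →
        (β + 2 * κ - κ * (3 / 4) ^ j) * (V.card : ℝ) ^ r ≤ (lk G V D r).card) →
      SpreadHP G k (K₀ * (2 - (1 / 2) ^ j)) e V u v := by
    intro j
    induction j with
    | zero =>
      intro e V u v h1 h2 hu hv huv hV hdeg
      rw [pow_zero, mul_one] at h1
      rw [zero_add, pow_one] at h2
      have hke : e ≤ (k - 1) * e := Nat.le_mul_of_pos_left e (by omega)
      have huc : (insert u (insert v V)).card = V.card + 2 := by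
        rw [Finset.card_insert_of_notMem (by simp [hu, huv rfl]), Finset.card_insert_of_notMem hv]
      have hVε : (2 : ℝ) ≤ ε * V.card := by
        rw [← div_le_iff₀' hε]
        refine hE'.trans ?_
        exact_mod_cast (by omega : E' ≤ V.card)
      have hL : LPath G u v (insert u (insert v V)) := by
        refine hN₀ α G _ e hG (by omega) (by omega) (fun D hD hDc => ?_) u
          (Finset.mem_insert_self _ _) v (Finset.mem_insert_of_mem (Finset.mem_insert_self _ _))
          (huv rfl)
        have h3 := hdeg D hD hDc
        have h4 := hε' V.card 2 (Nat.cast_nonneg _) (by norm_num) hVε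
        rw [huc]
        calc _ = (β + κ / 2) * ((V.card : ℝ) + 2) ^ r := by push_cast; rfl
          _ ≤ (β + κ / 2 + κ / 2) * (V.card : ℝ) ^ r := h4
          _ = (β + 2 * κ - κ * (3 / 4) ^ 0) * (V.card : ℝ) ^ r := by ring
          _ ≤ _ := h3
          _ ≤ _ := Nat.cast_le.2 (Finset.card_le_card (lk_mono
              ((Finset.subset_insert _ _).trans (Finset.subset_insert _ _))))
      obtain ⟨F, hF⟩ := hL.isHP hk hG hu hv (huv rfl) hV
      refine spreadHP_of_isHP hF ?_
      have : V.card ≤ 2 * k * e₀ := by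
        calc V.card ≤ (k - 1) * e := by omega
          _ ≤ k * (e₀ * 2) := Nat.mul_le_mul (by omega) h2
          _ = _ := by ring
      have : (V.card : ℝ) ≤ K₀ := by rw [hK₀]; exact_mod_cast this
      rw [pow_zero]; linarith
    | succ j ih =>
      intro e V u v h1 h2 hu hv _ hV hdeg
      have hp1 : e₀ * 2 ^ (j + 1) = 2 * (e₀ * 2 ^ j) := by ring
      have hp2 : e₀ * 2 ^ (j + 1 + 1) = 4 * (e₀ * 2 ^ j) := by ring
      rw [hp1] at h1
      rw [hp2] at h2
      have hX : e₀ ≤ e₀ * 2 ^ j := Nat.le_mul_of_pos_right _ (by positivity)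
      obtain ⟨e₁, e₂, rfl, hl1, hl1', hl2, hl2'⟩ : ∃ e₁ e₂, e = e₁ + e₂ ∧ e₀ * 2 ^ j ≤ e₁ ∧
          e₁ ≤ e₀ * 2 ^ (j + 1) ∧ e₀ * 2 ^ j ≤ e₂ ∧ e₂ ≤ e₀ * 2 ^ (j + 1) :=
        ⟨e / 2, e - e / 2, by omega, by omega, by omega, by omega, by omega⟩
      have hge : ∀ e', e' ≤ (k - 1) * e' := fun e' => Nat.le_mul_of_pos_left e' (by omega)
      have hm : (k - 1) * e₁ - 1 + 1 = (k - 1) * e₁ := by have := hge e₁; omega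
      have hm' : (k - 1) * e₂ - 1 + 1 = (k - 1) * e₂ := by have := hge e₂; omega
      have hmX : e₀ * 2 ^ j ≤ 2 * ((k - 1) * e₁ - 1) := by have := hge e₁; omega
      have hmX' : e₀ * 2 ^ j ≤ 2 * ((k - 1) * e₂ - 1) := by have := hge e₂; omega
      have hVX : V.card + 2 ≤ 4 * k * (e₀ * 2 ^ j) := by
        have h3 : (k - 1) * (e₁ + e₂) ≤ (k - 1) * (4 * (e₀ * 2 ^ j)) := Nat.mul_le_mul_left _ h2
        have h4 : 4 * k * (e₀ * 2 ^ j) = (k - 1) * (4 * (e₀ * 2 ^ j)) + 4 * (e₀ * 2 ^ j) := by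
          obtain ⟨l, rfl⟩ := Nat.exists_eq_add_of_le' (show 1 ≤ k by omega)
          rw [Nat.add_sub_cancel]; ring
        omega
      set φ : ℝ := (1 / 2) ^ (j + 2) with hφ
      set η : ℝ := κ / (4 * r) * (3 / 4) ^ j with hη
      have hφ1 : φ ≤ 1 / 4 := by
        rw [hφ, pow_add]
        nlinarith [(hhalf j).2, (hhalf j).1]
      have hψ : ∀ m : ℕ, e₀ * 2 ^ j ≤ 2 * m → 2 * ((V.card + 2 : ℝ) ^ d * (V.card + 1) ^ (r + 1) *
          Real.exp (-(η ^ 2 * m / 2))) ≤ φ := by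
        intro m hm
        have hmr : (e₀ * 2 ^ j : ℝ) ≤ 2 * m := by exact_mod_cast hm
        have hexp : κ ^ 2 / (64 * r ^ 2) * e₀ * (9 / 8) ^ j ≤ η ^ 2 * m / 2 := by
          have h5 : η ^ 2 = κ ^ 2 / (16 * r ^ 2) * (9 / 16) ^ j := by
            rw [hη, mul_pow, ← pow_mul, mul_comm j 2, pow_mul]
            congr 1
            · field_simp; norm_num
            · norm_num
          have h6 : ((9 : ℝ) / 8) ^ j = (9 / 16) ^ j * 2 ^ j := by rw [← mul_pow]; norm_num
          calc κ ^ 2 / (64 * r ^ 2) * e₀ * (9 / 8) ^ j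
              = κ ^ 2 / (16 * r ^ 2) * (9 / 16) ^ j * (e₀ * 2 ^ j) / 4 := by
                rw [h6]; field_simp; norm_num
            _ ≤ κ ^ 2 / (16 * r ^ 2) * (9 / 16) ^ j * (2 * m) / 4 := by gcongr
            _ = _ := by rw [h5]; ring
        set X : ℝ := κ ^ 2 / (64 * r ^ 2) * e₀ * (9 / 8) ^ j with hX
        have hVr : (V.card + 2 : ℝ) ≤ 4 * k * e₀ * 2 ^ j := by
          rw [mul_assoc (4 * (k : ℝ))]; exact_mod_cast hVX
        have h7 : (V.card + 2 : ℝ) ^ d * (V.card + 1) ^ (r + 1) ≤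
            (4 * k * e₀ * 2 ^ j : ℝ) ^ (k + 1) := by
          calc _ ≤ (V.card + 2 : ℝ) ^ d * (V.card + 2) ^ (r + 1) := by gcongr; norm_num
            _ = (V.card + 2 : ℝ) ^ (k + 1) := by rw [← pow_add]; congr 1; omega
            _ ≤ _ := by gcongr
        have h8 := hE e₀ (by omega) j
        have h9 : Real.exp (-(η ^ 2 * m / 2)) ≤ (Real.exp X)⁻¹ := by
          rw [← Real.exp_neg]; exact Real.exp_le_exp.2 (by linarith)
        calc _ ≤ 2 * ((4 * k * e₀ * 2 ^ j : ℝ) ^ (k + 1) * (Real.exp X)⁻¹) := by gcongr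
          _ ≤ φ := by
            rw [← div_eq_mul_inv, ← mul_div_assoc, div_le_iff₀ (Real.exp_pos _)]
            have h10 : φ * (4 * 2 ^ j) = 1 := by
              rw [hφ, pow_add, one_div, inv_pow]; field_simp; norm_num
            have hφ0 : 0 < φ := by rw [hφ]; positivity
            calc 2 * (4 * k * e₀ * 2 ^ j : ℝ) ^ (k + 1)
                = φ * (4 * 2 ^ j) * (2 * (4 * k * e₀ * 2 ^ j : ℝ) ^ (k + 1)) := by
                  rw [h10, one_mul]
              _ = φ * (8 * 2 ^ j * (4 * k * e₀ * 2 ^ j : ℝ) ^ (k + 1)) := by ring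
              _ ≤ φ * Real.exp X := by gcongr
      have hKj : 1 ≤ K₀ * (2 - (1 / 2) ^ j) := by
        have := hhalf j
        nlinarith
      have hθ : β + 2 * κ - κ * (3 / 4) ^ (j + 1) - r * η = β + 2 * κ - κ * (3 / 4) ^ j := by
        rw [hη]; field_simp; ring
      have := SpreadHP.halve (d := d) (r := r) (φ := φ) (η := η)
        (θ := β + 2 * κ - κ * (3 / 4) ^ (j + 1)) hk hKj (by linarith) (by omega) (by omega)
        (by omega) (by omega) hm hm' (by rw [mul_add] at hV; omega) hu hv (by positivity) hdeg
        (hψ _ hmX) (hψ _ hmX') (fun e A x y he hx hy hxy hA hAdeg => by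
          rw [hθ] at hAdeg
          rcases he with rfl | rfl
          · exact ih _ A x y hl1 hl1' hx hy (fun _ => hxy) hA hAdeg
          · exact ih _ A x y hl2 hl2' hx hy (fun _ => hxy) hA hAdeg)
      refine this.mono (div_nonneg (by linarith) (by linarith)) ?_
      rw [div_le_iff₀ (by linarith), mul_assoc K₀]
      refine mul_le_mul_of_nonneg_left ?_ (by linarith)
      rw [hφ, pow_add, pow_add]
      nlinarith [(hhalf j).1, (hhalf j).2]
  intro e V u v he hu hv hV hdeg
  have hq2 : 2 ≤ e / e₀ := (Nat.le_div_iff_mul_le (by omega)).2 he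
  set j := Nat.log 2 (e / e₀) with hj
  have hj1 : 1 ≤ j := Nat.log_pos (by norm_num) hq2
  have h1 : 2 ^ j ≤ e / e₀ := Nat.pow_log_le_self 2 (by omega)
  have h2 : e / e₀ < 2 ^ (j + 1) := Nat.lt_pow_succ_log_self (by norm_num) _
  have h1' := (Nat.le_div_iff_mul_le (by omega)).1 h1
  have h2' := (Nat.div_lt_iff_lt_mul (by omega)).1 h2
  refine (key j e V u v (by linarith) (by linarith) hu hv (by omega) hV fun D hD hDc =>
    le_trans ?_ (hdeg D hD hDc)).mono ?_ ?_
  · have : (0 : ℝ) ≤ κ * (3 / 4) ^ j := by positivity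
    gcongr; linarith
  · exact mul_nonneg (by linarith) (by linarith [(hhalf j).2])
  · exact mul_le_mul_of_nonneg_left (by linarith [(hhalf j).1]) (by linarith)

theorem pow_le_exp_pow_mul_descFactorial (M : ℕ) : ∀ s ≤ M,
    (M : ℝ) ^ s ≤ Real.exp 1 ^ s * (M.descFactorial s : ℕ) := by
  induction M with
  | zero => intro s hs; obtain rfl := Nat.le_zero.1 hs; simp
  | succ M ih =>
    intro s hs
    rcases s with _ | s
    · simp
    have h := ih s (by omega)
    rw [Nat.succ_descFactorial_succ]
    push_cast
    rcases Nat.eq_zero_or_pos M with rfl | hM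
    · obtain rfl : s = 0 := by omega
      simp
    have hM' : (0 : ℝ) < M := by exact_mod_cast hM
    have h1 : ((M : ℝ) + 1) ^ s ≤ Real.exp 1 * (M : ℝ) ^ s := by
      have h2 : (M : ℝ) + 1 ≤ Real.exp (1 / M) * M := by
        have := Real.add_one_le_exp (1 / (M : ℝ))
        calc (M : ℝ) + 1 = (1 / M + 1) * M := by field_simp; ring
          _ ≤ _ := by gcongr
      calc ((M : ℝ) + 1) ^ s ≤ (Real.exp (1 / M) * M) ^ s := by gcongr
        _ = Real.exp (s * (1 / M)) * (M : ℝ) ^ s := by rw [mul_pow, ← Real.exp_nat_mul]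
        _ ≤ _ := by
          gcongr
          rw [mul_one_div, div_le_one hM']
          exact_mod_cast (by omega : s ≤ M)
    calc ((M : ℝ) + 1) ^ (s + 1) = (M + 1) * ((M : ℝ) + 1) ^ s := by ring
      _ ≤ (M + 1) * (Real.exp 1 * (Real.exp 1 ^ s * (M.descFactorial s : ℕ))) := by
          gcongr; exact h1.trans (by gcongr)
      _ = _ := by ring

variable {α : Type} [DecidableEq α]

theorem IsHP.isHC {G : Finset (Finset α)} {k e : ℕ} {V : Finset α} {u : α} {F : ℕ → α}
    (hk : 2 ≤ k) (hu : u ∈ V) (hV : V.card = (k - 1) * e) (h : IsHP G k e (V.erase u) u u F) :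
    IsHC G k V fun q => F (q % V.card) := by
  have hpos : 0 < V.card := Finset.card_pos.2 ⟨u, hu⟩
  have he : 0 < e := Nat.pos_of_ne_zero fun h => by rw [h, mul_zero] at hV; omega
  have hinj := h.injOn (by rw [Finset.card_erase_of_mem hu]; omega)
  have hmem : ∀ q, 0 < q → q < V.card → F q ∈ V.erase u := fun q h1 h2 =>
    h.mem (Finset.mem_Ioo.2 ⟨h1, hV ▸ h2⟩)
  have hinj' : Set.InjOn (fun q => F (q % V.card)) (Set.Iio V.card) := by
    intro x hx y hy hxy
    rw [Set.mem_Iio] at hx hy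
    simp only [Nat.mod_eq_of_lt hx, Nat.mod_eq_of_lt hy] at hxy
    rcases Nat.eq_zero_or_pos x with rfl | hx0 <;> rcases Nat.eq_zero_or_pos y with rfl | hy0
    · rfl
    · rw [h.zero] at hxy
      exact absurd (hxy ▸ hmem y hy0 hy) (by simp)
    · rw [h.zero] at hxy
      exact absurd (hxy ▸ hmem x hx0 hx) (by simp)
    · exact hinj (Finset.mem_coe.2 (Finset.mem_Ioo.2 ⟨hx0, hV ▸ hx⟩))
        (Finset.mem_coe.2 (Finset.mem_Ioo.2 ⟨hy0, hV ▸ hy⟩)) hxy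
  refine ⟨fun i => by simp only [Nat.add_mod_right], hinj', ?_, fun t => ?_⟩
  · refine Finset.eq_of_subset_of_card_le (Finset.image_subset_iff.2 fun q hq => ?_) ?_
    · rw [Finset.mem_range] at hq
      rw [Nat.mod_eq_of_lt hq]
      rcases Nat.eq_zero_or_pos q with rfl | hq0
      · rwa [h.zero]
      · exact Finset.mem_of_mem_erase (hmem q hq0 hq)
    · rw [Finset.card_image_of_injOn (by rwa [Finset.coe_range]), Finset.card_range]
  · have hlt := Nat.mod_lt t he
    rw [show blk (fun q => F (q % V.card)) k t = blk F k (t % e) from ?_]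
    · exact h.blk_mem _ hlt
    · ext z
      rw [mem_blk, mem_blk]
      refine exists_congr fun j => and_congr_right fun hj => ?_
      have h1 : t * (k - 1) + j = V.card * (t / e) + (t % e * (k - 1) + j) := by
        conv_lhs => rw [← Nat.div_add_mod t e]
        rw [hV]; ring
      have h2 : t % e * (k - 1) + j ≤ V.card := by
        calc t % e * (k - 1) + j ≤ t % e * (k - 1) + (k - 1) := by omega
          _ = (k - 1) * (t % e + 1) := by ring
          _ ≤ _ := by rw [hV]; exact Nat.mul_le_mul_left _ hlt
      rw [h1, Nat.mul_add_mod]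
      rcases h2.lt_or_eq with h3 | h3
      · rw [Nat.mod_eq_of_lt h3]
      · rw [h3, Nat.mod_self, h.zero, hV, h.last]

/-- Averaging over the starting vertex turns spread paths into spread Hamilton cycles. -/
theorem exists_spread_isHC {G : Finset (Finset α)} {k e : ℕ} {K : ℝ} {V : Finset α} (hk : 2 ≤ k)
    (hK : 1 ≤ K) (hV0 : V.Nonempty) (hV : V.card = (k - 1) * e)
    (h : ∀ u ∈ V, SpreadHP G k K e (V.erase u) u u) :
    ∃ (ι : Type) (_ : Fintype ι) (w : ι → ℝ) (F : ι → ℕ → α), (∀ i, 0 ≤ w i) ∧ ∑ i, w i = 1 ∧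
      (∀ i, IsHC G k V (F i)) ∧ ∀ s ⊆ Finset.range V.card, ∀ g : ℕ → α,
        (∑ i, if ∀ p ∈ s, F i p = g p then w i else 0) ≤
          (Real.exp 2 * K / V.card) ^ s.card := by
  have hn0 : 0 < V.card := Finset.card_pos.2 hV0
  have hn : (0 : ℝ) < V.card := by exact_mod_cast hn0
  choose ι fι w F hw hs hP hS using fun u : V => h u.1 u.2
  have hmass : (∑ x : Σ u : V, ι u, (V.card : ℝ)⁻¹ * w x.1 x.2) = 1 := by
    rw [Fintype.sum_sigma]
    simp only [← Finset.mul_sum, hs, mul_one]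
    rw [Finset.sum_const, Finset.card_univ, Fintype.card_coe, nsmul_eq_mul,
      mul_inv_cancel₀ hn.ne']
  refine ⟨Σ u : V, ι u, inferInstance, fun x => (V.card : ℝ)⁻¹ * w x.1 x.2,
    fun x q => F x.1 x.2 (q % V.card), fun x => mul_nonneg (inv_nonneg.2 hn.le) (hw _ _), hmass,
    fun x => (hP x.1 x.2).isHC hk x.1.2 hV, fun s hs g => ?_⟩
  rcases s.eq_empty_or_nonempty with rfl | hne
  · simpa using hmass.le
  set s' := s.erase 0 with hs'
  have hs'I : s' ⊆ Finset.Ioo 0 ((k - 1) * e) := fun q hq => by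
    rw [hs', Finset.mem_erase] at hq
    have := Finset.mem_range.1 (hs hq.2)
    rw [Finset.mem_Ioo]; omega
  have hs'c : s'.card + 1 ≤ V.card := by
    have := Finset.card_le_card hs'I
    rw [Nat.card_Ioo] at this; omega
  set D : ℝ := (((V.card - 1).descFactorial s'.card : ℕ) : ℝ) with hD
  have hDp : 0 < D := by
    rw [hD, Nat.cast_pos, Nat.descFactorial_pos]; omega
  have hDV : (V.card : ℝ) ^ (s'.card + 1) ≤ Real.exp 1 ^ (s'.card + 1) * (V.card * D) := by
    have := pow_le_exp_pow_mul_descFactorial V.card (s'.card + 1) hs'c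
    obtain ⟨N, hN⟩ := Nat.exists_eq_add_of_le' hn0
    rw [hD, hN, Nat.add_sub_cancel]
    rw [hN, Nat.succ_descFactorial_succ] at this
    push_cast at this ⊢
    exact this
  have hterm : ∀ u : V, (∑ i, if ∀ p ∈ s, F u i (p % V.card) = g p then
      (V.card : ℝ)⁻¹ * w u i else 0) ≤
      if 0 ∈ s → u.1 = g 0 then (V.card : ℝ)⁻¹ * (K ^ s'.card / D) else 0 := by
    intro u
    split_ifs with hc
    · have h1 := hS u s' hs'I g
      rw [Finset.card_erase_of_mem u.2, ← hD, ← le_div_iff₀ hDp] at h1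
      refine le_trans ?_ (mul_le_mul_of_nonneg_left h1 (inv_nonneg.2 hn.le))
      rw [Finset.mul_sum]
      refine Finset.sum_le_sum fun i _ => ?_
      by_cases h : ∀ p ∈ s, F u i (p % V.card) = g p
      · rw [if_pos h, if_pos fun p hp => ?_]
        rw [hs', Finset.mem_erase] at hp
        rw [← h p hp.2, Nat.mod_eq_of_lt (Finset.mem_range.1 (hs hp.2))]
      · rw [if_neg h]
        refine mul_nonneg (inv_nonneg.2 hn.le) ?_
        split_ifs
        · exact hw _ _
        · exact le_rfl
    · refine le_of_eq (Finset.sum_eq_zero fun i _ => if_neg fun h => hc fun h0 => ?_)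
      rw [← h 0 h0, Nat.zero_mod, (hP u i).zero]
  have hcount : ((Finset.univ.filter fun u : V => 0 ∈ s → u.1 = g 0).card : ℝ) *
      (V.card : ℝ) ^ s.card ≤ V.card ^ (s'.card + 1) := by
    by_cases h0 : 0 ∈ s
    · have h1 : s'.card + 1 = s.card := Finset.card_erase_add_one h0
      have h2 : (Finset.univ.filter fun u : V => 0 ∈ s → u.1 = g 0).card ≤ 1 := by
        rw [Finset.card_le_one]
        intro a ha b hb
        simp only [Finset.mem_filter, h0, true_implies] at ha hb
        exact Subtype.ext (ha.2.trans hb.2.symm)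
      rw [h1]
      exact mul_le_of_le_one_left (by positivity) (by exact_mod_cast h2)
    · have h1 : s' = s := Finset.erase_eq_of_notMem h0
      rw [h1, pow_succ']
      refine mul_le_mul_of_nonneg_right ?_ (by positivity)
      have := Finset.card_filter_le (Finset.univ : Finset V) fun u : V => 0 ∈ s → u.1 = g 0
      rw [Finset.card_univ, Fintype.card_coe] at this
      exact_mod_cast this
  have hsc : s'.card ≤ s.card ∧ s'.card + 1 ≤ 2 * s.card := by
    have h1 := Finset.card_erase_le (s := s) (a := 0)
    have h2 := Finset.card_pos.2 hne
    rw [← hs'] at h1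
    omega
  rw [Fintype.sum_sigma]
  refine le_trans (Finset.sum_le_sum fun u _ => hterm u) ?_
  rw [← Finset.sum_filter, Finset.sum_const, nsmul_eq_mul, div_pow, le_div_iff₀ (by positivity)]
  set N : ℝ := ((Finset.univ.filter fun u : V => 0 ∈ s → u.1 = g 0).card : ℝ) with hN
  calc N * ((V.card : ℝ)⁻¹ * (K ^ s'.card / D)) * (V.card : ℝ) ^ s.card
      = (N * (V.card : ℝ) ^ s.card) * (K ^ s'.card / (V.card * D)) := by field_simp
    _ ≤ (Real.exp 1 ^ (s'.card + 1) * (V.card * D)) * (K ^ s'.card / (V.card * D)) := by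
        refine mul_le_mul_of_nonneg_right (hcount.trans hDV) (by positivity)
    _ = Real.exp 1 ^ (s'.card + 1) * K ^ s'.card := by field_simp
    _ ≤ Real.exp 1 ^ (2 * s.card) * K ^ s.card := by
        have : (1 : ℝ) ≤ Real.exp 1 := Real.one_le_exp zero_le_one
        exact mul_le_mul (pow_le_pow_right₀ this hsc.2) (pow_le_pow_right₀ hK hsc.1)
          (by positivity) (by positivity)
    _ = (Real.exp 2 * K) ^ s.card := by
        rw [pow_mul, mul_pow, ← Real.exp_nat_mul]; norm_num

section EdgeSpread

variable {α : Type} [DecidableEq α] {G : Finset (Finset α)} {k e : ℕ} {V : Finset α} {F : ℕ → α}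

/-- The edge set of the loose cycle listed by `F`. -/
def cyc (F : ℕ → α) (k e : ℕ) : Finset (Finset α) := (Finset.range e).image (blk F k)

theorem mem_cyc {x : Finset α} : x ∈ cyc F k e ↔ ∃ t < e, blk F k t = x := by simp [cyc]

theorem IsHC.blk_add_period (h : IsHC G k V F) (hV : V.card = (k - 1) * e) (t : ℕ) :
    blk F k (t + e) = blk F k t := by
  rw [← blk_shift]
  congr 1
  ext i
  rw [mul_comm, ← hV, h.per]

/-- A proper subset of the edges of a loose cycle avoids the last edge, up to rotation. -/
theorem IsHC.exists_rotation (h : IsHC G k V F) (hV0 : 0 < V.card) (hV : V.card = (k - 1) * e)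
    {T : Finset (Finset α)} (hT : T ⊆ cyc F k e) {t₀ : ℕ} (ht₀ : t₀ < e)
    (hTt : blk F k t₀ ∉ T) :
    ∃ f, IsHC G k V f ∧ ∃ I ⊆ Finset.range (e - 1), I.card = T.card ∧ I.image (blk f k) = T := by
  refine ⟨_, h.rotate hV0 (t₀ + 1), ?_⟩
  have hsurj : Set.SurjOn (blk (fun i => F (i + (t₀ + 1) * (k - 1))) k)
      (Finset.range (e - 1)) (T : Set (Finset α)) := by
    intro x hx
    obtain ⟨s, hs, rfl⟩ := mem_cyc.1 (hT hx)
    have hne : s ≠ t₀ := fun h => hTt (h ▸ hx)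
    rcases Nat.lt_or_gt_of_ne hne with hlt | hgt
    · refine ⟨s + e - t₀ - 1, Finset.mem_coe.2 (Finset.mem_range.2 (by omega)), ?_⟩
      rw [blk_shift, show s + e - t₀ - 1 + (t₀ + 1) = s + e by omega, h.blk_add_period hV]
    · refine ⟨s - t₀ - 1, Finset.mem_coe.2 (Finset.mem_range.2 (by omega)), ?_⟩
      rw [blk_shift, show s - t₀ - 1 + (t₀ + 1) = s by omega]
  obtain ⟨I, hI, hinj, him⟩ := Finset.exists_subset_injOn_image_eq_of_surjOn _ _ hsurj
  refine ⟨I, Finset.coe_subset.1 hI, ?_, him⟩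
  rw [← him, Finset.card_image_of_injOn hinj]

/-- Positions occupied by the blocks in `I`. -/
def blkPos (k : ℕ) (I : Finset ℕ) : Finset ℕ :=
  (I ×ˢ Finset.range k).image fun x => x.1 * (k - 1) + x.2

/-- Positions in the blocks of `I` whose predecessor lies in the same block. -/
def blkTail (k : ℕ) (I : Finset ℕ) : Finset ℕ :=
  (I ×ˢ Finset.range (k - 1)).image fun x => x.1 * (k - 1) + x.2 + 1

theorem mem_blkPos {I : Finset ℕ} {p : ℕ} :
    p ∈ blkPos k I ↔ ∃ t ∈ I, ∃ j < k, t * (k - 1) + j = p := by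
  simp only [blkPos, Finset.mem_image, Finset.mem_product, Finset.mem_range, Prod.exists]
  exact ⟨fun ⟨t, j, ⟨h1, h2⟩, h3⟩ => ⟨t, h1, j, h2, h3⟩,
    fun ⟨t, h1, j, h2, h3⟩ => ⟨t, j, ⟨h1, h2⟩, h3⟩⟩

theorem mem_blkTail {I : Finset ℕ} {p : ℕ} :
    p ∈ blkTail k I ↔ ∃ t ∈ I, ∃ j < k - 1, t * (k - 1) + j + 1 = p := by
  simp only [blkTail, Finset.mem_image, Finset.mem_product, Finset.mem_range, Prod.exists]
  exact ⟨fun ⟨t, j, ⟨h1, h2⟩, h3⟩ => ⟨t, h1, j, h2, h3⟩,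
    fun ⟨t, h1, j, h2, h3⟩ => ⟨t, j, ⟨h1, h2⟩, h3⟩⟩

theorem blkTail_subset (I : Finset ℕ) : blkTail k I ⊆ blkPos k I := fun p hp => by
  obtain ⟨t, ht, j, hj, rfl⟩ := mem_blkTail.1 hp
  exact mem_blkPos.2 ⟨t, ht, j + 1, by omega, rfl⟩

theorem card_blkPos_le (I : Finset ℕ) : (blkPos k I).card ≤ k * I.card := by
  refine Finset.card_image_le.trans ?_
  rw [Finset.card_product, Finset.card_range, mul_comm]

theorem card_blkTail (I : Finset ℕ) : (blkTail k I).card = (k - 1) * I.card := by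
  rw [blkTail, Finset.card_image_of_injOn, Finset.card_product, Finset.card_range, mul_comm]
  rintro ⟨t, j⟩ h ⟨t', j'⟩ h' heq
  rw [Finset.mem_coe, Finset.mem_product, Finset.mem_range] at h h'
  have h1 : j < k - 1 := h.2
  have h2 : j' < k - 1 := h'.2
  have heq : t * (k - 1) + j + 1 = t' * (k - 1) + j' + 1 := heq
  have h3 : j + (k - 1) * t = j' + (k - 1) * t' := by
    rw [mul_comm (k - 1), mul_comm (k - 1)]; omega
  have h4 := congrArg (· / (k - 1)) h3
  simp only [Nat.add_mul_div_left _ _ (by omega : 0 < k - 1), Nat.div_eq_of_lt h1,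
    Nat.div_eq_of_lt h2, zero_add] at h4
  subst h4
  rw [Prod.mk.injEq]
  exact ⟨rfl, by omega⟩

theorem blkPos_subset (hk : 2 ≤ k) {I : Finset ℕ} (hI : I ⊆ Finset.range (e - 1)) :
    blkPos k I ⊆ Finset.range ((k - 1) * e) := fun p hp => by
  obtain ⟨t, ht, j, hj, rfl⟩ := mem_blkPos.1 hp
  have h1 := Finset.mem_range.1 (hI ht)
  rw [Finset.mem_range]
  calc t * (k - 1) + j < t * (k - 1) + (k - 1) + (k - 1) := by omega
    _ = (k - 1) * (t + 2) := by ring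
    _ ≤ _ := Nat.mul_le_mul_left _ (by omega)

open Classical in
/-- A small family of position assignments captures all loose cycles through prescribed edges. -/
theorem exists_assignments (hk : 2 ≤ k) (he : 1 ≤ e) (hV : V.card = (k - 1) * e) {f : ℕ → α}
    (hf : ∀ p, f p ∈ V) (I : Finset ℕ) (m : ℕ) :
    ∃ 𝒜 : Finset (ℕ → ℕ), 𝒜.card ≤ V.card ^ ((Finset.range m).filter (· ∈ blkPos k I \ blkTail k I)).card *
        (2 * k) ^ ((Finset.range m).filter (· ∈ blkTail k I)).card ∧
      ∀ F, IsHC G k V F → (∀ t ∈ I, blk f k t ∈ cyc F k e) →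
        ∃ a ∈ 𝒜, ∀ p ∈ blkPos k I, p < m → a p < V.card ∧ F (a p) = f p := by
  have hle : k - 1 ≤ V.card := by rw [hV]; exact Nat.le_mul_of_pos_right _ he
  have hV0 : 0 < V.card := by omega
  induction m with
  | zero => exact ⟨{fun _ => 0}, by simp, fun F _ _ => ⟨_, Finset.mem_singleton_self _, by simp⟩⟩
  | succ m ih =>
    obtain ⟨𝒜, hc, hA⟩ := ih
    rw [Finset.range_add_one, Finset.filter_insert, Finset.filter_insert]
    have hext : ∀ (a : ℕ → ℕ) (x : ℕ) (F : ℕ → α),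
        (∀ p ∈ blkPos k I, p < m → a p < V.card ∧ F (a p) = f p) →
        (x < V.card ∧ F x = f m) → ∀ p ∈ blkPos k I, p < m + 1 →
          Function.update a m x p < V.card ∧ F (Function.update a m x p) = f p := by
      intro a x F ha hx p hp hpm
      by_cases hpm' : p = m
      · subst hpm'; rwa [Function.update_self]
      · rw [Function.update_of_ne hpm']
        exact ha p hp (by omega)
    by_cases hroot : m ∈ blkPos k I \ blkTail k I
    · have hnt : m ∉ blkTail k I := (Finset.mem_sdiff.1 hroot).2
      rw [if_pos hroot, if_neg hnt, Finset.card_insert_of_notMem (by simp)]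
      refine ⟨(𝒜 ×ˢ Finset.range V.card).image fun x => Function.update x.1 m x.2, ?_, ?_⟩
      · refine Finset.card_image_le.trans ?_
        rw [Finset.card_product, Finset.card_range, pow_succ, mul_right_comm]
        exact Nat.mul_le_mul_right _ hc
      · intro F hF hFI
        obtain ⟨a, ha, ha'⟩ := hA F hF hFI
        obtain ⟨x, hx, hxe⟩ := hF.exists_lt (hf m)
        exact ⟨_, Finset.mem_image_of_mem _ (Finset.mk_mem_product ha
          (Finset.mem_range.2 hx)), hext a x F ha' ⟨hx, hxe⟩⟩
    by_cases htail : m ∈ blkTail k I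
    · rw [if_neg hroot, if_pos htail, Finset.card_insert_of_notMem (by simp)]
      refine ⟨(𝒜 ×ˢ Finset.range (2 * k)).image fun x =>
        Function.update x.1 m ((x.1 (m - 1) + x.2 + (V.card - (k - 1))) % V.card), ?_, ?_⟩
      · refine Finset.card_image_le.trans ?_
        rw [Finset.card_product, Finset.card_range]
        exact (Nat.mul_le_mul_right _ hc).trans (le_of_eq (by ring))
      · intro F hF hFI
        obtain ⟨a, ha, ha'⟩ := hA F hF hFI
        obtain ⟨t, ht, j, hj, rfl⟩ := mem_blkTail.1 htail
        obtain ⟨h1, h2⟩ := ha' (t * (k - 1) + j) (mem_blkPos.2 ⟨t, ht, j, by omega, rfl⟩)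
          (by omega)
        obtain ⟨t', -, hb⟩ := mem_cyc.1 (hFI t ht)
        obtain ⟨j₁, hj₁, he₁⟩ := mem_blk.1
          (hb ▸ mem_blk.2 ⟨j, by omega, rfl⟩ : f (t * (k - 1) + j) ∈ blk F k t')
        obtain ⟨j₂, hj₂, he₂⟩ := mem_blk.1
          (hb ▸ mem_blk.2 ⟨j + 1, by omega, rfl⟩ : f (t * (k - 1) + (j + 1)) ∈ blk F k t')
        have h3 : a (t * (k - 1) + j) ≡ t' * (k - 1) + j₁ [MOD V.card] :=
          (hF.eq_iff hV0).1 (h2.trans he₁.symm)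
        refine ⟨_, Finset.mem_image_of_mem _ (Finset.mk_mem_product ha
          (Finset.mem_range.2 (by omega : j₂ + (k - 1) - j₁ < 2 * k))), hext a _ F ha' ⟨Nat.mod_lt _ hV0, ?_⟩⟩
        rw [hF.apply_mod, add_assoc (t * (k - 1)), ← he₂, hF.eq_iff hV0]
        have h4 := h3.add_right (j₂ + (k - 1) - j₁ + (V.card - (k - 1)))
        rw [show t' * (k - 1) + j₁ + (j₂ + (k - 1) - j₁ + (V.card - (k - 1))) =
          t' * (k - 1) + j₂ + V.card by omega] at h4
        have h5 : t' * (k - 1) + j₂ + V.card ≡ t' * (k - 1) + j₂ [MOD V.card] := by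
          simp [Nat.ModEq]
        rw [show t * (k - 1) + (j + 1) - 1 = t * (k - 1) + j by omega]
        rw [add_assoc (a _)]
        exact h4.trans h5
    · rw [if_neg hroot, if_neg htail]
      refine ⟨𝒜, hc, fun F hF hFI => ?_⟩
      obtain ⟨a, ha, ha'⟩ := hA F hF hFI
      refine ⟨a, ha, fun p hp hpm => ha' p hp (lt_of_le_of_ne (by omega) ?_)⟩
      rintro rfl
      exact hroot (Finset.mem_sdiff.2 ⟨hp, htail⟩)

open Classical in
theorem IsHC.sum_filter_image_blk_subset_le {ι : Type} [Fintype ι] {w : ι → ℝ} {K : ℝ}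
    {F : ι → ℕ → α} {f : ℕ → α} {I : Finset ℕ} (hk : 2 ≤ k) (he : 1 ≤ e)
    (hV : V.card = (k - 1) * e) (hK : 1 ≤ K) (hw : ∀ i, 0 ≤ w i) (hF : ∀ i, IsHC G k V (F i))
    (hsp : ∀ s ⊆ Finset.range V.card, ∀ g : ℕ → α,
      (∑ i, if ∀ p ∈ s, F i p = g p then w i else 0) ≤ (K / V.card) ^ s.card)
    (hf : IsHC G k V f) (hI : I ⊆ Finset.range (e - 1)) :
    ∑ i with I.image (blk f k) ⊆ cyc (F i) k e, w i ≤
      (K ^ k * (2 * k) ^ (k - 1) / (V.card : ℝ) ^ (k - 1)) ^ I.card := by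
  have hV0 : 0 < V.card := by rw [hV]; exact Nat.mul_pos (by omega) he
  have hn : (0 : ℝ) < V.card := by exact_mod_cast hV0
  have hP := blkPos_subset hk hI
  rw [← hV] at hP
  have hfil : ∀ X ⊆ blkPos k I, (Finset.range V.card).filter (· ∈ X) = X := fun X hX => by
    ext p
    rw [Finset.mem_filter]
    exact ⟨And.right, fun h => ⟨hP (hX h), h⟩⟩
  obtain ⟨𝒜, hc, hA⟩ := exists_assignments (G := G) hk he hV (fun p => hf.mem hV0 p) I V.card
  rw [hfil _ Finset.sdiff_subset, hfil _ (blkTail_subset I)] at hc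
  have hone : ∀ a ∈ 𝒜,
      (∑ i, if ∀ p ∈ blkPos k I, a p < V.card ∧ F i (a p) = f p then w i else 0) ≤
        (K / V.card) ^ (blkPos k I).card := by
    intro a _
    by_cases hex : ∃ i₁, ∀ p ∈ blkPos k I, a p < V.card ∧ F i₁ (a p) = f p
    · obtain ⟨i₁, h₁⟩ := hex
      have hinj : Set.InjOn a (blkPos k I) := fun p hp q hq hpq =>
        hf.eq_of_lt (Finset.mem_range.1 (hP hp)) (Finset.mem_range.1 (hP hq)) (by
          rw [← (h₁ p hp).2, ← (h₁ q hq).2, hpq])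
      have h2 := hsp ((blkPos k I).image a) (fun q hq => by
        obtain ⟨p, hp, rfl⟩ := Finset.mem_image.1 hq
        exact Finset.mem_range.2 (h₁ p hp).1) (F i₁)
      rw [Finset.card_image_of_injOn hinj] at h2
      refine le_trans (Finset.sum_le_sum fun i _ => ?_) h2
      split_ifs with h3 h4 h4
      · exact le_rfl
      · refine absurd (fun q hq => ?_) h4
        obtain ⟨p, hp, rfl⟩ := Finset.mem_image.1 hq
        rw [(h3 p hp).2, (h₁ p hp).2]
      · exact hw i
      · exact le_rfl
    · rw [Finset.sum_eq_zero fun i _ => if_neg fun h => hex ⟨i, h⟩]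
      positivity
  have hunion : ∑ i with I.image (blk f k) ⊆ cyc (F i) k e, w i ≤ ∑ a ∈ 𝒜,
      ∑ i, if ∀ p ∈ blkPos k I, a p < V.card ∧ F i (a p) = f p then w i else 0 := by
    rw [Finset.sum_comm, Finset.sum_filter]
    refine Finset.sum_le_sum fun i _ => ?_
    split_ifs with h
    · obtain ⟨a, ha, ha'⟩ := hA (F i) (hF i) fun t ht => h (Finset.mem_image_of_mem _ ht)
      refine le_trans (le_of_eq ?_) (Finset.single_le_sum (fun a _ => ?_) ha)
      · exact (if_pos fun p hp => ha' p hp (Finset.mem_range.1 (hP hp))).symm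
      · split_ifs
        · exact hw i
        · exact le_rfl
    · exact Finset.sum_nonneg fun a _ => by split_ifs; exacts [hw i, le_rfl]
  refine hunion.trans ((Finset.sum_le_sum hone).trans ?_)
  rw [Finset.sum_const, nsmul_eq_mul]
  have hcR : (𝒜.card : ℝ) ≤ (V.card : ℝ) ^ (blkPos k I \ blkTail k I).card *
      (2 * k) ^ (blkTail k I).card := by exact_mod_cast hc
  have hsplit : (blkPos k I).card = (blkPos k I \ blkTail k I).card + (blkTail k I).card :=
    (Finset.card_sdiff_add_card_eq_card (blkTail_subset I)).symm
  calc (𝒜.card : ℝ) * (K / V.card) ^ (blkPos k I).card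
      ≤ (V.card : ℝ) ^ (blkPos k I \ blkTail k I).card * (2 * k) ^ (blkTail k I).card *
          (K / V.card) ^ (blkPos k I).card := by gcongr
    _ = K ^ (blkPos k I).card * ((2 * k) ^ (blkTail k I).card / (V.card : ℝ) ^ (blkTail k I).card) := by
        rw [div_pow, hsplit, pow_add (V.card : ℝ)]
        field_simp
    _ ≤ K ^ (k * I.card) * ((2 * k) ^ (blkTail k I).card / (V.card : ℝ) ^ (blkTail k I).card) := by
        gcongr
        exact card_blkPos_le I
    _ = _ := by
        rw [card_blkTail, div_pow, mul_pow, pow_mul, pow_mul, pow_mul]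
        ring

theorem IsHC.card_le_mul_card_cyc (h : IsHC G k V F) (hk : 2 ≤ k) (hV : V.card = (k - 1) * e) :
    V.card ≤ (cyc F k e).card * k := by
  have hsub : V ⊆ (cyc F k e).biUnion id := fun x hx => by
    obtain ⟨p, hp, rfl⟩ := h.exists_lt hx
    have h1 : p / (k - 1) < e := Nat.div_lt_of_lt_mul (hV ▸ hp)
    refine Finset.mem_biUnion.2 ⟨_, mem_cyc.2 ⟨_, h1, rfl⟩, mem_blk.2 ⟨p % (k - 1), ?_, ?_⟩⟩
    · exact (Nat.mod_lt _ (by omega)).trans (by omega)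
    · rw [mul_comm, Nat.div_add_mod]
  refine (Finset.card_le_card hsub).trans (Finset.card_biUnion_le_card_mul _ _ _ fun x hx => ?_)
  obtain ⟨t, -, rfl⟩ := mem_cyc.1 hx
  exact Finset.card_image_le.trans (Finset.card_range k).le

/-- Vertex-spreadness of a random loose cycle transfers to its edge set. -/
theorem isSpread_cyc {ι : Type} [Fintype ι] {w : ι → ℝ} {K : ℝ}
    {F : ι → ℕ → α} (hk : 2 ≤ k) (he : 1 ≤ e)
    (hV : V.card = (k - 1) * e) (hK : 1 ≤ K) (hw : ∀ i, 0 ≤ w i) (hF : ∀ i, IsHC G k V (F i))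
    (hsp : ∀ s ⊆ Finset.range V.card, ∀ g : ℕ → α,
      (∑ i, if ∀ p ∈ s, F i p = g p then w i else 0) ≤ (K / V.card) ^ s.card) :
    IsSpread w (K ^ k * (2 * k) ^ (k - 1) * 2 ^ (k * (k - 1)) / (V.card : ℝ) ^ (k - 1))
      Finset.univ (fun i => cyc (F i) k e) := by
  intro T
  have hV0 : 0 < V.card := by rw [hV]; exact Nat.mul_pos (by omega) he
  have hN : (0 : ℝ) < (V.card : ℝ) ^ (k - 1) := by positivity
  have hB : 1 ≤ K ^ k * (2 * k : ℝ) ^ (k - 1) := by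
    have : (1 : ℝ) ≤ 2 * k := by
      have : (2 : ℝ) ≤ k := by exact_mod_cast hk
      linarith
    exact one_le_mul_of_one_le_of_one_le (one_le_pow₀ hK) (one_le_pow₀ this)
  set B : ℝ := K ^ k * (2 * k : ℝ) ^ (k - 1) with hBdef
  set N : ℝ := (V.card : ℝ) ^ (k - 1) with hNdef
  set D : ℝ := 2 ^ (k * (k - 1)) with hDdef
  have hD : 1 ≤ D := one_le_pow₀ one_le_two
  have hB0 : 0 < B := by linarith
  by_cases hex : ∃ i₀, T ⊆ cyc (F i₀) k e
  swap
  · rw [Finset.filter_false_of_mem fun i _ hi => hex ⟨i, hi⟩, Finset.sum_empty]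
    positivity
  obtain ⟨i₀, hT⟩ := hex
  have key : ∀ T' ⊆ cyc (F i₀) k e, (∃ t₀ < e, blk (F i₀) k t₀ ∉ T') →
      ∑ i with T' ⊆ cyc (F i) k e, w i ≤ (B / N) ^ T'.card := by
    rintro T' hT' ⟨t₀, ht₀, hnot⟩
    obtain ⟨f, hf, I, hI, hcard, rfl⟩ := (hF i₀).exists_rotation hV0 hV hT' ht₀ hnot
    rw [← hcard]
    exact IsHC.sum_filter_image_blk_subset_le hk he hV hK hw hF hsp hf hI
  by_cases hall : ∃ t₀ < e, blk (F i₀) k t₀ ∉ T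
  · refine (key T hT hall).trans (pow_le_pow_left₀ (by positivity) ?_ _)
    rw [mul_div_right_comm B D N]
    exact le_mul_of_one_le_right (by positivity) hD
  · push Not at hall
    have hTeq : T = cyc (F i₀) k e := hT.antisymm fun x hx => by
      obtain ⟨t, ht, rfl⟩ := mem_cyc.1 hx
      exact hall t ht
    have h0 : blk (F i₀) k 0 ∈ T := hall 0 he
    have h1 := key (T.erase (blk (F i₀) k 0)) ((Finset.erase_subset _ _).trans hT)
      ⟨0, he, Finset.notMem_erase _ _⟩
    have hle : ∑ i with T ⊆ cyc (F i) k e, w i ≤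
        ∑ i with T.erase (blk (F i₀) k 0) ⊆ cyc (F i) k e, w i :=
      Finset.sum_le_sum_of_subset_of_nonneg
        (Finset.monotone_filter_right _ fun i _ hi => (Finset.erase_subset _ _).trans hi)
        fun i _ _ => hw i
    refine hle.trans (h1.trans ?_)
    obtain ⟨q, hq⟩ : ∃ q, T.card = q + 1 :=
      ⟨T.card - 1, by have := Finset.card_pos.2 ⟨_, h0⟩; omega⟩
    rw [Finset.card_erase_of_mem h0, hq, Nat.add_sub_cancel]
    have hn : V.card ≤ (q + 1) * k := by
      rw [← hq, hTeq]
      exact (hF i₀).card_le_mul_card_cyc hk hV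
    have hND : N ≤ D ^ (q + 1) := by
      have h2 : (V.card : ℝ) ≤ 2 ^ ((q + 1) * k) := by
        exact_mod_cast hn.trans (Nat.lt_two_pow_self).le
      calc N ≤ (2 ^ ((q + 1) * k)) ^ (k - 1) := pow_le_pow_left₀ (by positivity) h2 _
        _ = D ^ (q + 1) := by rw [hDdef, ← pow_mul, ← pow_mul]; congr 1; ring
    calc (B / N) ^ q = (B / N) ^ (q + 1) * (N / B) := by rw [pow_succ]; field_simp
      _ ≤ (B / N) ^ (q + 1) * D ^ (q + 1) := by
          gcongr
          exact (div_le_self hN.le hB).trans hND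
      _ = (B * D / N) ^ (q + 1) := by rw [← mul_pow]; congr 1; ring

end EdgeSpread

theorem IsHC.hasHamLCycle {k n e : ℕ} {G E : Finset (Finset (Fin n))} {F : ℕ → Fin n}
    (h : IsHC G k Finset.univ F) (hn : n = (k - 1) * e) (he : 1 ≤ e) (hE : cyc F k e ⊆ E) :
    HasHamLCycle k 1 n E := by
  have hcard : (Finset.univ : Finset (Fin n)).card = n := by simp
  have hV : (Finset.univ : Finset (Fin n)).card = (k - 1) * e := by rw [hcard, hn]
  refine ⟨F, fun i => by simpa only [hcard] using h.per i, by simpa only [hcard] using h.inj,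
    fun v => by simpa only [hcard] using h.exists_lt (Finset.mem_univ v), fun t => ?_⟩
  have hper : ∀ s r, blk F k (r + e * s) = blk F k r := fun s r => by
    induction s with
    | zero => rfl
    | succ s ih => rw [Nat.mul_succ, ← add_assoc, h.blk_add_period hV, ih]
  have hmem : blk F k t ∈ E := by
    rw [← Nat.mod_add_div t e, hper]
    exact hE (mem_cyc.2 ⟨_, Nat.mod_lt _ he, rfl⟩)
  convert hmem using 1
  ext x
  rw [mem_blk, Finset.mem_image]
  exact ⟨fun ⟨j, _, hj⟩ => ⟨j, j.2, hj⟩, fun ⟨j, hj, hx⟩ => ⟨⟨j, hj⟩, Finset.mem_univ _, hx⟩⟩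

theorem natLog_two_add_one_le {n : ℕ} (hn : 3 ≤ n) :
    ((Nat.log 2 n + 1 : ℕ) : ℝ) ≤ 3 * Real.log n := by
  have h3 : (3 : ℝ) ≤ n := by exact_mod_cast hn
  have h1 : 1 ≤ Real.log n := by
    rw [Real.le_log_iff_exp_le (by linarith)]
    exact Real.exp_one_lt_three.le.trans h3
  have h2 : (Nat.log 2 n : ℝ) * Real.log 2 ≤ Real.log n := by
    rw [← Real.log_pow]
    refine Real.log_le_log (by positivity) ?_
    exact_mod_cast Nat.pow_log_le_self 2 (by omega)
  have h4 := Real.log_two_gt_d9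
  push_cast
  nlinarith [(Nat.cast_nonneg (Nat.log 2 n) : (0 : ℝ) ≤ _)]

theorem sixteen_div_add_one_div_sqrt_le {ε m : ℝ} (hε : 0 < ε) (hm1 : 1 ≤ m)
    (hm : (17 / ε) ^ 2 ≤ m) : 16 / m + 1 / √m ≤ ε := by
  have h1 : 17 / ε ≤ √m := Real.le_sqrt_of_sq_le hm
  have h2 : 1 ≤ √m := Real.one_le_sqrt.2 hm1
  have h3 : √m * √m = m := Real.mul_self_sqrt (by linarith)
  have h4 : 16 / m ≤ 16 / √m := by
    gcongr
    nlinarith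
  calc 16 / m + 1 / √m ≤ 16 / √m + 1 / √m := by gcongr
    _ = 17 / √m := by ring
    _ ≤ ε := by
      rw [div_le_iff₀ (by linarith)]
      rw [div_le_iff₀ hε] at h1
      linarith

/-- Dense hypergraphs carry a probability distribution on loose Hamilton cycles whose edge sets
are `O(n^{1-k})`-spread. -/
theorem exists_spread_cyc {k d : ℕ} (hk : 2 ≤ k) (hd1 : 1 ≤ d) (hdk : d ≤ k - 1) {μ : ℝ}
    (hμ : 0 < μ) : ∃ C : ℝ, 0 < C ∧ ∃ n₀ : ℕ, ∀ n, n₀ ≤ n → ∀ e, n = (k - 1) * e →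
      ∀ G : Finset (Finset (Fin n)), IsHG k n G →
        MinDegGE G d ((looseHamThreshold k d + μ) * (((n - d).choose (k - d) : ℕ) : ℝ)) →
        ∃ (ι : Type) (_ : Fintype ι) (w : ι → ℝ) (F : ι → ℕ → Fin n), (∀ i, 0 ≤ w i) ∧
          ∑ i, w i = 1 ∧ (∀ i, IsHC G k Finset.univ (F i)) ∧
          IsSpread w (C / (n : ℝ) ^ (k - 1)) Finset.univ (fun i => cyc (F i) k e) := by
  obtain ⟨β, κ, hβ, hκ, ⟨n₂, hBB⟩, n₁, hdeg⟩ := exists_hamBB hdk hμ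
  obtain ⟨e₀, K, he₀, hK, hHP⟩ := hBB.spreadHP hk hd1 hdk hβ (half_pos hκ)
  have hK' : 1 ≤ Real.exp 2 * K :=
    one_le_mul_of_one_le_of_one_le (Real.one_le_exp zero_le_two) hK
  refine ⟨(Real.exp 2 * K) ^ k * (2 * k) ^ (k - 1) * 2 ^ (k * (k - 1)), by positivity,
    max (max n₁ ⌈1 / κ⌉₊) ((k - 1) * (2 * e₀)), fun n hn e hne G hG hGd => ?_⟩
  rw [max_le_iff, max_le_iff] at hn
  obtain ⟨⟨hn1, hn2⟩, hn3⟩ := hn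
  have he : 2 * e₀ ≤ e := Nat.le_of_mul_le_mul_left (hne ▸ hn3) (by omega)
  have hcard : (Finset.univ : Finset (Fin n)).card = n := by simp
  have hV : (Finset.univ : Finset (Fin n)).card = (k - 1) * e := by rw [hcard, hne]
  have hn0 : 0 < n := by rw [hne]; exact Nat.mul_pos (by omega) (by omega)
  have hκn : 1 ≤ κ * n := by
    have h := Nat.ceil_le.1 hn2
    rwa [div_le_iff₀ hκ, mul_comm] at h
  have hspread : ∀ u ∈ (Finset.univ : Finset (Fin n)),
      SpreadHP G k K e (Finset.univ.erase u) u u := fun u _ => by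
    refine hHP (Fin n) G hG e _ u u he (Finset.notMem_erase _ _) (Finset.notMem_erase _ _) ?_ ?_
    · rw [Finset.card_erase_add_one (Finset.mem_univ u), hV]
    · have h := le_card_lk_sdiff (G := G) (d := d) (V := Finset.univ) (β := β) (κ := 2 * κ)
        (r := k - d) hβ (by linarith) (by omega) (Y := Finset.univ) (Z := {u})
        (by rw [hcard, Finset.card_singleton]; push_cast; linarith)
        (fun D _ hD => by rw [hcard]; exact hdeg n hn1 G hG hGd D hD)
      rw [Finset.sdiff_singleton_eq_erase] at h
      intro D _ hD
      refine le_trans (le_of_eq ?_) (h D (Finset.subset_univ _) hD)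
      ring
  obtain ⟨ι, _, w, F, hw, hw1, hF, hsp⟩ :=
    exists_spread_isHC hk hK ⟨⟨0, hn0⟩, Finset.mem_univ _⟩ hV hspread
  refine ⟨ι, inferInstance, w, F, hw, hw1, hF, ?_⟩
  have h := isSpread_cyc hk (by omega) hV hK' hw hF hsp
  rwa [hcard] at h

end LooseHam

/-- **Loose Hamiltonicity.**  For every `k ≥ 2`, `1 ≤ d ≤ k-1` and `μ > 0`,
there is `C > 0` such that: if `p ≥ C n^{-k+1} log n`, `(k-1) ∣ n` and `G` is
an `n`-vertex `k`-graph with `δ_d(G) ≥ (th_d(ham_{k,1}) + μ)·C(n-d, k-d)`,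
then `G_p` contains a loose Hamilton cycle with high probability. -/
theorem loose_hamilton_cycles
    (k d : ℕ) (hk : 2 ≤ k) (hd1 : 1 ≤ d) (hdk : d ≤ k - 1) (μ : ℝ) (hμ : 0 < μ) :
    ∃ C : ℝ, 0 < C ∧
      ∀ ε : ℝ, 0 < ε → ∃ n₀ : ℕ, ∀ n, n₀ ≤ n → (k - 1) ∣ n →
        ∀ G : Finset (Finset (Fin n)), IsHG k n G →
          MinDegGE G d
            ((looseHamThreshold k d + μ) * (((n - d).choose (k - d) : ℕ) : ℝ)) →
          ∀ p : ℝ, 0 ≤ p → p ≤ 1 →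
            C * (n : ℝ) ^ (-(k : ℝ) + 1) * Real.log n ≤ p →
            1 - ε ≤ sparsProb G p (fun E => HasHamLCycle k 1 n E) := by
  obtain ⟨C, hC, n₁, hspread⟩ := LooseHam.exists_spread_cyc hk hd1 hdk hμ
  refine ⟨1025 * 3 * C, by positivity, fun ε hε =>
    ⟨max (max n₁ 8) (2 ^ ⌈(17 / ε) ^ 2⌉₊), fun n hn hdvd G hG hdeg p _ hp1 hp => ?_⟩⟩
  rw [max_le_iff, max_le_iff] at hn
  obtain ⟨⟨hn1, hn2⟩, hn3⟩ := hn
  obtain ⟨e, hne⟩ := hdvd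
  have he : 1 ≤ e := Nat.pos_of_ne_zero fun h => by rw [h, mul_zero] at hne; omega
  obtain ⟨ι, _, w, F, hw, hw1, hF, hsp⟩ := hspread n hn1 e hne G hG hdeg
  have hnpos : (0 : ℝ) < n := by exact_mod_cast (by omega : 0 < n)
  set m := Nat.log 2 n + 1 with hm
  have hm4 : 4 ≤ m := by
    have := Nat.le_log_of_pow_le (b := 2) (x := 3) (y := n) (by norm_num) (by omega)
    omega
  have hmε : (17 / ε) ^ 2 ≤ m := by
    have h := Nat.le_log_of_pow_le (by norm_num) hn3
    exact (Nat.le_ceil _).trans (by exact_mod_cast h.trans (Nat.le_succ _))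
  have hpow : (n : ℝ) ^ (-(k : ℝ) + 1) = ((n : ℝ) ^ (k - 1))⁻¹ := by
    rw [← Real.rpow_natCast, ← Real.rpow_neg hnpos.le, Nat.cast_sub (by omega)]
    congr 1
    push_cast
    ring
  have hmp : 1025 * (m : ℝ) * (C / (n : ℝ) ^ (k - 1)) ≤ p := by
    refine le_trans ?_ hp
    calc 1025 * (m : ℝ) * (C / (n : ℝ) ^ (k - 1))
        ≤ 1025 * (3 * Real.log n) * (C / (n : ℝ) ^ (k - 1)) := by
          gcongr
          exact LooseHam.natLog_two_add_one_le (by omega)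
      _ = _ := by rw [hpow]; ring
  have hmain := LooseHam.one_sub_le_sparsProb_of_isSpread hw hw1 (by positivity) hp1 hsp
    (X := G) (fun i x hx => by
      obtain ⟨t, -, rfl⟩ := LooseHam.mem_cyc.1 hx
      exact (hF i).blk_mem t)
    (l := n) (fun i => by
      refine Finset.card_image_le.trans ((Finset.card_range e).le.trans ?_)
      rw [hne]
      exact Nat.le_mul_of_pos_left _ (by omega)) hm4
    (Nat.lt_pow_succ_log_self (by norm_num) n).le hmp
    (Q := fun E => HasHamLCycle k 1 n E)
    (fun i E _ hE => (hF i).hasHamLCycle hne he hE)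
  have := LooseHam.sixteen_div_add_one_div_sqrt_le hε
    (by exact_mod_cast (by omega : 1 ≤ m)) hmε
  linarith
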